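/- Let G be a countable group. Then there exists a simple group S and an injective group homomorphism φ : G → S such that for all p, q ∈ {2, 3, 4, ...} ∪ {∞} with q ≥ 3, there exist elements x, y ∈ S where x has order p, y has order q, and S is generated by {x, y}. -/

import Mathlib

set_option linter.unusedSectionVars false
set_option linter.unusedSimpArgs false
set_option linter.flexible false
open scoped commutatorElement

section OneAddMem

variable {R : Type*} [Ring R] [CharP R 2]

/-- Some element of the subgroup `K` of units has the form `1 + m`. -/
def OneAddMem (K : Subgroup Rˣ) (m : R) : Prop := ∃ u ∈ K, (u : R) = 1 + m

theorem mul_reassoc {S : Type*} [Semigroup S] {x y z : S} (h : x * y = z) (w : S) :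
    x * (y * w) = z * w := by rw [← mul_assoc, h]

namespace OneAddMem

variable {K : Subgroup Rˣ} {m n : R}

theorem zero : OneAddMem K (0 : R) := ⟨1, K.one_mem, by simp⟩

theorem congr (hm : OneAddMem K m) (h : m = n) : OneAddMem K n := h ▸ hm

theorem add (hm : OneAddMem K m) (hn : OneAddMem K n) (h : m * n = 0) :
    OneAddMem K (m + n) := by
  obtain ⟨u, hu, hu'⟩ := hm
  obtain ⟨v, hv, hv'⟩ := hn
  refine ⟨u * v, K.mul_mem hu hv, ?_⟩
  rw [Units.val_mul, hu', hv', mul_add, add_mul, add_mul, h]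
  simp only [mul_one, one_mul]
  abel

theorem of_mul_eq {u v : Rˣ} (hu : u ∈ K) (hv : v ∈ K) (h : (u : R) = (1 + m) * v) :
    OneAddMem K m := by
  refine ⟨u * v⁻¹, K.mul_mem hu (K.inv_mem hv), ?_⟩
  rw [Units.val_mul, h, Units.mul_inv_cancel_right]

theorem mul (hm : OneAddMem K m) (hn : OneAddMem K n) (hnn : n * n = 0)
    (hnm : n * m = 0) : OneAddMem K (m * n) := by
  obtain ⟨u, hu, hu'⟩ := hm
  obtain ⟨v, hv, hv'⟩ := hn
  refine of_mul_eq (K.mul_mem hu hv) (K.mul_mem hv hu) ?_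
  simp only [Units.val_mul, hu', hv', mul_add, add_mul, mul_one, one_mul, mul_assoc, hnm, hnn,
    mul_zero, add_zero]
  abel

theorem conj (hm : OneAddMem K m) {u : Rˣ} (hu : u ∈ K) (h : (u : R) * m = n * u) :
    OneAddMem K n := by
  obtain ⟨v, hv, hv'⟩ := hm
  refine of_mul_eq (K.mul_mem hu hv) hu ?_
  rw [Units.val_mul, hv', mul_add, add_mul, h, mul_one, one_mul]

/-- Conjugating `1 + v ψ`. -/
theorem conj_mul {v v' ψ ψ' : R} (hm : OneAddMem K (v * ψ)) {u : R} (hu : ∃ w ∈ K, (w : R) = u)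
    (h : u * v = v') (h' : ψ' * u = ψ) : OneAddMem K (v' * ψ') := by
  obtain ⟨w, hw, rfl⟩ := hu
  exact hm.conj hw (by rw [← mul_assoc, h, mul_assoc, h'])

theorem conj_inv (hm : OneAddMem K m) {u : R} (hu : ∃ w ∈ K, (w : R) = u)
    (h : m * u = u * n) : OneAddMem K n := by
  obtain ⟨w, hw, rfl⟩ := hu
  refine hm.conj (K.inv_mem hw) ?_
  rw [Units.inv_mul_eq_iff_eq_mul, ← mul_assoc, ← h, Units.mul_inv_cancel_right]

theorem isolate_right {v φ χ k τ : R} (h : OneAddMem K (v * φ + k)) (hτ : ∃ w ∈ K, (w : R) = τ)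
    (hv : τ * v = v) (hk : τ * k = k * τ) (hχv : χ * v = 0) (hχk : χ * k = 0)
    (hφ : φ * τ = χ) (hχ : χ * τ = φ + χ) : OneAddMem K (v * φ) := by
  have key : OneAddMem K (v * χ) := by
    obtain ⟨u, hu, hu'⟩ := h
    obtain ⟨w, hw, rfl⟩ := hτ
    refine of_mul_eq (K.mul_mem hw hu) (K.mul_mem hu hw) ?_
    simp only [Units.val_mul, hu', mul_add, add_mul, mul_one, one_mul, mul_assoc, hφ, hχ,
      mul_reassoc hv, hk, mul_reassoc hχv, mul_reassoc hχk, zero_mul, mul_zero, add_zero,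
      hχv, hχk]
    simp only [add_assoc, add_comm, add_left_comm, CharTwo.add_cancel_left,
      CharTwo.add_self_eq_zero, add_zero]
  exact key.conj_mul hτ hv hφ

theorem isolate_left {v ψ k τ : R} (h : OneAddMem K (v * ψ + k)) (hτ : ∃ w ∈ K, (w : R) = τ)
    (hv : v + τ * v + τ * (τ * v) = 0) (hk : τ * k = k * τ) (hψv : ψ * v = 0) (hψk : ψ * k = 0)
    (hψ : ψ * τ = ψ) : OneAddMem K (v * ψ) := by
  have hv1 : τ * (τ * v) = v + τ * v := by
    rw [← CharTwo.add_eq_zero, ← hv]; abel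
  have key : OneAddMem K (τ * (τ * v) * ψ) := by
    obtain ⟨u, hu, hu'⟩ := h
    obtain ⟨w, hw, rfl⟩ := hτ
    refine of_mul_eq (K.mul_mem hw hu) (K.mul_mem hu hw) ?_
    simp only [Units.val_mul, hu', mul_add, add_mul, mul_one, one_mul, mul_assoc, hψ, hv1, hk,
      mul_reassoc hψv, mul_reassoc hψk, zero_mul, mul_zero, add_zero]
    simp only [add_assoc, add_comm, add_left_comm, CharTwo.add_cancel_left,
      CharTwo.add_self_eq_zero, add_zero]
  refine key.conj_mul hτ ?_ hψ
  rw [hv1, mul_add, hv1, add_left_comm, CharTwo.add_self_eq_zero, add_zero]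

end OneAddMem

end OneAddMem

section Commutators

theorem commutatorElement_mul_mul_of_commute {G : Type*} [Group G] {A X B Y : G}
    (hAX : Commute A X) (hAY : Commute A Y) (hBX : Commute B X) (hBY : Commute B Y) :
    ⁅A * X, B * Y⁆ = ⁅A, B⁆ * ⁅X, Y⁆ := by
  have h1 : Commute (A * B) (X * Y) :=
    (hAX.mul_right hAY).mul_left (hBX.mul_right hBY)
  have h2 : Commute (B * A) (⁅X, Y⁆) := by
    have h3 : Commute (B * A) X := hBX.mul_left hAX
    have h4 : Commute (B * A) Y := hBY.mul_left hAY
    exact ((h3.mul_right h4).mul_right h3.inv_right).mul_right h4.inv_right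
  have h5 : A * X * (B * Y) = ⁅A, B⁆ * ⁅X, Y⁆ * (B * Y * (A * X)) := by
    calc A * X * (B * Y) = A * B * (X * Y) := by
          rw [mul_assoc, ← mul_assoc X, ← hBX.eq]; simp only [mul_assoc]
      _ = ⁅A, B⁆ * (B * A) * (⁅X, Y⁆ * (Y * X)) := by
          simp only [commutatorElement_def]; group
      _ = ⁅A, B⁆ * ⁅X, Y⁆ * (B * A * (Y * X)) := by
          rw [mul_assoc, ← mul_assoc (B * A), h2.eq]; simp only [mul_assoc]
      _ = ⁅A, B⁆ * ⁅X, Y⁆ * (B * Y * (A * X)) := by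
          rw [mul_assoc B A, ← mul_assoc A Y, hAY.eq]; simp only [mul_assoc]
  rw [commutatorElement_def, mul_assoc _ (A * X)⁻¹, ← mul_inv_rev, h5, mul_inv_cancel_right]

end Commutators

section RingLemmas

variable {R : Type*} [Ring R] [CharP R 2]

theorem val_commutatorElement_eq {A B : Rˣ} {w : R} (h : (A : R) * B = w * (B * A)) :
    ((⁅A, B⁆ : Rˣ) : R) = w := by
  rw [commutatorElement_def, mul_assoc _ A⁻¹, ← mul_inv_rev, Units.val_mul, Units.val_mul, h,
    ← Units.val_mul B A, mul_assoc, Units.mul_inv, mul_one]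

/-- The unit `1 + v ψ` when `ψ v - 1` is a unit (in characteristic two). -/
def reflection (v ψ : R) (u : Rˣ) (h : ψ * v = u + 1) : Rˣ where
  val := 1 + v * ψ
  inv := 1 + v * (↑u⁻¹ * ψ)
  val_inv := by
    simp only [mul_add, add_mul, mul_one, one_mul, mul_assoc, mul_reassoc h,
      Units.mul_inv_cancel_left]
    simp only [add_assoc, add_comm, add_left_comm, CharTwo.add_cancel_left,
      CharTwo.add_self_eq_zero, add_zero]
  inv_val := by
    simp only [mul_add, add_mul, mul_one, one_mul, mul_assoc, mul_reassoc h,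
      Units.inv_mul_cancel_left]
    simp only [add_assoc, add_comm, add_left_comm, CharTwo.add_cancel_left,
      CharTwo.add_self_eq_zero, add_zero]

@[simp] theorem val_reflection (v ψ : R) (u : Rˣ) (h : ψ * v = u + 1) :
    (reflection v ψ u h : R) = 1 + v * ψ := rfl

theorem reflection_commute {v ψ v' ψ' : R} {u u' : Rˣ} (h : ψ * v = u + 1) (h' : ψ' * v' = u' + 1)
    (h1 : ψ * v' = 0) (h2 : ψ' * v = 0) :
    Commute (reflection v ψ u h) (reflection v' ψ' u' h') := by
  apply Units.ext
  simp only [Units.val_mul, val_reflection, mul_add, add_mul, mul_one, one_mul, mul_assoc,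
    mul_reassoc h1, mul_reassoc h2, zero_mul, mul_zero]
  abel

/-- The commutator of two reflections. -/
theorem reflection_commutator {a b φ χ z₁ z₂ : R} {t : Rˣ} (hφa : φ * a = t + 1)
    (hφb : φ * b = 1) (hχa : χ * a = 1) (hχb : χ * b = t + 1)
    (ha : a = z₁ * (t + 1) + z₂) (hb : b = z₁ + z₂ * (t + 1)) :
    ((⁅reflection a φ t hφa, reflection b χ t hχb⁆ : Rˣ) : R)
      = 1 + z₁ * (φ + χ) + z₂ * φ := by
  apply val_commutatorElement_eq
  simp only [val_reflection, mul_add, add_mul, mul_one, one_mul, mul_assoc,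
    mul_reassoc hφa, mul_reassoc hφb, mul_reassoc hχa, mul_reassoc hχb]
  have h1 : a * χ = z₁ * (t * χ) + z₁ * χ + z₂ * χ := by
    rw [ha]; simp only [mul_add, add_mul, mul_one, mul_assoc]
  have h2 : b * φ = z₁ * φ + z₂ * (t * φ) + z₂ * φ := by
    rw [hb]; simp only [mul_add, add_mul, mul_one, mul_assoc, add_assoc]
  have h3 : a * φ = z₁ * (t * φ) + z₁ * φ + z₂ * φ := by
    rw [ha]; simp only [mul_add, add_mul, mul_one, mul_assoc]
  have h4 : b * χ = z₁ * χ + z₂ * (t * χ) + z₂ * χ := by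
    rw [hb]; simp only [mul_add, add_mul, mul_one, mul_assoc, add_assoc]
  rw [h1, h2, h3, h4]
  simp only [add_assoc, add_comm, add_left_comm, CharTwo.add_cancel_left,
      CharTwo.add_self_eq_zero, add_zero]

/-- The commutator of two products of two reflections, arranged block triangularly. -/
theorem reflection_commutator_block {a b c c' φ χ γ γ' β ρ κ : R} {t T : Rˣ}
    (hχb : χ * b = t + 1) (hγc : γ * c = T + 1) (hφa : φ * a = t + 1) (hγc' : γ' * c' = T + 1)
    (hχc : χ * c = 0) (hφc' : φ * c' = 0) (hγa' : γ' * a = 0)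
    (h1 : χ * a = t) (h2 : χ * c' = β * T) (h3 : γ * a = ρ * t) (h4 : γ * c' = κ * T)
    (h5 : φ * b = 0) (h6 : φ * c = 0) (h7 : γ' * b = 0) (h8 : γ' * c = 0) :
    ((⁅reflection b χ t hχb * reflection c γ T hγc,
      reflection a φ t hφa * reflection c' γ' T hγc'⁆ : Rˣ) : R)
      = 1 + (b * (φ + β * γ') + c * (ρ * φ + κ * γ')) := by
  apply val_commutatorElement_eq
  simp only [Units.val_mul, val_reflection, mul_add, add_mul, mul_one, one_mul, mul_assoc,
    mul_reassoc hχb, mul_reassoc hγc, mul_reassoc hφa, mul_reassoc hγc', mul_reassoc hχc,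
    mul_reassoc hφc', mul_reassoc hγa', mul_reassoc h1, mul_reassoc h2,
    mul_reassoc h3, mul_reassoc h4, mul_reassoc h5, mul_reassoc h6, mul_reassoc h7,
    mul_reassoc h8, zero_mul, mul_zero, add_zero]
  simp only [add_assoc, add_comm, add_left_comm, CharTwo.add_cancel_left,
      CharTwo.add_self_eq_zero, add_zero]

end RingLemmas

/-- Columns `a i, b i, c i` and rows `φ i, χ i, γ i` with prescribed products. -/
structure GramData (R : Type*) [Ring R] (q : ℤ) where
  (a b c φ χ γ : ℤ → R)
  (t T : Rˣ)
  (β κ ρ : R)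
  three_le : 3 ≤ q
  b_congr : ∀ i j, q ∣ j - i → b i = b j
  φ_congr : ∀ i j, q ∣ j - i → φ i = φ j
  φ_a : ∀ i j, j = i → φ i * a j = t + 1
  φ_a_zero : ∀ i j, ¬ q ∣ j - i → φ i * a j = 0
  φ_b : ∀ i j, j = i + 1 → φ i * b j = 1
  φ_b_zero : ∀ i j, ¬ q ∣ j - i - 1 → φ i * b j = 0
  φ_c : ∀ i j, φ i * c j = 0
  χ_a_left : ∀ i j, j = i - 1 → χ i * a j = 1
  χ_a_right : ∀ i j, j = i + 1 → χ i * a j = t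
  χ_a_zero : ∀ i j, ¬ q ∣ j - i - 1 → ¬ q ∣ j - i + 1 → χ i * a j = 0
  χ_b : ∀ i j, j = i → χ i * b j = t + 1
  χ_b_zero : ∀ i j, ¬ q ∣ j - i → χ i * b j = 0
  χ_c : ∀ i j, j = i + 1 → χ i * c j = β * T
  χ_c_zero : ∀ i j, ¬ q ∣ j - i - 1 → χ i * c j = 0
  γ_a : ∀ i j, j = i + 1 → γ i * a j = ρ * t
  γ_a_zero : ∀ i j, ¬ q ∣ j - i - 1 → γ i * a j = 0
  γ_b : ∀ i j, γ i * b j = 0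
  γ_c : ∀ i j, j = i → γ i * c j = T + 1
  γ_c_right : ∀ i j, j = i + 1 → γ i * c j = κ * T
  γ_c_zero : ∀ i j, ¬ q ∣ j - i → ¬ q ∣ j - i - 1 → γ i * c j = 0
  β_ρ : β * ρ = 1

theorem not_dvd_of_lt {q n : ℤ} (h0 : n ≠ 0) (h1 : n < q) (h2 : -q < n) : ¬ q ∣ n := by
  intro h
  exact h0 (Int.eq_zero_of_abs_lt_dvd h (abs_lt.2 ⟨h2, h1⟩))

namespace GramData

variable {R : Type*} [Ring R] [CharP R 2] {q : ℤ} (D : GramData R q) (K : Subgroup Rˣ)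

/-- `x i - 1`. -/
def off (i : ℤ) : R := D.a i * D.φ i + D.b i * D.χ i + D.c i * D.γ i

/-- The coordinate vector dual to `φ i` in the span of `a i` and `b (i + 1)`. -/
def z₁ (i : ℤ) : R := (D.a i * (D.t + 1) + D.b (i + 1)) * (↑D.t⁻¹ * ↑D.t⁻¹)

/-- The coordinate vector dual to `χ (i + 1)` in the span of `a i` and `b (i + 1)`. -/
def z₂ (i : ℤ) : R := (D.a i + D.b (i + 1) * (D.t + 1)) * (↑D.t⁻¹ * ↑D.t⁻¹)

/-- The commutator of the reflections at `a i` and `b (i + 1)`. -/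
def τ (i : ℤ) : R := 1 + D.z₁ i * (D.φ i + D.χ (i + 1)) + D.z₂ i * D.φ i

theorem φ_z₁ (i : ℤ) : D.φ i * D.z₁ i = 1 := by
  rw [z₁, ← mul_assoc, mul_add, mul_reassoc (D.φ_a i i rfl), D.φ_b i _ rfl]
  have h : ((D.t : R) + 1) * (D.t + 1) + 1 = D.t * D.t := by
    simp only [mul_add, add_mul, mul_one, one_mul, add_assoc, add_comm, add_left_comm,
      CharTwo.add_cancel_left, CharTwo.add_self_eq_zero, add_zero, zero_add, mul_zero, one_mul]
  rw [h]
  simp [mul_assoc]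

theorem χ_z₂ (i : ℤ) : D.χ (i + 1) * D.z₂ i = 1 := by
  rw [z₂, ← mul_assoc, mul_add, mul_reassoc (D.χ_b (i + 1) (i + 1) rfl),
    D.χ_a_left (i + 1) i (by omega)]
  have h : 1 + ((D.t : R) + 1) * (D.t + 1) = D.t * D.t := by
    simp only [mul_add, add_mul, mul_one, one_mul, add_assoc, add_comm, add_left_comm,
      CharTwo.add_cancel_left, CharTwo.add_self_eq_zero, add_zero, zero_add, mul_zero, one_mul]
  rw [h]
  simp [mul_assoc]

theorem χ_z₁ (i : ℤ) : D.χ (i + 1) * D.z₁ i = 0 := by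
  rw [z₁, ← mul_assoc, mul_add, mul_reassoc (D.χ_a_left (i + 1) i (by omega)),
    D.χ_b (i + 1) _ rfl, one_mul, CharTwo.add_self_eq_zero, zero_mul]

theorem φ_z₂ (i : ℤ) : D.φ i * D.z₂ i = 0 := by
  rw [z₂, ← mul_assoc, mul_add, mul_reassoc (D.φ_b i _ rfl),
    D.φ_a i _ rfl, one_mul, CharTwo.add_self_eq_zero, zero_mul]

theorem a_eq (i : ℤ) : D.a i = D.z₁ i * (D.t + 1) + D.z₂ i := by
  have h : (↑D.t⁻¹ * ↑D.t⁻¹ : R) * (D.t + 1) = (D.t + 1) * (↑D.t⁻¹ * ↑D.t⁻¹) := by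
    simp [mul_add, add_mul, mul_assoc]
  have h2 : ((D.t : R) + 1) * (D.t + 1) + 1 = D.t * D.t := by
    simp only [mul_add, add_mul, mul_one, one_mul, add_assoc, add_comm, add_left_comm,
      CharTwo.add_cancel_left, CharTwo.add_self_eq_zero, add_zero, zero_add, mul_zero, one_mul]
  rw [z₁, z₂, mul_assoc, h, ← mul_assoc, ← add_mul]
  have h3 : (D.a i * (D.t + 1) + D.b (i + 1)) * ((D.t : R) + 1)
      + (D.a i + D.b (i + 1) * (D.t + 1)) = D.a i * (D.t * D.t) := by
    rw [← h2]
    simp only [mul_add, add_mul, mul_one, mul_assoc, add_assoc, add_comm, add_left_comm,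
      CharTwo.add_cancel_left, CharTwo.add_self_eq_zero, add_zero, zero_add, mul_zero, one_mul]
  rw [h3]
  simp [mul_assoc]

theorem b_eq (i : ℤ) : D.b (i + 1) = D.z₁ i + D.z₂ i * (D.t + 1) := by
  have h : (↑D.t⁻¹ * ↑D.t⁻¹ : R) * (D.t + 1) = (D.t + 1) * (↑D.t⁻¹ * ↑D.t⁻¹) := by
    simp [mul_add, add_mul, mul_assoc]
  have h2 : ((D.t : R) + 1) * (D.t + 1) + 1 = D.t * D.t := by
    simp only [mul_add, add_mul, mul_one, one_mul, add_assoc, add_comm, add_left_comm,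
      CharTwo.add_cancel_left, CharTwo.add_self_eq_zero, add_zero, zero_add, mul_zero, one_mul]
  rw [z₁, z₂, mul_assoc _ _ ((D.t : R) + 1), h, ← mul_assoc _ ((D.t : R) + 1), ← add_mul]
  have h3 : (D.a i * (D.t + 1) + D.b (i + 1))
      + (D.a i + D.b (i + 1) * (D.t + 1)) * ((D.t : R) + 1) = D.b (i + 1) * (D.t * D.t) := by
    rw [← h2]
    simp only [mul_add, add_mul, mul_one, mul_assoc, add_assoc, add_comm, add_left_comm,
      CharTwo.add_cancel_left, CharTwo.add_self_eq_zero, add_zero, zero_add, mul_zero, one_mul]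
  rw [h3]
  simp [mul_assoc]

theorem φ_τ (i : ℤ) : D.φ i * D.τ i = D.χ (i + 1) := by
  simp only [τ, mul_add, mul_one, mul_reassoc (D.φ_z₁ i), mul_reassoc (D.φ_z₂ i), one_mul,
    zero_mul, add_zero, CharTwo.add_cancel_left]

theorem χ_τ (i : ℤ) : D.χ (i + 1) * D.τ i = D.φ i + D.χ (i + 1) := by
  simp only [τ, mul_add, mul_one, mul_reassoc (D.χ_z₁ i), mul_reassoc (D.χ_z₂ i), one_mul,
    zero_mul, add_zero, zero_add]
  exact add_comm _ _

theorem τ_z₁ (i : ℤ) : D.τ i * D.z₁ i = D.z₂ i := by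
  simp only [τ, add_mul, one_mul, mul_assoc, mul_add, D.φ_z₁, D.χ_z₁, mul_one, mul_zero, add_zero,
    CharTwo.add_self_eq_zero, zero_add]

theorem τ_z₂ (i : ℤ) : D.τ i * D.z₂ i = D.z₁ i + D.z₂ i := by
  simp only [τ, add_mul, one_mul, mul_assoc, mul_add, D.φ_z₂, D.χ_z₂, mul_one, mul_zero, add_zero,
    zero_add]
  exact add_comm _ _

theorem τ_cube (i : ℤ) : D.τ i * D.τ i * D.τ i = 1 := by
  have h : D.τ i * D.τ i = 1 + D.z₁ i * D.χ (i + 1) + D.z₂ i * (D.φ i + D.χ (i + 1)) := by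
    conv_lhs => enter [1]; rw [τ]
    simp only [add_mul, mul_assoc, D.φ_τ, D.χ_τ, one_mul]
    rw [τ]
    simp only [mul_add, add_assoc, add_comm, add_left_comm,
      CharTwo.add_cancel_left, CharTwo.add_self_eq_zero, add_zero, zero_add, mul_zero, one_mul]
  rw [h]
  simp only [add_mul, mul_assoc, D.φ_τ, D.χ_τ, one_mul]
  rw [τ]
  simp only [mul_add, add_assoc, add_comm, add_left_comm,
      CharTwo.add_cancel_left, CharTwo.add_self_eq_zero, add_zero, zero_add, mul_zero, one_mul]

theorem τ_orbit_b (i : ℤ) : D.b (i + 1) + D.τ i * D.b (i + 1) + D.τ i * (D.τ i * D.b (i + 1)) = 0 := by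
  simp only [D.b_eq, mul_add, add_mul, ← mul_assoc, τ_z₁, τ_z₂, mul_one]
  simp only [D.τ_z₁, D.τ_z₂, add_assoc, add_comm, add_left_comm,
      CharTwo.add_cancel_left, CharTwo.add_self_eq_zero, add_zero, zero_add, mul_zero, one_mul]

theorem τ_fix {i : ℤ} {v : R} (h : D.φ i * v = 0) (h' : D.χ (i + 1) * v = 0) : D.τ i * v = v := by
  simp [τ, add_mul, mul_assoc, h, h']

theorem fix_τ {i : ℤ} {ψ : R} (h : ψ * D.a i = 0) (h' : ψ * D.b (i + 1) = 0) :
    ψ * D.τ i = ψ := by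
  have h1 : ψ * D.z₁ i = 0 := by
    rw [z₁, ← mul_assoc, mul_add, mul_reassoc h, h', zero_mul, add_zero, zero_mul]
  have h2 : ψ * D.z₂ i = 0 := by
    rw [z₂, ← mul_assoc, mul_add, mul_reassoc h', h, zero_mul, add_zero, zero_mul]
  simp [τ, mul_add, ← mul_assoc, h1, h2]

/-- `Z i - 1` for the second factor `Z i` of the commutator of `x i` and `x (i + 1)`. -/
def zOff (i : ℤ) : R :=
  D.b i * (D.φ (i + 1) + D.β * D.γ (i + 1)) + D.c i * (D.ρ * D.φ (i + 1) + D.κ * D.γ (i + 1))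

variable {K}

theorem zOff_sq (i : ℤ) : D.zOff i * D.zOff i = 0 := by
  have hq := D.three_le
  have h1 := D.φ_b_zero (i + 1) i (not_dvd_of_lt (by omega) (by omega) (by omega))
  have h2 := D.φ_c (i + 1) i
  have h3 := D.γ_b (i + 1) i
  have h4 := D.γ_c_zero (i + 1) i (not_dvd_of_lt (by omega) (by omega) (by omega))
    (not_dvd_of_lt (by omega) (by omega) (by omega))
  simp only [zOff, add_mul, mul_add, mul_assoc, mul_reassoc h1, mul_reassoc h2, mul_reassoc h3,
    mul_reassoc h4, zero_mul, mul_zero, add_zero]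

theorem τ_mem_and_zOff_mem (hx : ∀ i, OneAddMem K (D.off i)) (i : ℤ) :
    (∃ w ∈ K, (w : R) = D.τ i) ∧ OneAddMem K (D.zOff i) := by
  have hq := D.three_le
  have nd : ∀ n : ℤ, n ≠ 0 → n < 3 → -3 < n → ¬ q ∣ n :=
    fun n h0 h1 h2 => not_dvd_of_lt h0 (by omega) (by omega)
  set A := reflection (D.a i) (D.φ i) D.t (D.φ_a i i rfl)
  set B := reflection (D.b i) (D.χ i) D.t (D.χ_b i i rfl)
  set C := reflection (D.c i) (D.γ i) D.T (D.γ_c i i rfl)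
  set A' := reflection (D.a (i + 1)) (D.φ (i + 1)) D.t (D.φ_a _ _ rfl)
  set B' := reflection (D.b (i + 1)) (D.χ (i + 1)) D.t (D.χ_b _ _ rfl)
  set C' := reflection (D.c (i + 1)) (D.γ (i + 1)) D.T (D.γ_c _ _ rfl)
  have hφb : ∀ i, D.φ i * D.b i = 0 := fun i =>
    D.φ_b_zero _ _ (nd _ (by omega) (by omega) (by omega))
  have hχa : ∀ i, D.χ i * D.a i = 0 := fun i =>
    D.χ_a_zero _ _ (nd _ (by omega) (by omega) (by omega)) (nd _ (by omega) (by omega) (by omega))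
  have hχc : ∀ i, D.χ i * D.c i = 0 := fun i =>
    D.χ_c_zero _ _ (nd _ (by omega) (by omega) (by omega))
  have hγa : ∀ i, D.γ i * D.a i = 0 := fun i =>
    D.γ_a_zero _ _ (nd _ (by omega) (by omega) (by omega))
  have hx1 : ((A * (B * C) : Rˣ) : R) = 1 + D.off i := by
    simp only [A, B, C, Units.val_mul, val_reflection, off, mul_add, add_mul, mul_one, one_mul,
      mul_assoc, mul_reassoc (hφb i), mul_reassoc (D.φ_c i i), mul_reassoc (hχc i), zero_mul,
      mul_zero, add_zero]
    abel
  have hx2 : ((B' * (A' * C') : Rˣ) : R) = 1 + D.off (i + 1) := by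
    simp only [A', B', C', Units.val_mul, val_reflection, off, mul_add, add_mul, mul_one, one_mul,
      mul_assoc, mul_reassoc (hχa (i + 1)), mul_reassoc (D.φ_c (i + 1) (i + 1)),
      mul_reassoc (hχc (i + 1)), zero_mul, mul_zero, add_zero]
    abel
  have m1 : A * (B * C) ∈ K := by
    obtain ⟨u, hu, hu'⟩ := hx i
    rwa [show A * (B * C) = u from Units.ext (hx1.trans hu'.symm)]
  have m2 : B' * (A' * C') ∈ K := by
    obtain ⟨u, hu, hu'⟩ := hx (i + 1)
    rwa [show B' * (A' * C') = u from Units.ext (hx2.trans hu'.symm)]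
  have cAB : Commute A B := reflection_commute _ _ (hφb i) (hχa i)
  have cAC : Commute A C := reflection_commute _ _ (D.φ_c _ _) (hγa i)
  have cAA' : Commute A A' := reflection_commute _ _
    (D.φ_a_zero _ _ (nd _ (by omega) (by omega) (by omega)))
    (D.φ_a_zero _ _ (nd _ (by omega) (by omega) (by omega)))
  have cAC' : Commute A C' := reflection_commute _ _ (D.φ_c _ _)
    (D.γ_a_zero _ _ (nd _ (by omega) (by omega) (by omega)))
  have cB'B : Commute B' B := reflection_commute _ _
    (D.χ_b_zero _ _ (nd _ (by omega) (by omega) (by omega)))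
    (D.χ_b_zero _ _ (nd _ (by omega) (by omega) (by omega)))
  have cB'C : Commute B' C := reflection_commute _ _
    (D.χ_c_zero _ _ (nd _ (by omega) (by omega) (by omega))) (D.γ_b _ _)
  have cB'A' : Commute B' A' := reflection_commute _ _ (hχa _) (hφb _)
  have cB'C' : Commute B' C' := reflection_commute _ _ (hχc _) (D.γ_b _ _)
  have hτ : ((⁅A, B'⁆ : Rˣ) : R) = D.τ i :=
    reflection_commutator (D.φ_a i i rfl) (D.φ_b i _ rfl) (D.χ_a_left _ _ (by omega))
      (D.χ_b _ _ rfl) (D.a_eq i) (D.b_eq i)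
  have hZ : ((⁅B * C, A' * C'⁆ : Rˣ) : R) = 1 + D.zOff i :=
    reflection_commutator_block (D.χ_b i i rfl) (D.γ_c i i rfl) (D.φ_a _ _ rfl) (D.γ_c _ _ rfl)
      (hχc i) (D.φ_c _ _) (hγa _) (D.χ_a_right _ _ rfl) (D.χ_c _ _ rfl) (D.γ_a _ _ rfl)
      (D.γ_c_right _ _ rfl) (D.φ_b_zero _ _ (nd _ (by omega) (by omega) (by omega)))
      (D.φ_c _ _) (D.γ_b _ _)
      (D.γ_c_zero _ _ (nd _ (by omega) (by omega) (by omega))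
        (nd _ (by omega) (by omega) (by omega)))
  have hsplit : ⁅A * (B * C), B' * (A' * C')⁆ = ⁅A, B'⁆ * ⁅B * C, A' * C'⁆ :=
    commutatorElement_mul_mul_of_commute (cAB.mul_right cAC) (cAA'.mul_right cAC')
      (cB'B.mul_right cB'C) (cB'A'.mul_right cB'C')
  have hcomm : Commute ⁅A, B'⁆ ⁅B * C, A' * C'⁆ := by
    have e1 : ∀ {X Y Z W : Rˣ}, Commute X Z → Commute X W → Commute Y Z → Commute Y W →
        Commute ⁅X, Y⁆ ⁅Z, W⁆ := by
      intro X Y Z W h1 h2 h3 h4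
      have e2 : ∀ {V : Rˣ}, Commute X V → Commute Y V → Commute ⁅X, Y⁆ V := fun hX hY =>
        ((hX.mul_left hY).mul_left hX.inv_left).mul_left hY.inv_left
      have e3 := e2 h1 h3
      have e4 := e2 h2 h4
      exact ((e3.mul_right e4).mul_right e3.inv_right).mul_right e4.inv_right
    exact e1 (cAB.mul_right cAC) (cAA'.mul_right cAC') (cB'B.mul_right cB'C)
      (cB'A'.mul_right cB'C')
  have hmem : ⁅A, B'⁆ * ⁅B * C, A' * C'⁆ ∈ K := by
    rw [← hsplit, commutatorElement_def]
    exact K.mul_mem (K.mul_mem (K.mul_mem m1 m2) (K.inv_mem m1)) (K.inv_mem m2)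
  have hτ3 : ⁅A, B'⁆ ^ 3 = 1 := by
    apply Units.ext
    rw [pow_succ, pow_two, Units.val_mul, Units.val_mul, hτ, D.τ_cube, Units.val_one]
  have hZ2 : ⁅B * C, A' * C'⁆ ^ 2 = 1 := by
    apply Units.ext
    rw [pow_two, Units.val_mul, hZ, mul_add, add_mul, add_mul, D.zOff_sq]
    simp [add_assoc, CharTwo.add_self_eq_zero]
  constructor
  · refine ⟨⁅A, B'⁆, ?_, hτ⟩
    have := K.pow_mem hmem 4
    rwa [hcomm.mul_pow, show 4 = 3 + 1 from rfl, pow_succ, hτ3, one_mul,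
      show 3 + 1 = 2 * 2 from rfl, pow_mul _ 2 2, hZ2, one_pow, mul_one] at this
  · refine ⟨⁅B * C, A' * C'⁆, ?_, hZ⟩
    have := K.pow_mem hmem 3
    rwa [hcomm.mul_pow, hτ3, one_mul, pow_succ, hZ2, one_mul] at this

end GramData

namespace GramData

variable {R : Type*} [Ring R] [CharP R 2] {q : ℤ} (D : GramData R q) {K : Subgroup Rˣ}

theorem not_dvd_small {R : Type*} [Ring R] {q : ℤ} (D : GramData R q) {n : ℤ} (h0 : n ≠ 0) (h1 : n < 3) (h2 : -3 < n) : ¬ q ∣ n :=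
  not_dvd_of_lt h0 (by have := D.three_le; omega) (by have := D.three_le; omega)

theorem zOff_eq (i : ℤ) : D.zOff i = (D.b i + D.c i * D.ρ) * D.φ (i + 1)
    + (D.b i * D.β + D.c i * D.κ) * D.γ (i + 1) := by
  simp only [zOff, mul_add, add_mul, mul_assoc]
  abel

theorem mul_b_add_c {ψ : R} {i : ℤ} (r s : R) (hb : ψ * D.b i = 0) (hc : ψ * D.c i = 0) :
    ψ * (D.b i * r + D.c i * s) = 0 := by
  rw [mul_add, mul_reassoc hb, mul_reassoc hc]; simp

/-- The part of `zOff` ending in `φ`, when the period is at least four. -/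
theorem zOff_φ_mem (hx : ∀ i, OneAddMem K (D.off i)) (hq : 4 ≤ q) (i : ℤ) :
    OneAddMem K ((D.b i + D.c i * D.ρ) * D.φ (i + 1)) := by
  have h1 := D.φ_b_zero (i + 1) i (D.not_dvd_small (by omega) (by omega) (by omega))
  have h2 := D.χ_b_zero (i + 1 + 1) i (D.not_dvd_small (by omega) (by omega) (by omega))
  have h3 := D.χ_c_zero (i + 1 + 1) i (not_dvd_of_lt (by omega) (by omega) (by omega))
  have h4 := D.γ_a_zero (i + 1) (i + 1) (D.not_dvd_small (by omega) (by omega) (by omega))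
  have e1 : D.b i + D.c i * D.ρ = D.b i * 1 + D.c i * D.ρ := by rw [mul_one]
  have h5 := D.mul_b_add_c 1 D.ρ h1 (D.φ_c (i + 1) i)
  have h6 := D.mul_b_add_c 1 D.ρ h2 h3
  have h7 := D.mul_b_add_c D.β D.κ h1 (D.φ_c (i + 1) i)
  have h8 := D.mul_b_add_c D.β D.κ h2 h3
  have hZ := (D.τ_mem_and_zOff_mem hx i).2
  rw [zOff_eq, e1] at hZ
  rw [e1]
  refine hZ.isolate_right (D.τ_mem_and_zOff_mem hx (i + 1)).1 (D.τ_fix h5 h6) ?_ h6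
    (by rw [mul_reassoc h8, zero_mul]) (D.φ_τ (i + 1)) (D.χ_τ (i + 1))
  rw [mul_reassoc (D.τ_fix h7 h8), mul_assoc, D.fix_τ h4 (D.γ_b _ _)]

theorem b_φ_succ_mem_of_four_le (hx : ∀ i, OneAddMem K (D.off i)) (hq : 4 ≤ q) (i : ℤ) :
    OneAddMem K (D.b i * D.φ (i + 1)) := by
  obtain ⟨j, rfl⟩ : ∃ j, i = j + 1 := ⟨i - 1, by omega⟩
  have hN := D.zOff_φ_mem hx hq (j + 1)
  rw [add_mul] at hN
  have h1 := D.φ_b_zero (j + 1 + 1) (j + 1) (D.not_dvd_small (by omega) (by omega) (by omega))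
  have h2 := D.φ_a_zero (j + 1 + 1) j (D.not_dvd_small (by omega) (by omega) (by omega))
  have h3 := D.χ_c_zero (j + 1) (j + 1) (D.not_dvd_small (by omega) (by omega) (by omega))
  have h4 : D.τ j * D.c (j + 1) = D.c (j + 1) := D.τ_fix (D.φ_c _ _) h3
  have h5 : D.φ (j + 1 + 1) * D.τ j = D.φ (j + 1 + 1) := D.fix_τ h2 h1
  refine hN.isolate_left (D.τ_mem_and_zOff_mem hx j).1 (D.τ_orbit_b j) ?_ h1 ?_ h5
  · rw [mul_assoc, mul_reassoc h4, mul_assoc, mul_assoc, h5]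
  · rw [mul_assoc, mul_reassoc (D.φ_c _ _), zero_mul]

theorem b_φ_succ_mem_of_eq_three (hx : ∀ i, OneAddMem K (D.off i)) (hq : q = 3) (ht : D.t = 1)
    (i : ℤ) : OneAddMem K (D.b i * D.φ (i + 1)) := by
  obtain ⟨j, rfl⟩ : ∃ j, i = j + 1 := ⟨i - 1, by omega⟩
  have hz1 : ∀ i, D.z₁ i = D.b (i + 1) := fun i => by
    simp [z₁, ht, CharTwo.add_self_eq_zero]
  have hz2 : ∀ i, D.z₂ i = D.a i := fun i => by
    simp [z₂, ht, CharTwo.add_self_eq_zero]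
  have nd : ∀ {n : ℤ}, n ≠ 0 → n < 3 → -3 < n → ¬ q ∣ n := fun h0 h1 h2 =>
    D.not_dvd_small h0 h1 h2
  have nd' : ∀ {n : ℤ}, ¬ (3 : ℤ) ∣ n → ¬ q ∣ n := fun h => by rwa [hq]
  -- products of rows of `τ j` with columns of `τ (j + 2)`
  have e1 : D.φ j * D.b (j + 2 + 1) = 0 := D.φ_b_zero _ _ (nd (by omega) (by omega) (by omega))
  have e2 : D.φ j * D.a (j + 2) = 0 := D.φ_a_zero _ _ (nd (by omega) (by omega) (by omega))
  have e3 : D.χ (j + 1) * D.b (j + 2 + 1) = 0 :=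
    D.χ_b_zero _ _ (nd (by omega) (by omega) (by omega))
  have e4 : D.χ (j + 1) * D.a (j + 2) = 1 := by
    rw [D.χ_a_right _ _ (by omega), ht, Units.val_one]
  have e5 : D.φ (j + 2) * D.b (j + 1) = 0 := D.φ_b_zero _ _ (nd (by omega) (by omega) (by omega))
  have e6 : D.φ (j + 2) * D.a j = 0 := D.φ_a_zero _ _ (nd (by omega) (by omega) (by omega))
  have e7 : D.χ (j + 2 + 1) * D.b (j + 1) = 0 :=
    D.χ_b_zero _ _ (nd (by omega) (by omega) (by omega))
  have e8 : D.χ (j + 2 + 1) * D.a j = 0 :=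
    D.χ_a_zero _ _ (nd' (by omega)) (nd' (by omega))
  have hfix : D.τ (j + 2) * D.b (j + 1) = D.b (j + 1) := D.τ_fix e5 e7
  obtain ⟨u, hu, hu'⟩ := (D.τ_mem_and_zOff_mem hx j).1
  obtain ⟨v, hv, hv'⟩ := (D.τ_mem_and_zOff_mem hx (j + 2)).1
  have key : OneAddMem K (D.b (j + 1) * (D.φ (j + 2) + D.χ (j + 2 + 1))) := by
    refine OneAddMem.of_mul_eq (K.mul_mem hu hv) (K.mul_mem hv hu) ?_
    have hl : (D.φ (j + 2) + D.χ (j + 2 + 1)) * D.τ (j + 2) = D.φ (j + 2) := by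
      rw [add_mul, D.φ_τ, D.χ_τ, add_left_comm, CharTwo.add_self_eq_zero, add_zero]
    rw [Units.val_mul, Units.val_mul, hu', hv', add_mul, one_mul, mul_assoc (D.b (j + 1)),
      mul_reassoc hl, D.fix_τ e6 e5]
    simp only [τ, hz1, hz2, mul_add, add_mul, mul_one, one_mul, mul_assoc, mul_reassoc e1,
      mul_reassoc e2, mul_reassoc e3, mul_reassoc e4, mul_reassoc e5, mul_reassoc e6,
      mul_reassoc e7, mul_reassoc e8, zero_mul, mul_zero, add_zero]
    abel
  have hτ : ∃ w ∈ K, (w : R) = D.τ (j + 2) := ⟨v, hv, hv'⟩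
  rw [show j + 1 + 1 = j + 2 by ring]
  refine OneAddMem.conj_mul (OneAddMem.conj_mul key hτ hfix (D.χ_τ _)) hτ hfix (D.φ_τ _)

/-- The hypotheses under which the construction works. -/
def Admissible : Prop := 4 ≤ q ∨ q = 3 ∧ D.t = 1

theorem b_φ_succ_mem (hx : ∀ i, OneAddMem K (D.off i)) (hD : D.Admissible) (i : ℤ) :
    OneAddMem K (D.b i * D.φ (i + 1)) := by
  rcases hD with hq | ⟨hq, ht⟩
  · exact D.b_φ_succ_mem_of_four_le hx hq i
  · exact D.b_φ_succ_mem_of_eq_three hx hq ht i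

theorem b_β_γ_mem (hx : ∀ i, OneAddMem K (D.off i)) (hD : D.Admissible) (i : ℤ) :
    OneAddMem K (D.b i * (D.β * D.γ (i + 3))) := by
  have hm := D.b_φ_succ_mem hx hD i
  have h0 : D.φ (i + 1) * D.b (i + 2) = 1 := D.φ_b _ _ (by omega)
  have h1 : D.φ (i + 1) * D.c (i + 2) = 0 := D.φ_c _ _
  have h2 : D.γ (i + 3) * D.b (i + 2) = 0 := D.γ_b _ _
  have h3 : D.γ (i + 3) * D.c (i + 2) = 0 := D.γ_c_zero _ _
    (D.not_dvd_small (by omega) (by omega) (by omega))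
    (D.not_dvd_small (by omega) (by omega) (by omega))
  have h4 : D.φ (i + 3) * D.b (i + 2) = 0 :=
    D.φ_b_zero _ _ (D.not_dvd_small (by omega) (by omega) (by omega))
  have h5 : D.γ (i + 3) * D.b i = 0 := D.γ_b _ _
  have h6 : D.φ (i + 3) * D.c (i + 2) = 0 := D.φ_c _ _
  have hZ := (D.τ_mem_and_zOff_mem hx (i + 2)).2
  rw [zOff_eq, show i + 2 + 1 = i + 3 by ring] at hZ
  rcases hD with hq | ⟨hq, ht⟩
  · have hN := D.zOff_φ_mem hx hq (i + 2)
    rw [show i + 2 + 1 = i + 3 by ring] at hN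
    have hW := hN.add hZ (by
      simp only [add_mul, mul_add, mul_assoc, mul_reassoc h4, mul_reassoc h6, zero_mul, mul_zero,
        add_zero])
    rw [CharTwo.add_cancel_left] at hW
    refine (hm.mul hW ?_ ?_).congr ?_
    · simp only [add_mul, mul_add, mul_assoc, mul_reassoc h2, mul_reassoc h3, zero_mul, mul_zero,
        add_zero]
    · simp only [add_mul, mul_add, mul_assoc, mul_reassoc h5, zero_mul, mul_zero, add_zero]
    · simp only [add_mul, mul_add, mul_assoc, mul_reassoc h0, mul_reassoc h1, zero_mul, mul_zero,
        add_zero, one_mul]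
  · have hN := D.b_φ_succ_mem_of_eq_three hx hq ht (i + 2)
    rw [show i + 2 + 1 = i + 3 by ring] at hN
    have h7 : D.φ (i + 3) * D.b i = 0 := D.φ_b_zero _ _ (by rw [hq]; omega)
    have hW := hN.add hZ (by
      simp only [add_mul, mul_add, mul_assoc, mul_reassoc h4, mul_reassoc h6, zero_mul, mul_zero,
        add_zero])
    rw [add_mul (D.b (i + 2)), add_assoc, CharTwo.add_cancel_left] at hW
    refine (hm.mul hW ?_ ?_).congr ?_
    · simp only [add_mul, mul_add, mul_assoc, mul_reassoc h2, mul_reassoc h3, mul_reassoc h4,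
        mul_reassoc h6, zero_mul, mul_zero, add_zero]
    · simp only [add_mul, mul_add, mul_assoc, mul_reassoc h5, mul_reassoc h7, zero_mul, mul_zero,
        add_zero]
    · simp only [add_mul, mul_add, mul_assoc, mul_reassoc h0, mul_reassoc h1, zero_mul, mul_zero,
        add_zero, one_mul, zero_add]

/-- Moving the column index down by two. -/
theorem b_sub_two_mem (hx : ∀ i, OneAddMem K (D.off i)) (hD : D.Admissible) {i l : ℤ} {r : R}
    (h : OneAddMem K (D.b i * (r * D.γ l))) (k : ℕ) :
    OneAddMem K (D.b (i - 2 * k) * (r * D.γ l)) := by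
  induction k with
  | zero => simpa using h
  | succ k ih =>
    have hm := D.b_φ_succ_mem hx hD (i - 2 * (k + 1 : ℕ))
    have h0 : D.φ (i - 2 * (k + 1 : ℕ) + 1) * D.b (i - 2 * k) = 1 :=
      D.φ_b _ _ (by push_cast; ring)
    refine (hm.mul ih ?_ ?_).congr ?_
    · simp only [mul_assoc, mul_reassoc (D.γ_b _ _), zero_mul, mul_zero]
    · simp only [mul_assoc, mul_reassoc (D.γ_b _ _), zero_mul, mul_zero]
    · simp only [mul_assoc, mul_reassoc h0, one_mul]

theorem b_β_γ_mem' (hx : ∀ i, OneAddMem K (D.off i)) (hD : D.Admissible) (l : ℤ) :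
    OneAddMem K (D.b (l + 3) * (D.β * D.γ l)) := by
  have h := D.b_β_γ_mem hx hD (l - 3)
  rw [show l - 3 + 3 = l by ring] at h
  have h' := D.b_sub_two_mem hx hD h (q - 3).toNat
  have hq := D.three_le
  rwa [D.b_congr _ (l + 3) ⟨2, by
    rw [Int.toNat_of_nonneg (by omega)]; ring⟩] at h'

/-- Pushing `γ l` through `x (l + 1)`. -/
theorem push_mem (hx : ∀ i, OneAddMem K (D.off i)) {l : ℤ} {r : R}
    (h : OneAddMem K (D.b (l + 3) * (r * D.γ l))) :
    OneAddMem K (D.b (l + 3) * (r * D.ρ * D.φ (l + 1))) ∧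
      OneAddMem K (D.b (l + 3) * (r * D.κ * D.γ (l + 1))) := by
  have h1 : D.φ (l + 1) * D.b (l + 3) = 0 :=
    D.φ_b_zero _ _ (D.not_dvd_small (by omega) (by omega) (by omega))
  have h2 : D.χ (l + 1) * D.b (l + 3) = 0 :=
    D.χ_b_zero _ _ (D.not_dvd_small (by omega) (by omega) (by omega))
  have h2' : D.χ (l + 1 + 1) * D.b (l + 3) = 0 :=
    D.χ_b_zero _ _ (D.not_dvd_small (by omega) (by omega) (by omega))
  have h3 := fun m => D.γ_b m (l + 3)
  have h4 := D.γ_a l (l + 1) rfl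
  have h5 := D.γ_b l (l + 1)
  have h6 := D.γ_c_right l (l + 1) rfl
  have h7 := D.φ_a (l + 1) (l + 1) rfl
  have h8 : D.φ (l + 1) * D.b (l + 1) = 0 :=
    D.φ_b_zero _ _ (D.not_dvd_small (by omega) (by omega) (by omega))
  have h9 := D.φ_c (l + 1) (l + 1)
  have h10 : D.γ (l + 1) * D.a (l + 1) = 0 :=
    D.γ_a_zero _ _ (D.not_dvd_small (by omega) (by omega) (by omega))
  have h11 := D.γ_b (l + 1) (l + 1)
  have h12 := D.γ_c (l + 1) (l + 1) rfl
  have hconj : OneAddMem K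
      (D.b (l + 3) * (r * (D.γ l + D.ρ * D.φ (l + 1) + D.κ * D.γ (l + 1)))) := by
    obtain ⟨w, hw, hw'⟩ := hx (l + 1)
    refine h.conj_mul ⟨w, hw, hw'⟩ ?_ ?_
    · simp only [off, add_mul, one_mul, mul_assoc, h1, h2, h3, mul_zero, add_zero]
    · simp only [off, mul_add, add_mul, mul_one, mul_assoc, mul_reassoc h4, mul_reassoc h5,
        mul_reassoc h6, mul_reassoc h7, mul_reassoc h8, mul_reassoc h9, mul_reassoc h10,
        mul_reassoc h11, mul_reassoc h12, zero_mul, mul_zero, add_zero, one_mul]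
      simp only [add_assoc, add_comm, add_left_comm, CharTwo.add_cancel_left,
        CharTwo.add_self_eq_zero, add_zero, zero_add, mul_zero, one_mul]
  have hsum : OneAddMem K (D.b (l + 3) * (r * D.ρ) * D.φ (l + 1)
      + D.b (l + 3) * (r * D.κ * D.γ (l + 1))) := by
    refine (h.add hconj ?_).congr ?_
    · simp only [mul_assoc, mul_reassoc (h3 l), zero_mul, mul_zero]
    · simp only [mul_add, mul_assoc, add_assoc, CharTwo.add_cancel_left]
  have hρ : OneAddMem K (D.b (l + 3) * (r * D.ρ) * D.φ (l + 1)) := by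
    refine hsum.isolate_right (D.τ_mem_and_zOff_mem hx (l + 1)).1 ?_ ?_ ?_ ?_ (D.φ_τ _) (D.χ_τ _)
    · rw [mul_reassoc (D.τ_fix h1 h2')]
    · rw [mul_reassoc (D.τ_fix h1 h2')]; simp only [mul_assoc, D.fix_τ h10 (D.γ_b _ _)]
    · rw [mul_reassoc h2', zero_mul]
    · rw [mul_reassoc h2', zero_mul]
  constructor
  · exact hρ.congr (by simp only [mul_assoc])
  · refine (hρ.add hsum ?_).congr ?_
    · simp only [mul_add, mul_assoc, mul_reassoc h1, zero_mul, mul_zero, add_zero]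
    · rw [CharTwo.add_cancel_left]

end GramData

/-- `S` is everything as soon as it is an additive subgroup stable under left multiplication
and contains the given set. -/
def LeftGenerates {R : Type*} [Ring R] (A : Set R) : Prop :=
  ∀ S : AddSubgroup R, (∀ r, ∀ v ∈ S, r * v ∈ S) → A ⊆ S → ∀ v, v ∈ S

/-- `S` is everything as soon as it is an additive subgroup stable under right multiplication
and contains the given set. -/
def RightGenerates {R : Type*} [Ring R] (A : Set R) : Prop :=
  ∀ S : AddSubgroup R, (∀ r, ∀ v ∈ S, v * r ∈ S) → A ⊆ S → ∀ v, v ∈ S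

namespace GramData

variable {R : Type*} [Ring R] [CharP R 2] {q : ℤ} (D : GramData R q) {K : Subgroup Rˣ}

/-- The spanning properties needed for the `x i` to generate all elementary matrices. -/
structure Spanning : Prop where
  admissible : D.Admissible
  closure_eq : Subring.closure (Set.range fun n : ℕ => D.β * D.κ ^ n * D.ρ) = ⊤
  left_β : LeftGenerates (Set.range fun n : ℕ => D.β * D.κ ^ n)
  right_ρ : RightGenerates (Set.range fun n : ℕ => D.κ ^ n * D.ρ)
  rows : LeftGenerates (Set.range D.φ ∪ Set.range D.χ ∪ Set.range D.γ)
  columns : RightGenerates (Set.range D.a ∪ Set.range D.b ∪ Set.range D.c)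

/-- In characteristic two, elements `r` with `f r` in a set closed under addition. -/
def addSubgroupOf (P : R → Prop) (h0 : P 0) (hadd : ∀ r s, P r → P s → P (r + s)) :
    AddSubgroup R where
  carrier := {r | P r}
  zero_mem' := h0
  add_mem' := fun {r s} hr hs => hadd r s hr hs
  neg_mem' := fun {r} hr => by rwa [CharTwo.neg_eq]

variable {D}

theorem b_φ_mem_one (hx : ∀ i, OneAddMem K (D.off i)) (hD : D.Spanning) {m j : ℤ}
    (hmj : ¬ q ∣ m - j - 1) : OneAddMem K (D.b m * D.φ j) := by
  have hq := D.three_le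
  have base : ∀ j, OneAddMem K (D.b (j + 2) * D.φ j) := fun j => by
    have h := (D.push_mem hx (D.b_β_γ_mem' hx hD.admissible (j - 1))).1
    rw [D.β_ρ, one_mul] at h
    convert h using 3 <;> ring
  have step : ∀ k : ℕ, (k : ℤ) + 1 < q → OneAddMem K (D.b (j + 2 + k) * D.φ j) := by
    intro k
    induction k with
    | zero => intro _; simpa using base j
    | succ k ih =>
      intro hk
      push_cast at hk
      have h1 := base (j + 1 + k)
      have h0 : D.φ (j + 1 + k) * D.b (j + 2 + k) = 1 := D.φ_b _ _ (by ring)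
      refine (h1.mul (ih (by omega)) ?_ ?_).congr ?_
      · rw [mul_assoc, mul_reassoc (D.φ_b_zero _ _ (not_dvd_of_lt (by omega) (by omega) (by omega)))]
        simp
      · rw [mul_assoc, mul_reassoc (D.φ_b_zero _ _ (not_dvd_of_lt (by omega) (by omega) (by omega)))]
        simp
      · rw [mul_assoc, mul_reassoc h0, one_mul]
        congr 2
        push_cast
        ring
  have h0 : 0 ≤ (m - j - 1) % q := Int.emod_nonneg _ (by omega)
  have h1 : (m - j - 1) % q < q := Int.emod_lt_of_pos _ (by omega)
  have h2 : (m - j - 1) % q ≠ 0 := fun h => hmj (Int.dvd_of_emod_eq_zero h)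
  have h3 := step ((m - j - 1) % q - 1).toNat (by omega)
  rw [Int.toNat_of_nonneg (by omega)] at h3
  rwa [D.b_congr m (j + 2 + ((m - j - 1) % q - 1))]
  refine ⟨-((m - j - 1) / q), ?_⟩
  have := Int.emod_add_mul_ediv (m - j - 1) q
  linear_combination this

theorem b_γ_mem_of_mem (hx : ∀ i, OneAddMem K (D.off i)) (hD : D.Spanning) {m l : ℤ} {r : R}
    (h : OneAddMem K (D.b m * (r * D.γ l))) (m' : ℤ) : OneAddMem K (D.b m' * (r * D.γ l)) := by
  by_cases hm : q ∣ m - m'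
  · rwa [D.b_congr m' m hm]
  · have h1 := b_φ_mem_one hx hD (m := m') (j := m - 1) (by
      rwa [show m' - (m - 1) - 1 = -(m - m') by ring, dvd_neg])
    refine (h1.mul h ?_ ?_).congr ?_
    · simp only [mul_assoc, mul_reassoc (D.γ_b _ _), zero_mul, mul_zero]
    · simp only [mul_assoc, mul_reassoc (D.γ_b _ _), zero_mul, mul_zero]
    · rw [mul_assoc, mul_reassoc (D.φ_b _ _ (by ring)), one_mul]

theorem b_β_κ_γ_mem (hx : ∀ i, OneAddMem K (D.off i)) (hD : D.Spanning) (n : ℕ) (m l : ℤ) :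
    OneAddMem K (D.b m * (D.β * D.κ ^ n * D.γ l)) := by
  induction n generalizing m l with
  | zero =>
    rw [pow_zero, mul_one]
    exact b_γ_mem_of_mem hx hD (D.b_β_γ_mem' hx hD.admissible l) m
  | succ n ih =>
    have h := (D.push_mem hx (ih (l - 1 + 3) (l - 1))).2
    rw [sub_add_cancel, mul_assoc D.β, ← pow_succ] at h
    exact b_γ_mem_of_mem hx hD h m

/-- Composition through an intermediate index. -/
theorem b_φ_mem_trans {m k j : ℤ} {r s : R}
    (h1 : OneAddMem K (D.b m * (r * D.φ k))) (h2 : OneAddMem K (D.b (k + 1) * (s * D.φ j)))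
    (hkj : ¬ q ∣ k + 1 - j - 1) (hmj : ¬ q ∣ m - j - 1) :
    OneAddMem K (D.b m * (r * s * D.φ j)) := by
  refine (h1.mul h2 ?_ ?_).congr ?_
  · simp only [mul_assoc, mul_reassoc (D.φ_b_zero _ _ hkj), zero_mul, mul_zero]
  · simp only [mul_assoc, mul_reassoc (D.φ_b_zero _ _ hmj), zero_mul, mul_zero]
  · simp only [mul_assoc, mul_reassoc (D.φ_b k _ rfl), one_mul]

theorem exists_third (D : GramData R q) (m j : ℤ) :
    ∃ k, ¬ q ∣ k - j ∧ ¬ q ∣ m - k - 1 := by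
  have hq := D.three_le
  have h1 : ¬ q ∣ 1 := not_dvd_of_lt (by omega) (by omega) (by omega)
  have h2 : ¬ q ∣ 2 := not_dvd_of_lt (by omega) (by omega) (by omega)
  by_cases h : q ∣ m - (j + 1) - 1
  · refine ⟨j + 2, by simpa using h2, fun h' => h1 ?_⟩
    rw [show (1 : ℤ) = m - (j + 1) - 1 - (m - (j + 2) - 1) by ring]
    exact dvd_sub h h'
  · exact ⟨j + 1, by simpa using h1, h⟩

theorem b_φ_mem (hx : ∀ i, OneAddMem K (D.off i)) (hD : D.Spanning) {m j : ℤ} (r : R)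
    (hmj : ¬ q ∣ m - j - 1) : OneAddMem K (D.b m * (r * D.φ j)) := by
  have hr : r ∈ Subring.closure (Set.range fun n : ℕ => D.β * D.κ ^ n * D.ρ) := by
    rw [hD.closure_eq]; trivial
  induction hr using Subring.closure_induction generalizing m j with
  | mem x hmem =>
    obtain ⟨n, rfl⟩ := hmem
    have h := (D.push_mem hx (b_β_κ_γ_mem hx hD n (j - 1 + 3) (j - 1))).1
    rw [sub_add_cancel] at h
    by_cases hm : q ∣ m - (j + 2)
    · rw [D.b_congr m (j - 1 + 3) (by
        rwa [show j - 1 + 3 - m = -(m - (j + 2)) by ring, dvd_neg])]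
      exact h
    · have h1 := b_φ_mem_one hx hD (m := m) (j := j + 1) (by convert hm using 2; ring)
      have h2 := b_φ_mem_trans (D := D) (K := K) (m := m) (k := j + 1) (r := 1) (by simpa using h1)
        (by rwa [show j - 1 + 3 = j + 1 + 1 by ring] at h)
        (D.not_dvd_small (by omega) (by omega) (by omega)) hmj
      simpa using h2
  | zero => simpa using OneAddMem.zero
  | one => simpa using b_φ_mem_one hx hD hmj
  | add x y _ _ hx' hy' =>
    refine ((hx' hmj).add (hy' hmj) ?_).congr ?_
    · simp only [mul_assoc, mul_reassoc (D.φ_b_zero _ _ hmj), zero_mul, mul_zero]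
    · rw [add_mul, mul_add]
  | neg x _ hx' => rw [CharTwo.neg_eq]; exact hx' hmj
  | mul x y _ _ hx' hy' =>
    obtain ⟨k, hk1, hk2⟩ := D.exists_third m j
    have hk3 : ¬ q ∣ k + 1 - j - 1 := by convert hk1 using 2; ring
    exact b_φ_mem_trans (hx' hk2) (hy' hk3) hk3 hmj

theorem b_γ_mem (hx : ∀ i, OneAddMem K (D.off i)) (hD : D.Spanning) (m l : ℤ) (r : R) :
    OneAddMem K (D.b m * (r * D.γ l)) := by
  let S : AddSubgroup R := addSubgroupOf (fun r => ∀ m, OneAddMem K (D.b m * (r * D.γ l)))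
    (fun m => by simpa using OneAddMem.zero)
    (fun r s hr hs m => ((hr m).add (hs m) (by
      simp only [mul_assoc, mul_reassoc (D.γ_b _ _), zero_mul, mul_zero])).congr (by
      rw [add_mul, mul_add]))
  refine hD.left_β S ?_ ?_ r m
  · intro r v hv m
    obtain ⟨k, -, hk⟩ := D.exists_third m 0
    refine ((b_φ_mem hx hD r hk).mul (hv (k + 1)) ?_ ?_).congr ?_
    · simp only [mul_assoc, mul_reassoc (D.γ_b _ _), zero_mul, mul_zero]
    · simp only [mul_assoc, mul_reassoc (D.γ_b _ _), zero_mul, mul_zero]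
    · simp only [mul_assoc, mul_reassoc (D.φ_b k _ rfl), one_mul]
  · rintro _ ⟨n, rfl⟩ m
    exact b_β_κ_γ_mem hx hD n m l

/-- Transfer to another column `b m'`. -/
theorem row_transfer (hx : ∀ i, OneAddMem K (D.off i)) (hD : D.Spanning) {m m' : ℤ} {r ψ : R}
    (h : OneAddMem K (D.b m * (r * ψ))) (hm : ψ * D.b m = 0) (hm' : ψ * D.b m' = 0) :
    OneAddMem K (D.b m' * (r * ψ)) := by
  by_cases hmm : q ∣ m - m'
  · rwa [D.b_congr m' m hmm]
  · have h1 := b_φ_mem_one hx hD (m := m') (j := m - 1) (by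
      rwa [show m' - (m - 1) - 1 = -(m - m') by ring, dvd_neg])
    refine (h1.mul h ?_ ?_).congr ?_
    · simp only [mul_assoc, mul_reassoc hm, zero_mul, mul_zero]
    · simp only [mul_assoc, mul_reassoc hm', zero_mul, mul_zero]
    · rw [mul_assoc, mul_reassoc (D.φ_b _ _ (by ring)), one_mul]

/-- Transfer to another row `φ j'`. -/
theorem column_transfer (hx : ∀ i, OneAddMem K (D.off i)) (hD : D.Spanning) {j j' : ℤ} {v : R}
    (h : ∀ r, OneAddMem K (v * r * D.φ j)) (hj' : D.φ j' * v = 0) (r : R) :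
    OneAddMem K (v * r * D.φ j') := by
  by_cases hjj : q ∣ j - j'
  · rw [D.φ_congr j' j hjj]
    exact h r
  · have hjj' : ¬ q ∣ j + 1 - j' - 1 := by convert hjj using 2; ring
    have h1 := b_φ_mem_one hx hD hjj'
    refine ((h r).mul h1 ?_ ?_).congr ?_
    · simp only [mul_assoc, mul_reassoc (D.φ_b_zero _ _ hjj'), zero_mul, mul_zero]
    · simp only [mul_assoc, mul_reassoc hj', zero_mul, mul_zero]
    · simp only [mul_assoc, mul_reassoc (D.φ_b _ _ rfl), one_mul]

theorem b_χ_mem (hx : ∀ i, OneAddMem K (D.off i)) (hD : D.Spanning) (j : ℤ) (r : R) :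
    OneAddMem K (D.b j * (r * D.χ (j + 1))) := by
  have h1 : D.φ (j + 1) * D.b j = 0 :=
    D.φ_b_zero _ _ (D.not_dvd_small (by omega) (by omega) (by omega))
  have h2 : D.χ (j + 1) * D.b j = 0 :=
    D.χ_b_zero _ _ (D.not_dvd_small (by omega) (by omega) (by omega))
  have h3 : D.φ j * D.b j = 0 :=
    D.φ_b_zero _ _ (D.not_dvd_small (by omega) (by omega) (by omega))
  have h4 : D.φ j * D.a (j + 1) = 0 :=
    D.φ_a_zero _ _ (D.not_dvd_small (by omega) (by omega) (by omega))
  have h5 := b_φ_mem hx hD (m := j) (j := j) r (D.not_dvd_small (by omega) (by omega) (by omega))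
  have h6 : OneAddMem K (D.b j * (r * (D.φ j + D.χ (j + 1)))) := by
    refine h5.conj_inv (hx (j + 1)) ?_
    simp only [off, mul_add, add_mul, mul_one, one_mul, mul_assoc, mul_reassoc h4,
      mul_reassoc (D.φ_b j _ rfl), mul_reassoc (D.φ_c _ _), mul_reassoc h1, mul_reassoc h2,
      mul_reassoc (D.γ_b _ _), zero_mul, mul_zero, add_zero, zero_add]
  refine (h5.add h6 ?_).congr ?_
  · simp only [mul_assoc, mul_reassoc h3, zero_mul, mul_zero]
  · simp only [mul_add, CharTwo.add_cancel_left]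

theorem row_mem (hx : ∀ i, OneAddMem K (D.off i)) (hD : D.Spanning) (m : ℤ) (ψ r : R) :
    OneAddMem K (D.b m * (r * (ψ + ψ * D.b m * D.φ (m - 1)))) := by
  have hb1 : D.φ (m - 1) * D.b m = 1 := D.φ_b _ _ (by ring)
  have hkill : ∀ ψ, (ψ + ψ * D.b m * D.φ (m - 1)) * D.b m = 0 := fun ψ => by
    rw [add_mul, mul_assoc (ψ * D.b m), hb1, mul_one, CharTwo.add_self_eq_zero]
  let S : AddSubgroup R := addSubgroupOf
    (fun ψ => ∀ r, OneAddMem K (D.b m * (r * (ψ + ψ * D.b m * D.φ (m - 1)))))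
    (fun m => by simpa using OneAddMem.zero)
    (fun ψ ψ' hψ hψ' r => ((hψ r).add (hψ' r) (by
      rw [mul_assoc (D.b m), mul_assoc r, mul_reassoc (hkill ψ), zero_mul, mul_zero,
          mul_zero])).congr (by simp only [mul_add, add_mul]; abel))
  refine hD.rows S ?_ ?_ ψ r
  · intro r ψ hψ s
    refine (hψ (s * r)).congr ?_
    simp only [mul_add, mul_assoc]
  · have hgood : ∀ ψ, ψ * D.b m = 0 → (∀ r, OneAddMem K (D.b m * (r * ψ))) → ψ ∈ S :=
      fun ψ h0 h r => by simpa [h0] using h r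
    rintro _ ((⟨j, rfl⟩ | ⟨j, rfl⟩) | ⟨j, rfl⟩)
    · by_cases hj : q ∣ m - 1 - j
      · intro r
        rw [D.φ_congr j (m - 1) hj, hb1, one_mul, CharTwo.add_self_eq_zero, mul_zero, mul_zero]
        exact OneAddMem.zero
      · have hj' : ¬ q ∣ m - j - 1 := by convert hj using 2; ring
        exact hgood _ (D.φ_b_zero _ _ hj') fun r => b_φ_mem hx hD r hj'
    · have h0 : D.χ j * D.b (j - 1) = 0 :=
        D.χ_b_zero _ _ (D.not_dvd_small (by omega) (by omega) (by omega))
      have h1 : ∀ r, OneAddMem K (D.b (j - 1) * (r * D.χ j)) := fun r => by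
        simpa using b_χ_mem hx hD (j - 1) r
      by_cases hj : q ∣ m - j
      · intro r
        have h2 : D.φ (j - 1) * D.b (j - 1) = 0 :=
          D.φ_b_zero _ _ (D.not_dvd_small (by omega) (by omega) (by omega))
        have h3 : D.φ (j - 1) * D.b j = 1 := D.φ_b _ _ (by ring)
        rw [D.b_congr m j ((dvd_sub_comm).1 hj),
          D.φ_congr (m - 1) (j - 1) (by
            rwa [show j - 1 - (m - 1) = -(m - j) by ring, dvd_neg]),
          D.χ_b j j rfl]
        refine row_transfer hx hD (m := j - 1) ?_ ?_ ?_
        · refine ((h1 r).add (b_φ_mem hx hD (m := j - 1) (j := j - 1) (r * (D.t + 1))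
            (D.not_dvd_small (by omega) (by omega) (by omega))) ?_).congr ?_
          · simp only [mul_assoc, mul_reassoc h0, zero_mul, mul_zero]
          · simp only [mul_add, add_mul, mul_assoc]
        · rw [add_mul, h0, mul_assoc, h2, mul_zero, add_zero]
        · rw [add_mul, D.χ_b j j rfl, mul_assoc, h3, mul_one, CharTwo.add_self_eq_zero]
      · have hm0 := D.χ_b_zero _ _ hj
        exact hgood _ hm0 fun r => row_transfer hx hD (h1 r) h0 hm0
    · exact hgood _ (D.γ_b _ _) fun r => b_γ_mem hx hD m j r

end GramData

namespace GramData

variable {R : Type*} [Ring R] [CharP R 2] {q : ℤ} {D : GramData R q} {K : Subgroup Rˣ}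

theorem a_φ_mem (hx : ∀ i, OneAddMem K (D.off i)) (hD : D.Spanning) {i j : ℤ}
    (hij : ¬ q ∣ i - j) (r : R) : OneAddMem K (D.a i * r * D.φ j) := by
  have h0 : D.φ j * D.a i = 0 := D.φ_a_zero _ _ hij
  refine column_transfer (j := i + 1) hx hD (fun r => ?_) h0 r
  have h1 : D.φ (i + 1) * D.a i = 0 :=
    D.φ_a_zero _ _ (D.not_dvd_small (by omega) (by omega) (by omega))
  have h2 : D.φ (i + 1) * D.b i = 0 :=
    D.φ_b_zero _ _ (D.not_dvd_small (by omega) (by omega) (by omega))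
  have h3 := D.φ_c (i + 1) i
  have h4 : D.φ (i + 1) * D.b (i + 1) = 0 :=
    D.φ_b_zero _ _ (D.not_dvd_small (by omega) (by omega) (by omega))
  have h5 : D.φ i * D.b (i + 1) = 1 := D.φ_b _ _ rfl
  have h6 : D.χ i * D.b (i + 1) = 0 :=
    D.χ_b_zero _ _ (D.not_dvd_small (by omega) (by omega) (by omega))
  have h7 := D.γ_b i (i + 1)
  have h := b_φ_mem hx hD (m := i + 1) (j := i + 1) r
    (D.not_dvd_small (by omega) (by omega) (by omega))
  have hc : OneAddMem K ((D.b (i + 1) + D.a i) * r * D.φ (i + 1)) := by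
    refine OneAddMem.conj_mul (u := 1 + D.off i) (v := D.b (i + 1) * r)
      (h.congr (by rw [mul_assoc])) (hx i) ?_ ?_
    · simp only [off, add_mul, one_mul, mul_assoc, mul_reassoc h5, mul_reassoc h6, mul_reassoc h7,
        zero_mul, mul_zero, add_zero]
    · simp only [off, mul_add, mul_one, ← mul_assoc, h1, h2, h3, zero_mul, add_zero]
  refine (h.add hc ?_).congr ?_
  · simp only [add_mul, mul_add, mul_assoc, mul_reassoc h4, mul_reassoc h1, zero_mul, mul_zero,
      add_zero]
  · simp only [add_mul, mul_assoc, CharTwo.add_cancel_left]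

theorem a_add_b_φ_mem (hx : ∀ i, OneAddMem K (D.off i)) (hD : D.Spanning) (i j : ℤ)
    (r : R) (h0 : D.φ j * (D.a i + D.b (i + 1) * (D.t + 1)) = 0) :
    OneAddMem K ((D.a i + D.b (i + 1) * (D.t + 1)) * r * D.φ j) := by
  refine column_transfer (j := i + 1) hx hD (fun r => ?_) h0 r
  have h4 : D.φ (i + 1) * D.b (i + 1) = 0 :=
    D.φ_b_zero _ _ (D.not_dvd_small (by omega) (by omega) (by omega))
  refine ((a_φ_mem hx hD (i := i) (j := i + 1)
    (D.not_dvd_small (by omega) (by omega) (by omega)) r).add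
    (b_φ_mem hx hD (m := i + 1) (j := i + 1) ((D.t + 1) * r)
      (D.not_dvd_small (by omega) (by omega) (by omega))) ?_).congr ?_
  · simp only [mul_assoc, mul_reassoc h4, zero_mul, mul_zero]
  · simp only [add_mul, mul_add, mul_assoc]

theorem c_ρ_φ_mem (hx : ∀ i, OneAddMem K (D.off i)) (hD : D.Spanning) (i j : ℤ) (r : R) :
    OneAddMem K (D.c i * (D.ρ * r) * D.φ j) := by
  have key : ∀ r, OneAddMem K (D.c i * D.ρ * r * D.φ (i + 1)) := by
    intro r
    set v := D.a (i + 1) + D.b (i + 1 + 1) * ((D.t : R) + 1) with hv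
    have h1 : D.φ (i + 1) * v = 0 := by
      rw [hv, mul_add, D.φ_a _ _ rfl, mul_reassoc (D.φ_b _ _ rfl), one_mul,
        CharTwo.add_self_eq_zero]
    have h2 : D.φ i * v = 0 := by
      rw [hv, mul_add, D.φ_a_zero _ _ (D.not_dvd_small (by omega) (by omega) (by omega)),
        mul_reassoc (D.φ_b_zero _ _ (D.not_dvd_small (by omega) (by omega) (by omega))),
        zero_mul, zero_add]
    have h3 : D.χ i * v = D.t := by
      rw [hv, mul_add, D.χ_a_right _ _ rfl,
        mul_reassoc (D.χ_b_zero _ _ (D.not_dvd_small (by omega) (by omega) (by omega))),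
        zero_mul, add_zero]
    have h4 : D.γ i * v = D.ρ * D.t := by
      rw [hv, mul_add, D.γ_a _ _ rfl, mul_reassoc (D.γ_b _ _), zero_mul, add_zero]
    have h5 : D.φ (i + 1) * D.a i = 0 :=
      D.φ_a_zero _ _ (D.not_dvd_small (by omega) (by omega) (by omega))
    have h6 : D.φ (i + 1) * D.b i = 0 :=
      D.φ_b_zero _ _ (D.not_dvd_small (by omega) (by omega) (by omega))
    have h7 := D.φ_c (i + 1) i
    set s : R := ↑D.t⁻¹ * r with hs
    have hts : (D.t : R) * s = r := by rw [hs, Units.mul_inv_cancel_left]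
    have hb := b_φ_mem hx hD (m := i) (j := i + 1) r
      (D.not_dvd_small (by omega) (by omega) (by omega))
    have hm : OneAddMem K (v * s * D.φ (i + 1)) := a_add_b_φ_mem hx hD _ _ _ h1
    have hc : OneAddMem K ((v * s + D.b i * r + D.c i * (D.ρ * r)) * D.φ (i + 1)) := by
      refine OneAddMem.conj_mul hm (hx i) ?_ ?_
      · simp only [off, add_mul, one_mul, mul_assoc, mul_reassoc h2, mul_reassoc h3,
          mul_reassoc h4, hts, zero_mul, mul_zero, add_zero, add_assoc, zero_add]
      · simp only [off, mul_add, mul_one, ← mul_assoc, h5, h6, h7, zero_mul, add_zero]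
    refine ((hm.add hc ?_).add hb ?_).congr ?_
    · simp only [mul_add, add_mul, mul_assoc, mul_reassoc h1, mul_reassoc h6, mul_reassoc h7,
        zero_mul, mul_zero, add_zero]
    · simp only [mul_add, add_mul, mul_assoc, mul_reassoc h1, mul_reassoc h6, mul_reassoc h7,
        zero_mul, mul_zero, add_zero]
    · simp only [add_mul, mul_assoc, add_assoc, CharTwo.add_cancel_left]
      rw [add_comm (D.c i * _), CharTwo.add_cancel_left]
  have h0 : D.φ j * (D.c i * D.ρ) = 0 := by rw [mul_reassoc (D.φ_c _ _), zero_mul]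
  exact (column_transfer hx hD key h0 r).congr (by simp only [mul_assoc])

theorem c_φ_mem (hx : ∀ i, OneAddMem K (D.off i)) (hD : D.Spanning) (i j : ℤ) (r : R) :
    OneAddMem K (D.c i * r * D.φ j) := by
  have h0 : ∀ i j s, D.φ j * (D.c i * s) = 0 := fun i j s => by
    rw [mul_reassoc (D.φ_c _ _), zero_mul]
  let S : AddSubgroup R := addSubgroupOf (fun v => ∀ i j r, OneAddMem K (D.c i * (v * r) * D.φ j))
    (fun i j r => by simpa using OneAddMem.zero)
    (fun v w hv hw i j r => ((hv i j r).add (hw i j r) (by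
      rw [mul_assoc, ← mul_assoc (D.φ j), h0]; simp)).congr (by simp only [mul_add, add_mul]))
  have stable : ∀ v ∈ S, D.κ * v ∈ S := by
    intro v hv i j r
    have e1 : D.φ (i + 1) * D.a i = 0 :=
      D.φ_a_zero _ _ (D.not_dvd_small (by omega) (by omega) (by omega))
    have e2 : D.φ (i + 1) * D.b i = 0 :=
      D.φ_b_zero _ _ (D.not_dvd_small (by omega) (by omega) (by omega))
    have e3 := D.φ_c (i + 1) i
    have e4 : D.φ (i + 1) * (1 + D.off i) = D.φ (i + 1) := by
      simp only [off, mul_add, mul_one, ← mul_assoc, e1, e2, e3, zero_mul, add_zero]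
    have hT : ∀ r, OneAddMem K (D.c (i + 1) * (↑D.T⁻¹ * v * r) * D.φ (i + 1)) := by
      intro r
      have f1 : D.φ (i + 1) * D.a (i + 1) = D.t + 1 := D.φ_a _ _ rfl
      have f2 : D.χ (i + 1) * D.c (i + 1) = 0 :=
        D.χ_c_zero _ _ (D.not_dvd_small (by omega) (by omega) (by omega))
      have f3 : D.γ (i + 1) * D.c (i + 1) = D.T + 1 := D.γ_c _ _ rfl
      have f4 : D.φ (i + 2) * D.a (i + 1) = 0 :=
        D.φ_a_zero _ _ (D.not_dvd_small (by omega) (by omega) (by omega))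
      have f5 : D.φ (i + 2) * D.b (i + 1) = 0 :=
        D.φ_b_zero _ _ (D.not_dvd_small (by omega) (by omega) (by omega))
      have f6 := D.φ_c (i + 2) (i + 1)
      refine (column_transfer (v := D.c (i + 1) * (↑D.T⁻¹ * v)) (j := i + 2) (j' := i + 1) hx hD (fun r => ?_)
        (h0 _ _ _) r).congr (by simp only [mul_assoc])
      refine (hv (i + 1) (i + 2) r).conj_inv (hx (i + 1)) ?_
      simp only [off, mul_add, add_mul, mul_one, one_mul, mul_assoc, f4, f5, f6,
        mul_reassoc (D.φ_c (i + 1) (i + 1)), mul_reassoc f2, mul_reassoc f3, mul_reassoc f4,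
        mul_reassoc f5, mul_reassoc f6, zero_mul, mul_zero, add_zero, zero_add,
        Units.mul_inv_cancel_left, CharTwo.add_cancel_left]
      simp only [add_comm, add_left_comm, CharTwo.add_cancel_left, CharTwo.add_self_eq_zero,
        add_zero, zero_add]
    have hκ : ∀ r, OneAddMem K (D.c i * (D.κ * v) * r * D.φ (i + 1)) := by
      intro r
      have g1 : D.χ i * D.c (i + 1) = D.β * D.T := D.χ_c _ _ rfl
      have g2 : D.γ i * D.c (i + 1) = D.κ * D.T := D.γ_c_right _ _ rfl
      have hb := b_φ_mem hx hD (m := i) (j := i + 1) (D.β * (v * r))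
        (D.not_dvd_small (by omega) (by omega) (by omega))
      have hc : OneAddMem K ((D.c (i + 1) * (↑D.T⁻¹ * v * r) + D.b i * (D.β * (v * r))
          + D.c i * (D.κ * (v * r))) * D.φ (i + 1)) := by
        refine OneAddMem.conj_mul (hT r) (hx i) ?_ e4
        simp only [off, add_mul, one_mul, mul_assoc, mul_reassoc (D.φ_c i (i + 1)),
          mul_reassoc g1, mul_reassoc g2, zero_mul, mul_zero, add_zero, add_assoc, zero_add,
          Units.mul_inv_cancel_left]
      refine (((hT r).add hc ?_).add hb ?_).congr ?_
      · simp only [mul_add, add_mul, mul_assoc, mul_reassoc e2, mul_reassoc e3,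
          mul_reassoc (D.φ_c (i + 1) (i + 1)), zero_mul, mul_zero, add_zero]
      · simp only [mul_add, add_mul, mul_assoc, mul_reassoc e2, mul_reassoc e3,
          mul_reassoc (D.φ_c (i + 1) (i + 1)), zero_mul, mul_zero, add_zero]
      · simp only [add_mul, mul_assoc, add_assoc, CharTwo.add_cancel_left]
        rw [add_comm (D.c i * _), CharTwo.add_cancel_left]
    exact (column_transfer (j' := j) hx hD hκ (h0 _ _ _) r).congr (by simp only [mul_assoc])
  have hS : r ∈ S := by
    refine hD.right_ρ S ?_ ?_ r
    · intro s v hv i j r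
      exact (hv i j (s * r)).congr (by simp only [mul_assoc])
    · rintro _ ⟨n, rfl⟩
      induction n with
      | zero =>
        intro i j r
        simpa using c_ρ_φ_mem hx hD i j r
      | succ n ih =>
        have := stable _ ih
        rwa [← mul_assoc, ← pow_succ'] at this
  simpa using hS i j 1

theorem column_mem (hx : ∀ i, OneAddMem K (D.off i)) (hD : D.Spanning) (v : R) (j : ℤ) (r : R) :
    OneAddMem K ((v + D.b (j + 1) * D.φ j * v) * r * D.φ j) := by
  have hkill : ∀ v j, D.φ j * (v + D.b (j + 1) * D.φ j * v) = 0 := fun v j => by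
    rw [mul_add, mul_assoc, mul_reassoc (D.φ_b j _ rfl), one_mul, CharTwo.add_self_eq_zero]
  let S : AddSubgroup R := addSubgroupOf
    (fun v => ∀ j r, OneAddMem K ((v + D.b (j + 1) * D.φ j * v) * r * D.φ j))
    (fun j r => by simpa using OneAddMem.zero)
    (fun v w hv hw j r => ((hv j r).add (hw j r) (by
      rw [mul_assoc _ (D.φ j), mul_assoc _ r (D.φ j), mul_reassoc (hkill w j), zero_mul,
          mul_zero])).congr
        (by simp only [mul_add, add_mul]; abel))
  have hgood : ∀ v, (∀ j, D.φ j * v = 0) → (∀ j r, OneAddMem K (v * r * D.φ j)) → v ∈ S :=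
    fun v h0 h j r => by simpa [mul_assoc, h0] using h j r
  refine hD.columns S ?_ ?_ v j r
  · intro s v hv j r
    exact (hv j (s * r)).congr (by simp only [add_mul, mul_assoc])
  · rintro _ ((⟨i, rfl⟩ | ⟨i, rfl⟩) | ⟨i, rfl⟩) j r
    · by_cases hj : q ∣ i - j
      · have e1 : D.b (j + 1) = D.b (i + 1) := D.b_congr _ _ (by
          rwa [show i + 1 - (j + 1) = i - j by ring])
        have e2 : D.φ j = D.φ i := D.φ_congr _ _ hj
        have h := a_add_b_φ_mem hx hD i i r (by
          rw [mul_add, D.φ_a _ _ rfl, mul_reassoc (D.φ_b _ _ rfl), one_mul,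
            CharTwo.add_self_eq_zero])
        rwa [e1, e2, mul_assoc (D.b _), D.φ_a _ _ rfl]
      · rw [mul_assoc (D.b _), D.φ_a_zero _ _ hj, mul_zero, add_zero]
        exact a_φ_mem hx hD hj r
    · by_cases hj : q ∣ i - j - 1
      · have e1 : D.b i = D.b (j + 1) := D.b_congr _ _ (by
          rwa [show j + 1 - i = -(i - j - 1) by ring, dvd_neg])
        rw [e1, mul_assoc (D.b _) (D.φ j), D.φ_b j _ rfl, mul_one, CharTwo.add_self_eq_zero,
          zero_mul, zero_mul]
        exact OneAddMem.zero
      · rw [mul_assoc (D.b _) (D.φ j), D.φ_b_zero _ _ hj, mul_zero, add_zero, mul_assoc]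
        exact b_φ_mem hx hD r hj
    · rw [mul_assoc (D.b _) (D.φ j), D.φ_c, mul_zero, add_zero]
      exact c_φ_mem hx hD i j r

/-- The elementary matrices obtained from the `x i`. -/
theorem elementary_mem (hx : ∀ i, OneAddMem K (D.off i)) (hD : D.Spanning) {v ψ : R} (j : ℤ)
    (hv : D.φ j * v = 0) (hψ : ψ * D.b (j + 1) = 0) (hψv : ψ * v = 0) (r : R) :
    OneAddMem K (v * r * ψ) := by
  have h1 := column_mem hx hD v j r
  have h2 := row_mem hx hD (j + 1) ψ 1
  rw [mul_assoc (D.b _) (D.φ j), hv, mul_zero, add_zero] at h1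
  rw [hψ, zero_mul, add_zero, one_mul] at h2
  refine (h1.mul h2 ?_ ?_).congr ?_
  · rw [mul_assoc, mul_reassoc hψ, zero_mul, mul_zero]
  · simp only [mul_assoc, mul_reassoc hψv, zero_mul, mul_zero]
  · rw [mul_assoc, mul_reassoc (D.φ_b _ _ rfl), one_mul]

end GramData

/-- A decomposition of a free module of rank one into copies of itself. -/
structure Frame (ι R : Type*) [Fintype ι] [DecidableEq ι] [Ring R] where
  (s t : ι → R)
  t_s : ∀ i j, t i * s j = if i = j then 1 else 0
  sum_s_t : ∑ i, s i * t i = 1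

namespace Frame

variable {ι R : Type*} [Fintype ι] [DecidableEq ι] [Ring R] (E : Frame ι R)

theorem t_s_self (i : ι) : E.t i * E.s i = 1 := by simp [E.t_s]

theorem t_s_ne {i j : ι} (h : i ≠ j) : E.t i * E.s j = 0 := by simp [E.t_s, h]

theorem t_mul_sum (i : ι) (g : ι → R) : E.t i * ∑ j, E.s j * g j = g i := by
  simp [Finset.mul_sum, ← mul_assoc, E.t_s]

theorem sum_mul_s (g : ι → R) (i : ι) : (∑ j, g j * E.t j) * E.s i = g i := by
  simp [Finset.sum_mul, mul_assoc, E.t_s]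

theorem ext_left {x y : R} (h : ∀ i, E.t i * x = E.t i * y) : x = y := by
  rw [← one_mul x, ← one_mul y, ← E.sum_s_t, Finset.sum_mul, Finset.sum_mul]
  exact Finset.sum_congr rfl fun i _ => by rw [mul_assoc, h, mul_assoc]

theorem ext_right {x y : R} (h : ∀ i, x * E.s i = y * E.s i) : x = y := by
  rw [← mul_one x, ← mul_one y, ← E.sum_s_t, Finset.mul_sum, Finset.mul_sum]
  exact Finset.sum_congr rfl fun i _ => by rw [← mul_assoc, h, mul_assoc]

/-- Diagonal units. -/
def diag : (ι → Rˣ) →* Rˣ := Units.map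
  { toFun := fun d => ∑ i, E.s i * (d i * E.t i)
    map_one' := by simpa using E.sum_s_t
    map_mul' := fun d e => E.ext_left fun i => by
      rw [E.t_mul_sum, ← mul_assoc, E.t_mul_sum, mul_assoc, E.t_mul_sum, Pi.mul_apply, mul_assoc] }
    |>.comp (MulEquiv.piUnits (M := fun _ : ι => R)).symm.toMonoidHom

theorem val_diag (d : ι → Rˣ) : (E.diag d : R) = ∑ i, E.s i * (d i * E.t i) := rfl

theorem t_diag (d : ι → Rˣ) (i : ι) : E.t i * (E.diag d : R) = d i * E.t i := by
  rw [val_diag, E.t_mul_sum]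

theorem diag_s (d : ι → Rˣ) (i : ι) : (E.diag d : R) * E.s i = E.s i * d i := by
  simp only [val_diag, ← mul_assoc]
  exact E.sum_mul_s (fun i => E.s i * d i) i

/-- Permutation units. -/
def perm : Equiv.Perm ι →* Rˣ := MonoidHom.toHomUnits
  { toFun := fun π => ∑ i, E.s (π i) * E.t i
    map_one' := by simpa using E.sum_s_t
    map_mul' := fun π π' => E.ext_right fun i => by
      rw [E.sum_mul_s (fun i => E.s ((π * π') i)), mul_assoc, E.sum_mul_s (fun i => E.s (π' i)),
        E.sum_mul_s (fun i => E.s (π i)), Equiv.Perm.mul_apply] }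

theorem val_perm (π : Equiv.Perm ι) : (E.perm π : R) = ∑ i, E.s (π i) * E.t i := rfl

theorem perm_s (π : Equiv.Perm ι) (i : ι) : (E.perm π : R) * E.s i = E.s (π i) := by
  rw [val_perm]
  exact E.sum_mul_s (fun i => E.s (π i)) i

theorem t_perm (π : Equiv.Perm ι) (i : ι) : E.t (π i) * (E.perm π : R) = E.t i :=
  E.ext_right fun j => by simp [mul_assoc, E.perm_s, E.t_s]

/-- The composite of two frames. -/
def comp {κ : Type*} [Fintype κ] [DecidableEq κ] (F : Frame κ R) : Frame (ι × κ) R where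
  s i := E.s i.1 * F.s i.2
  t i := F.t i.2 * E.t i.1
  t_s i j := by
    rw [mul_assoc, ← mul_assoc (E.t _), E.t_s]
    by_cases h : i.1 = j.1 <;> simp [h, F.t_s, Prod.ext_iff]
  sum_s_t := by
    rw [Fintype.sum_prod_type, ← E.sum_s_t]
    refine Finset.sum_congr rfl fun i _ => ?_
    have : ∀ k, E.s i * F.s k * (F.t k * E.t i) = E.s i * (F.s k * F.t k) * E.t i :=
      fun k => by simp only [mul_assoc]
    simp only [this, ← Finset.sum_mul, ← Finset.mul_sum, F.sum_s_t, mul_one]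

variable {N : ℕ} (E : Frame (Fin N) R)

/-- The rows of a frame indexed by `Fin N`, extended by zero. -/
def row (k : ℕ) : R := if h : k < N then E.t ⟨k, h⟩ else 0

theorem row_of_lt {k : ℕ} (h : k < N) : E.row k = E.t ⟨k, h⟩ := dif_pos h

theorem row_of_le {k : ℕ} (h : N ≤ k) : E.row k = 0 := dif_neg h.not_gt

theorem sum_s_row : ∑ i : Fin N, E.s i * E.row i = 1 := by
  rw [← E.sum_s_t]
  exact Finset.sum_congr rfl fun i _ => by rw [E.row_of_lt i.2]

theorem row_mul_sum (k : ℕ) (g : ℕ → R) :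
    E.row k * ∑ i : Fin N, E.s i * g i = if k < N then g k else 0 := by
  by_cases h : k < N
  · rw [E.row_of_lt h, E.t_mul_sum _ (fun i => g i), if_pos h]
  · rw [E.row_of_le (not_lt.1 h), zero_mul, if_neg h]

/-- The shift operator. -/
def shift : R := ∑ i : Fin N, E.s i * E.row (i + 1)

theorem row_shift (k : ℕ) : E.row k * E.shift = E.row (k + 1) := by
  rw [shift, E.row_mul_sum k fun i => E.row (i + 1)]
  split_ifs with h
  · rfl
  · rw [E.row_of_le (by omega)]

theorem row_shift_pow (k n : ℕ) : E.row k * E.shift ^ n = E.row (k + n) := by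
  induction n with
  | zero => simp
  | succ n ih => rw [pow_succ, ← mul_assoc, ih, row_shift, add_assoc]

theorem row_diag (t : Rˣ) (k : ℕ) :
    E.row k * (E.diag (fun _ => t) : R) = t * E.row k := by
  by_cases h : k < N
  · rw [E.row_of_lt h, E.t_diag]
  · rw [E.row_of_le (not_lt.1 h), zero_mul, mul_zero]

theorem ext_row {x y : R} (h : ∀ k, k < N → E.row k * x = E.row k * y) : x = y :=
  E.ext_left fun i => by simpa [E.row_of_lt i.2] using h i i.2

end Frame

/-- Three columns and rows whose translates by the unit `y` form a frame. The first two columns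
are `q`-periodic. -/
structure ShiftFrame (R : Type*) [Ring R] (q : ℤ) where
  y : Rˣ
  (a b c a' b' c' : R)
  three_le : 3 ≤ q
  a_a : ∀ n : ℤ, q ∣ n → a' * (y ^ n : Rˣ) * a = 1
  a_a_zero : ∀ n : ℤ, ¬ q ∣ n → a' * (y ^ n : Rˣ) * a = 0
  a_b : ∀ n : ℤ, a' * (y ^ n : Rˣ) * b = 0
  a_c : ∀ n : ℤ, a' * (y ^ n : Rˣ) * c = 0
  b_a : ∀ n : ℤ, b' * (y ^ n : Rˣ) * a = 0
  b_b : ∀ n : ℤ, q ∣ n → b' * (y ^ n : Rˣ) * b = 1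
  b_b_zero : ∀ n : ℤ, ¬ q ∣ n → b' * (y ^ n : Rˣ) * b = 0
  b_c : ∀ n : ℤ, b' * (y ^ n : Rˣ) * c = 0
  c_a : ∀ n : ℤ, c' * (y ^ n : Rˣ) * a = 0
  c_b : ∀ n : ℤ, c' * (y ^ n : Rˣ) * b = 0
  c_c : c' * c = 1
  c_c_zero : ∀ n : ℤ, ¬ q ∣ n → c' * (y ^ n : Rˣ) * c = 0
  pow_b : ∀ n : ℤ, q ∣ n → (y ^ n : Rˣ) * b = b
  a'_pow : ∀ n : ℤ, q ∣ n → a' * (y ^ n : Rˣ) = a'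
  b'_pow : ∀ n : ℤ, q ∣ n → b' * (y ^ n : Rˣ) = b'
  sum_eq_one : ∑ i ∈ Finset.range q.toNat,
    ((y ^ (i : ℤ) : Rˣ) * a * (a' * (y ^ (-(i : ℤ)) : Rˣ))
      + (y ^ (i : ℤ) : Rˣ) * b * (b' * (y ^ (-(i : ℤ)) : Rˣ))
      + (y ^ (i : ℤ) : Rˣ) * c * (c' * (y ^ (-(i : ℤ)) : Rˣ))) = 1

namespace ShiftFrame

variable {R : Type*} [Ring R] {q : ℤ} (F : ShiftFrame R q)

/-- The rows `φ`, `χ`, `γ` at index zero. -/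
def row₁ (t : Rˣ) : R := (t + 1) * F.a' + F.b' * (F.y ^ (-1 : ℤ) : Rˣ)

/-- See `row₁`. -/
def row₂ (t : Rˣ) {N : ℕ} (E : Frame (Fin N) R) : R :=
  (t + 1) * F.b' + F.a' * (F.y ^ (1 : ℤ) : Rˣ) + t * (F.a' * (F.y ^ (-1 : ℤ) : Rˣ))
    + E.row 0 * E.diag (fun _ => t) * (F.c' * (F.y ^ (-1 : ℤ) : Rˣ))

/-- The column with prescribed entries. -/
def weights {N : ℕ} (E : Frame (Fin N) R) (f : ℕ → R) : R := ∑ i : Fin N, E.s i * f i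

/-- See `row₁`. -/
def row₃ (t : Rˣ) {N : ℕ} (E : Frame (Fin N) R) (f : ℕ → R) : R :=
  (E.diag (fun _ => t) + 1) * F.c' + E.shift * E.diag (fun _ => t) * (F.c' * (F.y ^ (-1 : ℤ) : Rˣ))
    + weights E f * t * (F.a' * (F.y ^ (-1 : ℤ) : Rˣ))

variable (t : Rˣ) {N : ℕ} (E : Frame (Fin N) R) (f : ℕ → R)

theorem row₁_mul (n : ℤ) (v : R) : F.row₁ t * (F.y ^ n : Rˣ) * v =
    (t + 1) * (F.a' * (F.y ^ n : Rˣ) * v) + F.b' * (F.y ^ (n - 1) : Rˣ) * v := by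
  simp only [row₁, add_mul, mul_assoc]
  rw [← mul_assoc ((F.y ^ (-1 : ℤ) : Rˣ) : R), ← Units.val_mul, ← zpow_add, neg_add_eq_sub]

theorem row₂_mul (n : ℤ) (v : R) : F.row₂ t E * (F.y ^ n : Rˣ) * v =
    (t + 1) * (F.b' * (F.y ^ n : Rˣ) * v) + F.a' * (F.y ^ (n + 1) : Rˣ) * v
      + t * (F.a' * (F.y ^ (n - 1) : Rˣ) * v)
      + E.row 0 * E.diag (fun _ => t) * (F.c' * (F.y ^ (n - 1) : Rˣ) * v) := by
  simp only [row₂, add_mul, mul_assoc]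
  rw [← mul_assoc ((F.y ^ (-1 : ℤ) : Rˣ) : R), ← Units.val_mul, ← zpow_add, neg_add_eq_sub,
    ← mul_assoc ((F.y ^ (1 : ℤ) : Rˣ) : R), ← Units.val_mul, ← zpow_add, add_comm 1 n]

theorem row₃_mul (n : ℤ) (v : R) : F.row₃ t E f * (F.y ^ n : Rˣ) * v =
    (E.diag (fun _ => t) + 1) * (F.c' * (F.y ^ n : Rˣ) * v)
      + E.shift * E.diag (fun _ => t) * (F.c' * (F.y ^ (n - 1) : Rˣ) * v)
      + weights E f * t * (F.a' * (F.y ^ (n - 1) : Rˣ) * v) := by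
  simp only [row₃, add_mul, mul_assoc]
  rw [← mul_assoc ((F.y ^ (-1 : ℤ) : Rˣ) : R), ← Units.val_mul, ← zpow_add, neg_add_eq_sub]

theorem conj_pow (r v : R) (i j : ℤ) :
    r * (F.y ^ (-i) : Rˣ) * ((F.y ^ j : Rˣ) * v) = r * (F.y ^ (j - i) : Rˣ) * v := by
  rw [sub_eq_neg_add, zpow_add, Units.val_mul]
  simp only [mul_assoc]

theorem c_c' : F.c' * (F.y ^ (0 : ℤ) : Rˣ) * F.c = 1 := by
  rw [zpow_zero, Units.val_one, mul_one, F.c_c]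

/-- The Gram data attached to a shift frame. -/
def gramData (h0 : E.row 0 * weights E f = 1) : GramData R q where
  a i := (F.y ^ i : Rˣ) * F.a
  b i := (F.y ^ i : Rˣ) * F.b
  c i := (F.y ^ i : Rˣ) * F.c
  φ i := F.row₁ t * (F.y ^ (-i) : Rˣ)
  χ i := F.row₂ t E * (F.y ^ (-i) : Rˣ)
  γ i := F.row₃ t E f * (F.y ^ (-i) : Rˣ)
  t := t
  T := E.diag (fun _ => t)
  β := E.row 0
  κ := E.shift
  ρ := weights E f
  three_le := F.three_le
  b_congr i j h := by
    rw [show (F.y ^ j : Rˣ) = F.y ^ i * F.y ^ (j - i) by rw [← zpow_add, add_sub_cancel],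
      Units.val_mul, mul_assoc, F.pow_b _ h]
  φ_congr i j h := by
    rw [show (F.y ^ (-i) : Rˣ) = F.y ^ (j - i) * F.y ^ (-j) by rw [← zpow_add]; congr 1; ring,
      Units.val_mul, ← mul_assoc]
    congr 1
    simp only [row₁, add_mul, mul_assoc, F.a'_pow _ h]
    rw [← Units.val_mul, ← zpow_add, add_comm (-1 : ℤ), zpow_add, Units.val_mul, ← mul_assoc F.b',
      F.b'_pow _ h]
  φ_a i j h := by
    subst h
    rw [conj_pow, row₁_mul, sub_self, F.a_a _ (dvd_zero _), F.b_a, mul_one, add_zero]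
  φ_a_zero i j h := by
    rw [conj_pow, row₁_mul, F.a_a_zero _ h, F.b_a, mul_zero, add_zero]
  φ_b i j h := by
    subst h
    rw [conj_pow, row₁_mul, F.a_b, F.b_b _ (by simp), mul_zero, zero_add]
  φ_b_zero i j h := by
    rw [conj_pow, row₁_mul, F.a_b, F.b_b_zero _ h, mul_zero, zero_add]
  φ_c i j := by rw [conj_pow, row₁_mul, F.a_c, F.b_c, mul_zero, zero_add]
  χ_a_left i j h := by
    subst h
    have h2 : ¬ q ∣ i - 1 - i - 1 :=
      not_dvd_of_lt (by omega) (by have := F.three_le; omega) (by have := F.three_le; omega)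
    rw [conj_pow, row₂_mul, F.b_a, F.a_a _ (by simp), F.a_a_zero _ h2, F.c_a]
    simp
  χ_a_right i j h := by
    subst h
    have h2 : ¬ q ∣ i + 1 - i + 1 :=
      not_dvd_of_lt (by omega) (by have := F.three_le; omega) (by have := F.three_le; omega)
    rw [conj_pow, row₂_mul, F.b_a, F.a_a_zero _ h2, F.a_a _ (by simp), F.c_a]
    simp
  χ_a_zero i j h h2 := by
    rw [conj_pow, row₂_mul, F.b_a, F.a_a_zero _ h, F.a_a_zero _ h2, F.c_a]
    simp
  χ_b i j h := by
    subst h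
    rw [conj_pow, row₂_mul, F.a_b, F.a_b, F.b_b _ (by simp), F.c_b]
    simp
  χ_b_zero i j h := by
    rw [conj_pow, row₂_mul, F.a_b, F.a_b, F.b_b_zero _ h, F.c_b]
    simp
  χ_c i j h := by
    subst h
    rw [conj_pow, row₂_mul, F.a_c, F.a_c, F.b_c, show i + 1 - i - 1 = 0 by ring, F.c_c']
    simp
  χ_c_zero i j h := by
    rw [conj_pow, row₂_mul, F.a_c, F.a_c, F.b_c, F.c_c_zero _ h]
    simp
  γ_a i j h := by
    subst h
    rw [conj_pow, row₃_mul, F.a_a _ (by simp), F.c_a, F.c_a]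
    simp
  γ_a_zero i j h := by
    rw [conj_pow, row₃_mul, F.a_a_zero _ h, F.c_a, F.c_a]
    simp
  γ_b i j := by
    rw [conj_pow, row₃_mul, F.a_b, F.c_b, F.c_b]
    simp
  γ_c i j h := by
    subst h
    have h2 : ¬ q ∣ j - j - 1 :=
      not_dvd_of_lt (by omega) (by have := F.three_le; omega) (by have := F.three_le; omega)
    rw [conj_pow, row₃_mul, F.a_c, F.c_c_zero _ h2, sub_self, F.c_c']
    simp
  γ_c_right i j h := by
    subst h
    have h2 : ¬ q ∣ i + 1 - i :=
      not_dvd_of_lt (by omega) (by have := F.three_le; omega) (by have := F.three_le; omega)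
    rw [conj_pow, row₃_mul, F.a_c, F.c_c_zero _ h2, show i + 1 - i - 1 = 0 by ring, F.c_c']
    simp
  γ_c_zero i j h h2 := by
    rw [conj_pow, row₃_mul, F.a_c, F.c_c_zero _ h2, F.c_c_zero _ h]
    simp
  β_ρ := h0

end ShiftFrame

namespace ShiftFrame

variable {R : Type*} [Ring R]

/-- The operator `1 + t⁻¹`. -/
def omega (t : Rˣ) : R := 1 + ↑t⁻¹

/-- A sequence starting with the first `L` terms of `g` for which the translates of the rows
of the Gram data generate. -/
def coeffs (t : Rˣ) (g : ℕ → R) (L m n : ℕ) : R :=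
  if n < L then g n
  else if n < 2 * L then omega t ^ L * g (n - L)
  else if n = 2 * L + m then omega t ^ (2 * L + m + 1) * t
  else if n = 2 * L + m + 2 then omega t ^ (2 * L + m + 3)
  else if n = 2 * L + m + 3 then 1 else 0

variable (t : Rˣ) (g : ℕ → R) {L m : ℕ}

theorem coeffs_fst {n : ℕ} (h : n < L) : coeffs t g L m n = g n := if_pos h

theorem coeffs_snd {n : ℕ} (h : n < L) : coeffs t g L m (L + n) = omega t ^ L * g n := by
  rw [coeffs, if_neg (by omega), if_pos (by omega), Nat.add_sub_cancel_left]

theorem coeffs_of_lt {n : ℕ} (h : n < m) : coeffs t g L m (2 * L + n) = 0 := by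
  simp only [coeffs]
  split_ifs <;> first | omega | rfl

theorem coeffs_add : coeffs t g L m (2 * L + m) = omega t ^ (2 * L + m + 1) * t := by
  simp only [coeffs]
  split_ifs <;> first | omega | rfl

theorem coeffs_add_one : coeffs t g L m (2 * L + m + 1) = 0 := by
  simp only [coeffs]
  split_ifs <;> first | omega | rfl

theorem coeffs_add_two : coeffs t g L m (2 * L + m + 2) = omega t ^ (2 * L + m + 3) := by
  simp only [coeffs]
  split_ifs <;> first | omega | rfl

theorem coeffs_add_three : coeffs t g L m (2 * L + m + 3) = 1 := by
  simp only [coeffs]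
  split_ifs <;> first | omega | rfl

theorem coeffs_of_le {n : ℕ} (h : 2 * L + m + 4 ≤ n) : coeffs t g L m n = 0 := by
  simp only [coeffs]
  split_ifs <;> first | omega | rfl

theorem inv_omega_pow (n : ℕ) : (↑t⁻¹ : R) * omega t ^ n = omega t ^ n * ↑t⁻¹ :=
  ((Commute.one_right _).add_right (Commute.refl (↑t⁻¹ : R))).pow_right n

variable (R) in
theorem add_self_eq_zero_of_module {M : Type*} [AddCommGroup M] [Module R M] [CharP R 2] (x : M) :
    x + x = 0 := by
  have : ((1 : R) + 1) • x = 0 := by rw [CharTwo.add_self_eq_zero, zero_smul]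
  rwa [add_smul, one_smul] at this

variable {M : Type*} [AddCommGroup M] [Module R M] [CharP R 2]

/-- The recursion satisfied modulo the rows. -/
theorem eq_zero_of_recursion {Z A : ℕ → M} (hL : ∀ n, A (n + L) = A n)
    (h0 : Z 0 = A (m + 3) + (t : R) • A (m + 1))
    (hZ : ∀ n, n < 2 * L + m + 4 →
      Z (n + 1) = omega t • Z n + (↑t⁻¹ * coeffs t g L m n * t) • A (n + 1))
    (hN : Z (2 * L + m + 4) = 0) : A (2 * L + m + 4) = 0 := by
  have h2 : ∀ x : M, x + x = 0 := add_self_eq_zero_of_module R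
  have hL2 : ∀ n, A (2 * L + n) = A n := fun n => by
    rw [show 2 * L + n = n + L + L by ring, hL, hL]
  let W : ℕ → M := fun n =>
    Nat.rec 0 (fun n w => omega t • w + (↑t⁻¹ * g n * t : R) • A (n + 1)) n
  have hW : ∀ n, W (n + 1) = omega t • W n + (↑t⁻¹ * g n * t : R) • A (n + 1) := fun n => rfl
  have b1 : ∀ n, n ≤ L → Z n = omega t ^ n • Z 0 + W n := by
    intro n
    induction n with
    | zero => intro _; simp [W]
    | succ n ih =>
      intro hn
      rw [hZ n (by omega), ih (by omega), hW, coeffs_fst t g (by omega), smul_add, smul_smul,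
        pow_succ', add_assoc]
  have b2 : ∀ n, n ≤ L →
      Z (L + n) = omega t ^ (L + n) • Z 0 + omega t ^ n • W L + omega t ^ L • W n := by
    intro n
    induction n with
    | zero =>
      intro _
      rw [b1 _ (by omega), add_zero, pow_zero, one_smul, show W 0 = 0 from rfl, smul_zero, add_zero]
    | succ n ih =>
      intro hn
      rw [← add_assoc, hZ (L + n) (by omega), ih (by omega), hW, coeffs_snd t g (by omega),
        show L + n + 1 = n + 1 + L by ring, hL, ← mul_assoc, inv_omega_pow]
      simp only [smul_add, smul_smul, ← pow_succ', ← pow_succ, mul_assoc]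
      rw [show L + n + 1 = n + 1 + L by ring]
      abel
  have b3 : ∀ n, n ≤ m → Z (2 * L + n) = omega t ^ (2 * L + n) • Z 0 := by
    intro n
    induction n with
    | zero =>
      intro _
      have := b2 L le_rfl
      rwa [add_assoc, h2, add_zero, ← two_mul] at this
    | succ n ih =>
      intro hn
      rw [← add_assoc, hZ (2 * L + n) (by omega), ih (by omega), coeffs_of_lt t g (by omega),
        mul_zero, zero_mul, zero_smul, add_zero, smul_smul, ← pow_succ']
  have b4 : Z (2 * L + m + 1) = omega t ^ (2 * L + m + 1) • A (m + 3) := by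
    rw [hZ _ (by omega), b3 m le_rfl, coeffs_add, h0, smul_smul, ← pow_succ', smul_add, smul_smul,
      ← mul_assoc, inv_omega_pow, mul_assoc _ (↑t⁻¹ : R), Units.inv_mul, mul_one, add_assoc,
      add_assoc (2 * L), hL2, h2, add_zero]
  have b5 : Z (2 * L + m + 2) = omega t ^ (2 * L + m + 2) • A (m + 3) := by
    rw [hZ _ (by omega), b4, coeffs_add_one, mul_zero, zero_mul, zero_smul, add_zero, smul_smul,
      ← pow_succ']
  have b6 : Z (2 * L + m + 3) = 0 := by
    rw [hZ _ (by omega), b5, coeffs_add_two, smul_smul, ← pow_succ', inv_omega_pow, mul_assoc,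
      Units.inv_mul, mul_one, show 2 * L + m + 2 + 1 = 2 * L + (m + 3) by ring, hL2, h2]
  have b7 := hZ (2 * L + m + 3) (by omega)
  rw [hN, b6, smul_zero, zero_add, coeffs_add_three, mul_one, Units.inv_mul, one_smul] at b7
  exact b7.symm

/-- Modulo the rows of the Gram data everything vanishes. -/
theorem eq_zero_of_rows {A B C : ℤ → M} (E : Frame (Fin (2 * L + m + 4)) R)
    (hL : ((m + 3 : ℕ) : ℤ) ∣ L)
    (hA : ∀ i j, ((m + 3 : ℕ) : ℤ) ∣ j - i → A i = A j)
    (h1 : ∀ i, ((t : R) + 1) • A i + B (i + 1) = 0)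
    (h2 : ∀ i, ((t : R) + 1) • B i + A (i - 1) + (t : R) • A (i + 1)
      + (E.row 0 * (E.diag fun _ => t)) • C (i + 1) = 0)
    (h3 : ∀ i, ((E.diag fun _ => t : R) + 1) • C i + (E.shift * (E.diag fun _ => t)) • C (i + 1)
      + (weights E (coeffs t g L m) * t) • A (i + 1) = 0) (i : ℤ) :
    A i = 0 ∧ B i = 0 ∧ C i = 0 := by
  have hM : ∀ x : M, x + x = 0 := add_self_eq_zero_of_module R
  have eq_of : ∀ {x y : M}, x + y = 0 → x = y := fun {x y} h => by
    rw [eq_neg_of_add_eq_zero_left h, eq_comm, ← add_eq_zero_iff_eq_neg, hM]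
  have tinj : ∀ {x y : M}, (t : R) • x = (t : R) • y → x = y := fun {x y} h => by
    simpa [smul_smul] using congrArg (fun z => (↑t⁻¹ : R) • z) h
  have hZ0 : ∀ i, E.row 0 • C i = A i + (t : R) • A (i - 2) := by
    intro i
    obtain ⟨i, rfl⟩ : ∃ j, i = j + 1 := ⟨i - 1, by ring⟩
    have e1 := eq_of (h1 (i - 1))
    rw [sub_add_cancel] at e1
    have e2 := h2 i
    rw [E.row_diag, ← smul_smul] at e2
    refine tinj ((eq_of e2).symm.trans ?_)
    rw [← e1, smul_smul, show i + 1 - 2 = i - 1 by ring, smul_add, smul_smul]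
    simp only [mul_add, add_mul, add_smul, mul_one, one_mul, one_smul]
    have := hM ((t : R) • A (i - 1))
    have h' := hM (A (i - 1))
    calc _ = (↑t * ↑t : R) • A (i - 1) + ((t : R) • A (i - 1) + (t : R) • A (i - 1))
          + (A (i - 1) + A (i - 1)) + (t : R) • A (i + 1) := by abel
      _ = _ := by rw [this, h']; abel
  have hZ : ∀ i (n : ℕ), n < 2 * L + m + 4 → E.row (n + 1) • C (i + 1) =
      omega t • (E.row n • C i) + (↑t⁻¹ * coeffs t g L m n * t : R) • A (i + 1) := by
    intro i n hn
    have e1 := congrArg (fun z => E.row n • z) (h3 i)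
    simp only [smul_add, smul_smul, smul_zero, mul_add, mul_one, ← mul_assoc, E.row_shift,
      E.row_diag, weights, E.row_mul_sum, if_pos hn] at e1
    refine tinj (eq_of ?_).symm
    rw [← e1]
    simp only [omega, smul_add, smul_smul, mul_add, add_mul, mul_one, one_mul, ← mul_assoc,
      Units.mul_inv]
    abel
  have hA0 : ∀ i, A i = 0 := by
    intro i
    set k : ℤ := i - (2 * L + m + 4) with hk
    have := eq_zero_of_recursion (L := L) (m := m) t g (Z := fun n => E.row n • C (k + n))
      (A := fun n => A (k + n)) ?_ ?_ ?_ ?_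
    · rw [← this]
      congr 1
      push_cast
      omega
    · intro n
      refine (hA _ _ ?_).symm
      convert hL using 1
      push_cast
      ring
    · simp only [hZ0]
      congr 1
      · refine hA _ _ ?_
        rw [show k + ((m + 3 : ℕ) : ℤ) - (k + (0 : ℕ)) = (m + 3 : ℕ) by push_cast; ring]
      · congr 1
        refine hA _ _ ?_
        rw [show k + ((m + 1 : ℕ) : ℤ) - (k + (0 : ℕ) - 2) = (m + 3 : ℕ) by push_cast; ring]
    · intro n hn
      have := hZ (k + n) n hn
      simpa only [Nat.cast_add, Nat.cast_one, ← add_assoc] using this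
    · show E.row _ • _ = (0 : M)
      rw [E.row_of_le le_rfl, zero_smul]
  refine ⟨hA0 i, ?_, ?_⟩
  · have := h1 (i - 1)
    rwa [hA0, smul_zero, zero_add, sub_add_cancel] at this
  · have hz : ∀ n i, n < 2 * L + m + 4 → E.row n • C i = 0 := by
      intro n
      induction n with
      | zero => intro i _; simp [hZ0, hA0]
      | succ n ih =>
        intro i hn
        have := hZ (i - 1) n (by omega)
        rwa [sub_add_cancel, hA0, ih _ (by omega), smul_zero, smul_zero, zero_add] at this
    rw [← one_smul R (C i), ← E.sum_s_row, Finset.sum_smul]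
    exact Finset.sum_eq_zero fun k _ => by rw [← smul_smul, hz k i k.2, smul_zero]

end ShiftFrame

theorem LeftGenerates.of_one {R : Type*} [Ring R] {A : Set R}
    (h : ∀ S : AddSubgroup R, (∀ r, ∀ v ∈ S, r * v ∈ S) → A ⊆ S → (1 : R) ∈ S) :
    LeftGenerates A := fun S hS hA v => by simpa using hS v 1 (h S hS hA)

theorem RightGenerates.of_one {R : Type*} [Ring R] {A : Set R}
    (h : ∀ S : AddSubgroup R, (∀ r, ∀ v ∈ S, v * r ∈ S) → A ⊆ S → (1 : R) ∈ S) :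
    RightGenerates A := fun S hS hA v => by simpa using hS v 1 (h S hS hA)

namespace ShiftFrame

variable {R : Type*} [Ring R]

theorem row_zero_weights {t : Rˣ} {g : ℕ → R} {L m : ℕ} (E : Frame (Fin (2 * L + m + 4)) R)
    (hL : 0 < L) (hg : g 0 = 1) : E.row 0 * weights E (coeffs t g L m) = 1 := by
  rw [weights, E.row_mul_sum, if_pos (by omega), coeffs_fst t g hL, hg]

theorem row_shift_pow_weights (t : Rˣ) (g : ℕ → R) {L m : ℕ} (E : Frame (Fin (2 * L + m + 4)) R)
    (k n : ℕ) : E.row k * (E.shift ^ n * weights E (coeffs t g L m)) = coeffs t g L m (k + n) := by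
  rw [← mul_assoc, E.row_shift_pow, weights, E.row_mul_sum]
  split_ifs with h
  · rfl
  · rw [coeffs_of_le _ _ (by omega)]

theorem spanning [CharP R 2] {t : Rˣ} {g : ℕ → R} {L m : ℕ} (F : ShiftFrame R (m + 3 : ℕ))
    (E : Frame (Fin (2 * L + m + 4)) R) (hL : ((m + 3 : ℕ) : ℤ) ∣ L) (hLpos : 0 < L)
    (hg : g 0 = 1) (hclosure : Subring.closure (g '' {n | n < L}) = ⊤) (hm : 1 ≤ m ∨ t = 1) :
    (F.gramData t E (coeffs t g L m) (row_zero_weights E hLpos hg)).Spanning where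
  admissible := by
    rcases hm with h | h
    · left; push_cast; omega
    · rcases Nat.eq_zero_or_pos m with rfl | h'
      · exact Or.inr ⟨rfl, h⟩
      · left; push_cast; omega
  closure_eq := by
    rw [eq_top_iff, ← hclosure, Subring.closure_le]
    rintro _ ⟨n, hn, rfl⟩
    refine Subring.subset_closure ⟨n, ?_⟩
    show E.row 0 * E.shift ^ n * weights E (coeffs t g L m) = g n
    rw [mul_assoc, row_shift_pow_weights, zero_add, coeffs_fst t g hn]
  left_β := LeftGenerates.of_one fun S hS hA => by
    rw [← E.sum_s_row]
    refine sum_mem fun k _ => hS _ _ (hA ⟨k, ?_⟩)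
    show E.row 0 * E.shift ^ (k : ℕ) = _
    rw [E.row_shift_pow, zero_add]
  right_ρ := RightGenerates.of_one fun S hS hA => by
    have key : ∀ k, ∀ hk : k < 2 * L + m + 4, E.s ⟨k, hk⟩ ∈ S := by
      intro k
      induction k using Nat.strong_induction_on with
      | _ k ih =>
        intro hk
        set v := E.shift ^ (2 * L + m + 3 - k) * weights E (coeffs t g L m) with hv
        have hvS : v ∈ S := hA ⟨_, rfl⟩
        have hv' : v = ∑ j : Fin (2 * L + m + 4),
            E.s j * coeffs t g L m (j + (2 * L + m + 3 - k)) := by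
          refine E.ext_row fun i hi => ?_
          rw [hv, row_shift_pow_weights,
            E.row_mul_sum i fun j => coeffs t g L m (j + (2 * L + m + 3 - k)), if_pos hi]
        rw [← Finset.add_sum_erase _ _ (Finset.mem_univ ⟨k, hk⟩)] at hv'
        simp only [] at hv'
        rw [show k + (2 * L + m + 3 - k) = 2 * L + m + 3 by omega, coeffs_add_three, mul_one] at hv'
        rw [← sub_eq_iff_eq_add] at hv'
        rw [← hv']
        refine S.sub_mem hvS (sum_mem fun j hj => ?_)
        rcases lt_or_ge (j : ℕ) k with h | h
        · exact hS _ _ (ih j h j.2)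
        · have : (j : ℕ) ≠ k := fun h' => Finset.ne_of_mem_erase hj (Fin.ext h')
          rw [coeffs_of_le _ _ (by omega), mul_zero]
          exact S.zero_mem
    rw [← E.sum_s_t]
    exact sum_mem fun k _ => hS _ _ (key k k.2)
  rows := LeftGenerates.of_one fun S hS hA => by
    let I : Submodule R R := { S with smul_mem' := fun r v hv => hS r v hv }
    have hI : ∀ v, v ∈ S ↔ (Submodule.Quotient.mk v : R ⧸ I) = 0 := fun v =>
      (Submodule.Quotient.mk_eq_zero I).symm
    have hsmul : ∀ r v : R, (Submodule.Quotient.mk (r * v) : R ⧸ I)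
        = r • Submodule.Quotient.mk v := fun r v => rfl
    have hpow : ∀ (r : R) (n i : ℤ),
        r * (F.y ^ n : Rˣ) * (F.y ^ i : Rˣ) = r * (F.y ^ (n + i) : Rˣ) :=
      fun r n i => by rw [zpow_add, Units.val_mul, mul_assoc]
    have hzero := eq_zero_of_rows t g (M := R ⧸ I)
      (A := fun i => Submodule.Quotient.mk (F.a' * (F.y ^ (-i) : Rˣ)))
      (B := fun i => Submodule.Quotient.mk (F.b' * (F.y ^ (-i) : Rˣ)))
      (C := fun i => Submodule.Quotient.mk (F.c' * (F.y ^ (-i) : Rˣ))) E hL ?_ ?_ ?_ ?_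
    · simp only [← hI] at hzero
      rw [← F.sum_eq_one]
      exact sum_mem fun i _ => S.add_mem (S.add_mem (hS _ _ (hzero i).1) (hS _ _ (hzero i).2.1))
        (hS _ _ (hzero i).2.2)
    · intro i j h
      rw [show -i = j - i + -j by ring, ← hpow, F.a'_pow _ h]
    · intro i
      rw [← hsmul, ← Submodule.Quotient.mk_add, ← hI]
      have := SetLike.mem_coe.1 (hA (Or.inl (Or.inl ⟨i, rfl⟩)))
      convert this using 1
      show _ = F.row₁ t * (F.y ^ (-i) : Rˣ)
      simp only [row₁, add_mul, mul_assoc, ← Units.val_mul, ← zpow_add]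
      rw [neg_add, add_comm (-i)]
    · intro i
      rw [← hsmul, ← hsmul, ← hsmul, ← Submodule.Quotient.mk_add, ← Submodule.Quotient.mk_add,
        ← Submodule.Quotient.mk_add, ← hI]
      have := SetLike.mem_coe.1 (hA (Or.inl (Or.inr ⟨i, rfl⟩)))
      convert this using 1
      show _ = F.row₂ t E * (F.y ^ (-i) : Rˣ)
      simp only [row₂, add_mul, mul_assoc, ← Units.val_mul, ← zpow_add]
      rw [neg_sub, neg_add, sub_eq_add_neg, add_comm (-i)]
    · intro i
      rw [← hsmul, ← hsmul, ← hsmul, ← Submodule.Quotient.mk_add, ← Submodule.Quotient.mk_add,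
        ← hI]
      have := SetLike.mem_coe.1 (hA (Or.inr ⟨i, rfl⟩))
      convert this using 1
      show _ = F.row₃ t E _ * (F.y ^ (-i) : Rˣ)
      simp only [row₃, add_mul, mul_assoc, ← Units.val_mul, ← zpow_add]
      rw [neg_add, add_comm (-i)]
  columns := RightGenerates.of_one fun S hS hA => by
    rw [← F.sum_eq_one]
    exact sum_mem fun i _ => S.add_mem (S.add_mem (hS _ _ (hA (Or.inl (Or.inl ⟨i, rfl⟩))))
      (hS _ _ (hA (Or.inl (Or.inr ⟨i, rfl⟩))))) (hS _ _ (hA (Or.inr ⟨i, rfl⟩)))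

end ShiftFrame

namespace Frame

variable {R : Type*} [Ring R] {n : ℕ} [NeZero n] (C : Frame (Fin 3 × ZMod n) R) (θ : Rˣ)

/-- The cyclic shift on the second coordinate. -/
def rotation (n : ℕ) : Equiv.Perm (Fin 3 × ZMod n) :=
  Equiv.prodCongr (Equiv.refl _) (Equiv.addRight 1)

theorem rotation_apply (l : Fin 3) (i : ZMod n) : rotation n (l, i) = (l, i + 1) := rfl

/-- The diagonal twist at the end of the last cycle. -/
def twist (θ : Rˣ) (μ : Fin 3 × ZMod n) : Rˣ := if μ = (2, -1) then θ else 1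

/-- The cyclic shift with `θ` inserted in the last cycle. -/
def cycle : Rˣ := C.perm (rotation n) * C.diag (twist θ)

theorem cycle_s (l : Fin 3) (i : ZMod n) :
    (C.cycle θ : R) * C.s (l, i) = C.s (l, i + 1) * (twist θ (l, i) : Rˣ) := by
  rw [cycle, Units.val_mul, mul_assoc, diag_s, ← mul_assoc, perm_s, rotation_apply]

theorem twist_of_ne {l : Fin 3} (h : l ≠ 2) (i : ZMod n) : twist θ (l, i) = 1 := by
  simp [twist, h]

theorem exists_cycle_zpow_s (k : ℤ) : ∃ w : Fin 3 × ZMod n → Rˣ,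
    (∀ l i, ((C.cycle θ ^ k : Rˣ) : R) * C.s (l, i) = C.s (l, i + k) * w (l, i)) ∧
      ∀ l i, l ≠ 2 → w (l, i) = 1 := by
  induction k using Int.induction_on with
  | zero => exact ⟨1, by simp, by simp⟩
  | succ k ih =>
    obtain ⟨w, hw, hw1⟩ := ih
    refine ⟨fun μ => w (μ.1, μ.2 + 1) * twist θ μ, fun l i => ?_, fun l i h => ?_⟩
    · rw [zpow_add_one, Units.val_mul, mul_assoc, cycle_s, ← mul_assoc, hw]
      push_cast
      rw [mul_assoc, add_assoc, add_comm 1 (k : ZMod n)]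
    · simp [hw1 _ _ h, twist_of_ne θ h]
  | pred k ih =>
    obtain ⟨w, hw, hw1⟩ := ih
    refine ⟨fun μ => w (μ.1, μ.2 - 1) * (twist θ (μ.1, μ.2 - 1))⁻¹, fun l i => ?_, fun l i h => ?_⟩
    · have : ((C.cycle θ)⁻¹ : Rˣ) * C.s (l, i) =
          C.s (l, i - 1) * ((twist θ (l, i - 1))⁻¹ : Rˣ) := by
        rw [Units.inv_mul_eq_iff_eq_mul, ← mul_assoc, cycle_s, sub_add_cancel, mul_assoc,
          Units.mul_inv, mul_one]
      rw [zpow_sub_one, Units.val_mul, mul_assoc, this, ← mul_assoc, hw]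
      push_cast
      rw [mul_assoc, sub_add_eq_add_sub, add_sub_assoc]
    · simp [hw1 _ _ h, twist_of_ne θ h]

theorem cycle_zpow_s {l : Fin 3} (h : l ≠ 2) (i : ZMod n) (k : ℤ) :
    ((C.cycle θ ^ k : Rˣ) : R) * C.s (l, i) = C.s (l, i + k) := by
  obtain ⟨w, hw, hw1⟩ := C.exists_cycle_zpow_s θ k
  rw [hw, hw1 _ _ h, Units.val_one, mul_one]

theorem t_cycle_zpow_s_ne (k : ℤ) {l m : Fin 3} {i j : ZMod n} (h : (m, j) ≠ (l, i + k)) :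
    C.t (m, j) * (C.cycle θ ^ k : Rˣ) * C.s (l, i) = 0 := by
  obtain ⟨w, hw, -⟩ := C.exists_cycle_zpow_s θ k
  rw [mul_assoc, hw, ← mul_assoc, C.t_s_ne h, zero_mul]

theorem t_cycle_zpow {l : Fin 3} (h : l ≠ 2) (i : ZMod n) (k : ℤ) :
    C.t (l, i + k) * (C.cycle θ ^ k : Rˣ) = C.t (l, i) := by
  refine C.ext_right fun ⟨m, j⟩ => ?_
  by_cases hm : (l, i) = (m, j)
  · obtain ⟨rfl, rfl⟩ := Prod.mk.inj hm
    rw [mul_assoc, C.cycle_zpow_s θ h, t_s_self, t_s_self]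
  · rw [C.t_s_ne hm, t_cycle_zpow_s_ne]
    simpa using hm

theorem cycle_zpow_idempotent (k : ℤ) (l : Fin 3) (i : ZMod n) :
    ((C.cycle θ ^ k : Rˣ) : R) * C.s (l, i) * (C.t (l, i) * (C.cycle θ ^ (-k) : Rˣ)) =
      C.s (l, i + k) * C.t (l, i + k) := by
  rw [← mul_assoc, zpow_neg, Units.mul_inv_eq_iff_eq_mul]
  refine C.ext_right fun ⟨m, j⟩ => ?_
  by_cases hm : (l, i) = (m, j)
  · obtain ⟨rfl, rfl⟩ := Prod.mk.inj hm
    obtain ⟨w, hw, -⟩ := C.exists_cycle_zpow_s θ k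
    simp only [mul_assoc, t_s_self, mul_one, hw, mul_reassoc (C.t_s_self _), one_mul]
  · have h2 : (l, i + k) ≠ (m, j + k) := by simpa using hm
    rw [mul_assoc, mul_assoc, C.t_s_ne hm, mul_assoc, mul_assoc, ← mul_assoc (C.t _),
      t_cycle_zpow_s_ne _ _ _ h2, mul_zero, mul_zero, mul_zero]

end Frame

theorem ZMod.sum_range_cast {M : Type*} [AddCommMonoid M] (n : ℕ) [NeZero n] (f : ZMod n → M) :
    ∑ i ∈ Finset.range n, f i = ∑ i, f i :=
  Finset.sum_nbij' (fun i => (i : ZMod n)) ZMod.val (by simp) (by simp [ZMod.val_lt])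
    (fun i hi => ZMod.val_cast_of_lt (Finset.mem_range.1 hi)) (by simp) (by simp)

namespace Frame

variable {R : Type*} [Ring R] {n : ℕ} [NeZero n] (C : Frame (Fin 3 × ZMod n) R) (θ : Rˣ)

/-- The shift frame given by `Frame.cycle`. -/
def shiftFrame (hn : 3 ≤ n) : ShiftFrame R n where
  y := C.cycle θ
  a := C.s (0, 0)
  b := C.s (1, 0)
  c := C.s (2, 0)
  a' := C.t (0, 0)
  b' := C.t (1, 0)
  c' := C.t (2, 0)
  three_le := by exact_mod_cast hn
  a_a k h := by
    rw [← ZMod.intCast_zmod_eq_zero_iff_dvd] at h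
    rw [mul_assoc, C.cycle_zpow_s θ (by decide), h, add_zero, t_s_self]
  a_a_zero k h := by
    rw [← ZMod.intCast_zmod_eq_zero_iff_dvd] at h
    exact C.t_cycle_zpow_s_ne θ k (by simpa using Ne.symm h)
  a_b k := C.t_cycle_zpow_s_ne θ k (by simp)
  a_c k := C.t_cycle_zpow_s_ne θ k (by simp)
  b_a k := C.t_cycle_zpow_s_ne θ k (by simp)
  b_b k h := by
    rw [← ZMod.intCast_zmod_eq_zero_iff_dvd] at h
    rw [mul_assoc, C.cycle_zpow_s θ (by decide), h, add_zero, t_s_self]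
  b_b_zero k h := by
    rw [← ZMod.intCast_zmod_eq_zero_iff_dvd] at h
    exact C.t_cycle_zpow_s_ne θ k (by simpa using Ne.symm h)
  b_c k := C.t_cycle_zpow_s_ne θ k (by simp)
  c_a k := C.t_cycle_zpow_s_ne θ k (by simp)
  c_b k := C.t_cycle_zpow_s_ne θ k (by simp)
  c_c := C.t_s_self _
  c_c_zero k h := by
    rw [← ZMod.intCast_zmod_eq_zero_iff_dvd] at h
    exact C.t_cycle_zpow_s_ne θ k (by simpa using Ne.symm h)
  pow_b k h := by
    rw [← ZMod.intCast_zmod_eq_zero_iff_dvd] at h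
    rw [C.cycle_zpow_s θ (by decide), h, add_zero]
  a'_pow k h := by
    rw [← ZMod.intCast_zmod_eq_zero_iff_dvd] at h
    simpa [h] using C.t_cycle_zpow θ (l := 0) (by decide) 0 k
  b'_pow k h := by
    rw [← ZMod.intCast_zmod_eq_zero_iff_dvd] at h
    simpa [h] using C.t_cycle_zpow θ (l := 1) (by decide) 0 k
  sum_eq_one := by
    simp only [cycle_zpow_idempotent, zero_add, Int.toNat_natCast, Int.cast_natCast]
    rw [ZMod.sum_range_cast n fun i => C.s (0, i) * C.t (0, i) + C.s (1, i) * C.t (1, i)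
      + C.s (2, i) * C.t (2, i), ← C.sum_s_t, Fintype.sum_prod_type, Fin.sum_univ_three,
      ← Finset.sum_add_distrib, ← Finset.sum_add_distrib]

theorem cycle_pow_s_two (k : ℕ) (hk : k < n) :
    ((C.cycle θ ^ k : Rˣ) : R) * C.s (2, 0) = C.s (2, (k : ZMod n)) := by
  induction k with
  | zero => simp
  | succ k ih =>
    rw [pow_succ', Units.val_mul, mul_assoc, ih (by omega), cycle_s, twist, if_neg, Units.val_one,
      mul_one, Nat.cast_succ]
    intro h
    have h : ((k + 1 : ℕ) : ZMod n) = 0 := by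
      rw [Nat.cast_succ, (Prod.mk.inj h).2, neg_add_cancel]
    exact Nat.not_dvd_of_pos_of_lt (by omega) hk ((ZMod.natCast_eq_zero_iff _ _).1 h)

theorem cycle_pow_card_s_two : ((C.cycle θ ^ n : Rˣ) : R) * C.s (2, 0) = C.s (2, 0) * θ := by
  obtain ⟨k, hkn⟩ := Nat.exists_eq_succ_of_ne_zero (NeZero.ne n)
  have hk : (k : ZMod n) = -1 := by
    rw [eq_neg_iff_add_eq_zero, ← Nat.cast_succ, ← hkn, ZMod.natCast_self]
  rw [show C.cycle θ ^ n = C.cycle θ ^ (k + 1) from congrArg _ hkn, pow_succ', Units.val_mul,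
      mul_assoc, cycle_pow_s_two _ _ _ (by omega),
    cycle_s, hk, twist, if_pos rfl,
    neg_add_cancel]

theorem cycle_pow_mul_s_two (l : ℕ) :
    ((C.cycle θ ^ (n * l) : Rˣ) : R) * C.s (2, 0) = C.s (2, 0) * (θ ^ l : Rˣ) := by
  induction l with
  | zero => simp
  | succ l ih =>
    rw [mul_add_one, pow_add, Units.val_mul, mul_assoc, cycle_pow_card_s_two, ← mul_assoc, ih,
      mul_assoc, pow_succ, Units.val_mul]

theorem cycle_one_pow_card : C.cycle 1 ^ n = 1 := by
  have h1 : C.cycle 1 = C.perm (rotation n) := by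
    rw [cycle, show twist (n := n) (1 : Rˣ) = 1 from funext fun μ => by simp [twist], map_one,
      mul_one]
  have h2 : ∀ k : ℕ, ∀ l i, (rotation n ^ k) (l, i) = (l, i + k) := by
    intro k
    induction k with
    | zero => simp
    | succ k ih =>
      intro l i
      rw [pow_succ', Equiv.Perm.mul_apply, ih, rotation_apply, Nat.cast_succ, add_assoc]
  rw [h1, ← map_pow, show rotation n ^ n = 1 from Equiv.ext fun ⟨l, i⟩ => by simp [h2], map_one]

end Frame

/-- The unit `1 + v ψ` when `ψ v = 0`. -/
def transvection {R : Type*} [Ring R] (v ψ : R) (h : ψ * v = 0) : Rˣ where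
  val := 1 + v * ψ
  inv := 1 - v * ψ
  val_inv := by
    have : v * ψ * (v * ψ) = 0 := by rw [mul_assoc, ← mul_assoc ψ, h, zero_mul, mul_zero]
    rw [mul_sub, mul_one, add_mul, this]; simp
  inv_val := by
    have : v * ψ * (v * ψ) = 0 := by rw [mul_assoc, ← mul_assoc ψ, h, zero_mul, mul_zero]
    rw [mul_add, mul_one, sub_mul, this]; simp

@[simp] theorem val_transvection {R : Type*} [Ring R] (v ψ : R) (h : ψ * v = 0) :
    (transvection v ψ h : R) = 1 + v * ψ := rfl

theorem OneAddMem.sum {R : Type*} [Ring R] [CharP R 2] {K : Subgroup Rˣ} {α : Type*}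
    (A : Finset α) (f : α → R) (hf : ∀ i ∈ A, OneAddMem K (f i))
    (h : ∀ i ∈ A, ∀ j ∈ A, f i * f j = 0) : OneAddMem K (∑ i ∈ A, f i) := by
  classical
  induction A using Finset.induction_on with
  | empty => simpa using OneAddMem.zero
  | insert a A ha ih =>
    rw [Finset.sum_insert ha]
    refine (hf a (Finset.mem_insert_self a A)).add
      (ih (fun i hi => hf i (Finset.mem_insert_of_mem hi))
        fun i hi j hj => h i (Finset.mem_insert_of_mem hi) j (Finset.mem_insert_of_mem hj)) ?_
    rw [Finset.mul_sum]
    exact Finset.sum_eq_zero fun i hi =>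
      h a (Finset.mem_insert_self a A) i (Finset.mem_insert_of_mem hi)

namespace Frame

section

variable {ι R : Type*} [Fintype ι] [DecidableEq ι] [Ring R] (E : Frame ι R)

/-- The group generated by elementary matrices. -/
def elementary : Subgroup Rˣ :=
  Subgroup.closure {u | ∃ i j r, i ≠ j ∧ (u : R) = 1 + E.s i * r * E.t j}

theorem oneAddMem_elementary {i j : ι} (h : i ≠ j) (r : R) :
    OneAddMem E.elementary (E.s i * r * E.t j) :=
  ⟨transvection (E.s i * r) (E.t j) (by rw [← mul_assoc, E.t_s_ne h.symm, zero_mul]),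
    Subgroup.subset_closure ⟨i, j, r, h, rfl⟩, rfl⟩

theorem elementary_le {K : Subgroup Rˣ}
    (h : ∀ i j, i ≠ j → ∀ r, OneAddMem K (E.s i * r * E.t j)) : E.elementary ≤ K := by
  rw [elementary, Subgroup.closure_le]
  rintro u ⟨i, j, r, hij, hu⟩
  obtain ⟨v, hv, hvr⟩ := h i j hij r
  rwa [Units.ext (hu.trans hvr.symm)]

theorem comp_elementary_le [CharP R 2] {κ : Type*} [Fintype κ] [DecidableEq κ] (F : Frame κ R)
    {K : Subgroup Rˣ}
    (h : ∀ l m, l ≠ m → ∀ i j r, OneAddMem K ((E.comp F).s (l, i) * r * (E.comp F).t (m, j))) :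
    E.elementary ≤ K := by
  refine E.elementary_le fun l m hlm r => ?_
  have h1 := OneAddMem.sum (K := K) (Finset.univ : Finset (κ × κ))
    (fun μ => (E.comp F).s (l, μ.1) * (F.t μ.1 * r * F.s μ.2) * (E.comp F).t (m, μ.2))
    (fun μ _ => h l m hlm _ _ _) (fun μ _ ν _ => by
      simp only [mul_assoc]
      rw [← mul_assoc ((E.comp F).t _), (E.comp F).t_s_ne (by simp [hlm.symm])]
      simp)
  refine h1.congr ?_
  have h2 : E.s l * r * E.t m =
      E.s l * (∑ i, F.s i * F.t i) * r * (∑ i, F.s i * F.t i) * E.t m := by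
    rw [F.sum_s_t, mul_one, mul_one]
  rw [h2, Fintype.sum_prod_type, Finset.sum_comm]
  simp only [comp, Finset.mul_sum, Finset.sum_mul, mul_assoc]

end

end Frame

namespace ShiftFrame

variable {R : Type*} [Ring R] {q : ℤ} (F : ShiftFrame R q) (t : Rˣ) {N : ℕ}
  (E : Frame (Fin N) R) (f : ℕ → R) (h0 : E.row 0 * weights E f = 1)

theorem off_zero : (F.gramData t E f h0).off 0 =
    F.a * F.row₁ t + F.b * F.row₂ t E + F.c * F.row₃ t E f := by
  simp [GramData.off, gramData]

theorem zpow_mul_off (i : ℤ) : ((F.y ^ i : Rˣ) : R) * (F.gramData t E f h0).off 0 =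
    (F.gramData t E f h0).off i * (F.y ^ i : Rˣ) := by
  rw [off_zero]
  simp only [GramData.off, gramData, mul_add, add_mul, mul_assoc, zpow_neg, Units.inv_mul, mul_one]

end ShiftFrame

theorem ZMod.exists_ne_ne {n : ℕ} [NeZero n] (hn : 3 ≤ n) (a b : ZMod n) :
    ∃ j, j ≠ a ∧ j ≠ b := by
  have : ({a, b} : Finset (ZMod n)).card < Fintype.card (ZMod n) := by
    rw [ZMod.card]
    exact lt_of_le_of_lt Finset.card_le_two (by omega)
  rw [← Finset.card_univ] at this
  obtain ⟨j, hj⟩ := Finset.exists_mem_notMem_of_card_lt_card this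
  exact ⟨j, by simpa using hj.2⟩

namespace Frame

variable {R : Type*} [Ring R] [CharP R 2] {m : ℕ} (B : Frame (Fin 3) R)
  (I : Frame (ZMod (m + 3)) R) (θ t : Rˣ)

theorem elementary_le_closure {N : ℕ} (E : Frame (Fin N) R) (f : ℕ → R)
    (h0 : E.row 0 * ShiftFrame.weights E f = 1)
    (hD : (((B.comp I).shiftFrame θ (by omega)).gramData t E f h0).Spanning) {x : Rˣ}
    (hx : (x : R) = 1 + (((B.comp I).shiftFrame θ (by omega)).gramData t E f h0).off 0) :
    B.elementary ≤ Subgroup.closure {x, (B.comp I).cycle θ} := by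
  set C := B.comp I with hC
  set D := (C.shiftFrame θ (by omega)).gramData t E f h0 with hDdef
  set K := Subgroup.closure {x, C.cycle θ} with hK
  have hxK : x ∈ K := Subgroup.subset_closure (by simp)
  have hyK : C.cycle θ ∈ K := Subgroup.subset_closure (by simp)
  have hoff : ∀ i, OneAddMem K (D.off i) := fun i => by
    refine OneAddMem.conj (m := D.off 0) ⟨x, hxK, hx⟩ (K.zpow_mem hyK i) ?_
    exact (C.shiftFrame θ (by omega)).zpow_mul_off t E f h0 i
  refine B.comp_elementary_le I fun l k hlk i i' r => ?_
  rw [← hC]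
  obtain ⟨j, hj, hj'⟩ := ZMod.exists_ne_ne (by omega) (if l = 0 then i else i - 1) (i' - 1)
  have hjj : ((j.val : ℤ) : ZMod (m + 3)) = j := by simp
  refine D.elementary_mem hoff hD j.val ?_ ?_ ?_ r
  · show ShiftFrame.row₁ _ t * _ * _ = 0
    rw [ShiftFrame.row₁_mul]
    have h1 : (C.shiftFrame θ (by omega)).a' * ((C.cycle θ ^ (-(j.val : ℤ)) : Rˣ) : R) * C.s (l, i)
        = 0 := C.t_cycle_zpow_s_ne θ _ (by
      intro h
      have h1 := (Prod.mk.inj h).1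
      have h2 := (Prod.mk.inj h).2
      push_cast at h2
      rw [ZMod.natCast_zmod_val, ← sub_eq_add_neg] at h2
      exact hj (by rw [if_pos h1.symm, sub_eq_zero.1 h2.symm]))
    have h2 : (C.shiftFrame θ (by omega)).b' * ((C.cycle θ ^ (-(j.val : ℤ) - 1) : Rˣ) : R) *
        C.s (l, i) = 0 := C.t_cycle_zpow_s_ne θ _ (by
      intro h
      have h1 := (Prod.mk.inj h).1
      have h2 := (Prod.mk.inj h).2
      push_cast at h2
      rw [ZMod.natCast_zmod_val] at h2
      refine hj ?_
      rw [if_neg (by rw [← h1]; decide), ← sub_eq_zero, ← neg_eq_zero, h2]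
      ring)
    exact (congrArg₂ (· + ·) (congrArg _ h1) h2).trans (by simp)
  · have : D.b (j.val + 1) = C.s (1, j + 1) := by
      show ((C.cycle θ ^ _ : Rˣ) : R) * C.s (1, 0) = _
      rw [C.cycle_zpow_s θ (by decide)]
      simp
    rw [this, C.t_s_ne]
    intro h
    exact hj' (by rw [(Prod.mk.inj h).2]; ring)
  · exact C.t_s_ne (by simp [Ne.symm hlk])

end Frame

theorem map_mem_commutator {G H : Type*} [Group G] [Group H] (f : G →* H) {g : G}
    (hg : g ∈ commutator G) : f g ∈ commutator H := by
  have h : (commutator G).map f ≤ commutator H := by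
    rw [commutator_def, Subgroup.map_commutator]
    exact Subgroup.commutator_mono le_top le_top
  exact h (Subgroup.mem_map_of_mem f hg)

namespace Frame

variable {ι R : Type*} [Fintype ι] [DecidableEq ι] [Ring R] (E : Frame ι R)

theorem diag_mem_commutator {d : ι → Rˣ} (hd : ∀ i, d i ∈ commutator Rˣ) :
    E.diag d ∈ commutator Rˣ := by
  refine map_mem_commutator E.diag ?_
  exact Subgroup.pi_mem_of_mulSingle_mem _ fun i =>
    map_mem_commutator (MonoidHom.mulSingle (fun _ => Rˣ) i) (hd i)

theorem val_diag_mulSingle (i : ι) (u : Rˣ) :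
    (E.diag (Pi.mulSingle i u) : R) = 1 + E.s i * (u - 1) * E.t i := by
  refine E.ext_right fun j => ?_
  rw [diag_s, add_mul, mul_assoc _ (E.t i), E.t_s]
  by_cases h : i = j
  · subst h; simp [mul_sub]
  · simp [h, Pi.mulSingle_eq_of_ne (Ne.symm h)]

variable [CharP R 2] {K : Subgroup Rˣ}
  (hK : ∀ i j, i ≠ j → ∀ r, OneAddMem K (E.s i * r * E.t j))

include hK

theorem exists_mem_swap {i j : ι} (hij : i ≠ j) (v : Rˣ) : ∃ u ∈ K,
    (u : R) * E.s i = E.s j * (v⁻¹ : Rˣ) ∧ (u : R) * E.s j = E.s i * v ∧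
      ∀ k, k ≠ i → k ≠ j → (u : R) * E.s k = E.s k := by
  obtain ⟨e, he, he'⟩ := hK i j hij v
  obtain ⟨f, hf, hf'⟩ := hK j i hij.symm (v⁻¹ : Rˣ)
  have e1 : (e : R) * E.s i = E.s i := by
    rw [he', add_mul, one_mul, mul_assoc, E.t_s_ne hij.symm, mul_zero, add_zero]
  have e2 : (e : R) * E.s j = E.s j + E.s i * v := by
    rw [he', add_mul, one_mul, mul_assoc, E.t_s_self, mul_one]
  have f1 : (f : R) * E.s j = E.s j := by
    rw [hf', add_mul, one_mul, mul_assoc, E.t_s_ne hij, mul_zero, add_zero]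
  have f2 : (f : R) * E.s i = E.s i + E.s j * (v⁻¹ : Rˣ) := by
    rw [hf', add_mul, one_mul, mul_assoc, E.t_s_self, mul_one]
  refine ⟨e * f * e, K.mul_mem (K.mul_mem he hf) he, ?_, ?_, fun k hi hj => ?_⟩
  · rw [Units.val_mul, Units.val_mul, mul_assoc, mul_assoc, e1, f2, mul_add, e1, ← mul_assoc, e2,
      add_mul, mul_assoc, Units.mul_inv, mul_one, add_comm (E.s j * _), CharTwo.add_cancel_left]
  · rw [Units.val_mul, Units.val_mul, mul_assoc, mul_assoc, e2, mul_add, f1, ← mul_assoc, f2,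
      add_mul, mul_assoc, Units.inv_mul, mul_one, add_comm (E.s i * _), CharTwo.add_cancel_left,
      ← mul_assoc, e1]
  · have hk1 : (e : R) * E.s k = E.s k := by
      rw [he', add_mul, one_mul, mul_assoc, E.t_s_ne (Ne.symm hj), mul_zero, add_zero]
    have hk2 : (f : R) * E.s k = E.s k := by
      rw [hf', add_mul, one_mul, mul_assoc, E.t_s_ne (Ne.symm hi), mul_zero, add_zero]
    rw [Units.val_mul, Units.val_mul, mul_assoc, mul_assoc, hk1, hk2, hk1]

theorem perm_mem (π : Equiv.Perm ι) : E.perm π ∈ K := by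
  suffices h : (⊤ : Subgroup (Equiv.Perm ι)) ≤ K.comap E.perm from h (Subgroup.mem_top π)
  rw [← Equiv.Perm.closure_isSwap, Subgroup.closure_le]
  rintro _ ⟨i, j, hij, rfl⟩
  obtain ⟨u, hu, h1, h2, h3⟩ := E.exists_mem_swap hK hij 1
  have : E.perm (Equiv.swap i j) = u := Units.ext <| E.ext_right fun k => by
    rw [perm_s]
    by_cases hi : k = i
    · simp [hi, h1]
    · by_cases hj : k = j
      · simp [hj, h2]
      · rw [h3 k hi hj, Equiv.swap_apply_of_ne_of_ne hi hj]
  show E.perm _ ∈ K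
  rwa [this]

theorem diag_mulSingle_mul_inv_mem {i j : ι} (hij : i ≠ j) (v : Rˣ) :
    E.diag (Pi.mulSingle i v * Pi.mulSingle j v⁻¹) ∈ K := by
  obtain ⟨u, hu, h1, h2, h3⟩ := E.exists_mem_swap hK hij v
  obtain ⟨w, hw, h1', h2', h3'⟩ := E.exists_mem_swap hK hij 1
  have : E.diag (Pi.mulSingle i v * Pi.mulSingle j v⁻¹) = u * w :=
    Units.ext <| E.ext_right fun k => by
      rw [diag_s, Units.val_mul, mul_assoc]
      by_cases hi : k = i
      · subst hi; simp [h1', h2, Pi.mulSingle_eq_of_ne hij]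
      · by_cases hj : k = j
        · subst hj; simp [h2', h1, Pi.mulSingle_eq_of_ne hi]
        · simp [h3' k hi hj, h3 k hi hj, Pi.mulSingle_eq_of_ne hi, Pi.mulSingle_eq_of_ne hj]
  rw [this]
  exact K.mul_mem hu hw

theorem diag_mulSingle_mem (h3 : 3 ≤ Fintype.card ι) (i : ι) {u : Rˣ} (hu : u ∈ commutator Rˣ) :
    E.diag (Pi.mulSingle i u) ∈ K := by
  suffices h : commutator Rˣ ≤ K.comap (E.diag.comp (MonoidHom.mulSingle (fun _ => Rˣ) i)) from h hu
  rw [commutator_eq_closure, Subgroup.closure_le]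
  rintro _ ⟨v, w, rfl⟩
  obtain ⟨j, hj⟩ := Finset.exists_mem_notMem_of_card_lt_card
    (s := {i}) (t := (Finset.univ : Finset ι)) (by simpa using by omega)
  obtain ⟨k, hk⟩ := Finset.exists_mem_notMem_of_card_lt_card
    (s := {i, j}) (t := (Finset.univ : Finset ι))
    (lt_of_le_of_lt Finset.card_le_two (by simpa using by omega))
  simp only [Finset.mem_univ, Finset.mem_insert, Finset.mem_singleton, true_and, not_or] at hj hk
  have : ⁅(Pi.mulSingle i v * Pi.mulSingle j v⁻¹ : ι → Rˣ),
      (Pi.mulSingle i w * Pi.mulSingle k w⁻¹ : ι → Rˣ)⁆ = Pi.mulSingle i ⁅v, w⁆ := by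
    funext l
    simp only [commutatorElement_def, Pi.mul_apply, Pi.inv_apply]
    by_cases h1 : l = i
    · subst h1
      simp [Pi.mulSingle_eq_of_ne (Ne.symm hj), Pi.mulSingle_eq_of_ne (Ne.symm hk.1)]
    · by_cases h2 : l = j
      · subst h2
        simp [Pi.mulSingle_eq_of_ne h1, Pi.mulSingle_eq_of_ne (Ne.symm hk.2)]
      · simp [Pi.mulSingle_eq_of_ne h1, Pi.mulSingle_eq_of_ne h2]
  show E.diag (Pi.mulSingle i ⁅v, w⁆) ∈ K
  rw [← this, map_commutatorElement]
  have hv := E.diag_mulSingle_mul_inv_mem hK (Ne.symm hj) v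
  have hw := E.diag_mulSingle_mul_inv_mem hK (Ne.symm hk.1) w
  exact K.mul_mem (K.mul_mem (K.mul_mem hv hw) (K.inv_mem hv)) (K.inv_mem hw)

theorem diag_mem (h3 : 3 ≤ Fintype.card ι) {d : ι → Rˣ} (hd : ∀ i, d i ∈ commutator Rˣ) :
    E.diag d ∈ K := by
  exact Subgroup.pi_mem_of_mulSingle_mem (H := K.comap E.diag) d fun i =>
    E.diag_mulSingle_mem hK h3 i (hd i)

omit hK

theorem oneAddMem_elementary_corner (h2 : 2 ≤ Fintype.card ι) (i : ι) {v ψ : R} (h : ψ * v = 0) :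
    OneAddMem E.elementary (E.s i * v * (ψ * E.t i)) := by
  obtain ⟨j, hj⟩ := Finset.exists_mem_notMem_of_card_lt_card
    (s := {i}) (t := (Finset.univ : Finset ι)) (by simpa using by omega)
  simp only [Finset.mem_univ, Finset.mem_singleton, true_and] at hj
  refine ((E.oneAddMem_elementary (Ne.symm hj) v).mul (E.oneAddMem_elementary hj ψ) ?_ ?_).congr ?_
  · simp [mul_assoc, mul_reassoc (E.t_s_ne (Ne.symm hj))]
  · simp [mul_assoc, mul_reassoc (E.t_s_self i), mul_reassoc h]
  · simp [mul_assoc, mul_reassoc (E.t_s_self j)]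

theorem oneAddMem_elementary_comp {κ : Type*} [Fintype κ] [DecidableEq κ] (F : Frame κ R)
    (h2 : 2 ≤ Fintype.card ι) (μ ν : ι × κ) (h : μ ≠ ν) (r : R) :
    OneAddMem E.elementary ((E.comp F).s μ * r * (E.comp F).t ν) := by
  obtain ⟨i, k⟩ := μ
  obtain ⟨j, l⟩ := ν
  by_cases hij : i = j
  · subst hij
    have hkl : l ≠ k := by rintro rfl; exact h rfl
    refine (E.oneAddMem_elementary_corner h2 i (v := F.s k * r) (ψ := F.t l) ?_).congr ?_
    · rw [← mul_assoc, F.t_s_ne hkl, zero_mul]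
    · simp [comp, mul_assoc]
  · refine (E.oneAddMem_elementary hij (F.s k * r * F.t l)).congr ?_
    simp [comp, mul_assoc]

end Frame

namespace Frame

section

variable {R : Type*} [Ring R] {m : ℕ} (C : Frame (Fin 3 × ZMod (m + 3)) R) (θ t : Rˣ)

theorem _root_.ZMod.one_ne_zero_add_three : (1 : ZMod (m + 3)) ≠ 0 := by
  have : (1 : ZMod (m + 3)).val ≠ 0 := by rw [ZMod.val_one'' (by omega)]; exact one_ne_zero
  intro h
  rw [h, ZMod.val_zero] at this
  exact this rfl

theorem t_zero_mul_inv (l : Fin 3) :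
    C.t (l, 0) * ((C.cycle θ ^ (-1 : ℤ) : Rˣ) : R) = C.t (l, 1) := by
  rw [zpow_neg_one, Units.mul_inv_eq_iff_eq_mul]
  refine C.ext_right fun ⟨k, j⟩ => ?_
  rw [mul_assoc, cycle_s, ← mul_assoc, C.t_s, C.t_s]
  have h : (l, (1 : ZMod (m + 3))) = (k, j + 1) ↔ (l, (0 : ZMod (m + 3))) = (k, j) := by
    simp only [Prod.mk.injEq, eq_comm (a := (1 : ZMod (m + 3))), eq_comm (a := (0 : ZMod (m + 3))),
      add_eq_right]
  simp only [h]
  split_ifs with h'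
  · obtain ⟨rfl, rfl⟩ := Prod.mk.inj h'
    have : (0 : ZMod (m + 3)) ≠ -1 := fun h =>
      ZMod.one_ne_zero_add_three (by rw [← neg_eq_zero, ← h])
    simp [twist, this]
  · simp

theorem t_zero_mul_one {l : Fin 3} (h : l ≠ 2) :
    C.t (l, 0) * ((C.cycle θ ^ (1 : ℤ) : Rˣ) : R) = C.t (l, -1) := by
  have := C.t_cycle_zpow θ h (-1) 1
  simpa using this

theorem shiftFrame_row₁ : (C.shiftFrame θ (by omega)).row₁ t =
    (t + 1) * C.t (0, 0) + C.t (1, 1) := by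
  rw [ShiftFrame.row₁]
  exact congrArg _ (C.t_zero_mul_inv θ 1)

variable {N : ℕ} (E : Frame (Fin N) R) (f : ℕ → R)

theorem shiftFrame_row₂ : (C.shiftFrame θ (by omega)).row₂ t E =
    (t + 1) * C.t (1, 0) + C.t (0, -1) + t * C.t (0, 1)
      + E.row 0 * E.diag (fun _ => t) * C.t (2, 1) := by
  rw [ShiftFrame.row₂]
  exact congrArg₂ _ (congrArg₂ _ (congrArg _ (C.t_zero_mul_one θ (by decide)))
    (congrArg _ (C.t_zero_mul_inv θ 0))) (congrArg _ (C.t_zero_mul_inv θ 2))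

theorem shiftFrame_row₃ : (C.shiftFrame θ (by omega)).row₃ t E f =
    (E.diag (fun _ => t) + 1) * C.t (2, 0) + E.shift * E.diag (fun _ => t) * C.t (2, 1)
      + ShiftFrame.weights E f * t * C.t (0, 1) := by
  rw [ShiftFrame.row₃]
  exact congrArg₂ _ (congrArg _ (congrArg _ (C.t_zero_mul_inv θ 2)))
    (congrArg _ (C.t_zero_mul_inv θ 0))

/-- The diagonal part of the first generator. -/
def pivots (T : Rˣ) (μ : Fin 3 × ZMod (m + 3)) : Rˣ :=
  if μ.2 = 0 then if μ.1 = 2 then T else t else 1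

theorem val_diag_pivots [CharP R 2] (T : Rˣ) : (C.diag (pivots t T) : R) =
    1 + C.s (0, 0) * (t + 1) * C.t (0, 0) + C.s (1, 0) * (t + 1) * C.t (1, 0)
      + C.s (2, 0) * (T + 1) * C.t (2, 0) := by
  refine C.ext_right fun ⟨l, i⟩ => ?_
  rw [diag_s]
  simp only [add_mul, mul_assoc, C.t_s, pivots]
  by_cases hi : i = 0
  · subst hi
    fin_cases l <;> simp [mul_add, add_comm, CharTwo.add_cancel_left]
  · simp [hi, Ne.symm hi]

variable [CharP R 2] {K : Subgroup Rˣ}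
  (hK : ∀ μ ν, μ ≠ ν → ∀ r, OneAddMem K (C.s μ * r * C.t ν))

include hK

theorem cycle_mem (hθ : θ ∈ commutator Rˣ) : C.cycle θ ∈ K :=
  K.mul_mem (C.perm_mem hK _) (C.diag_mem hK
    (by rw [Fintype.card_prod, Fintype.card_fin, ZMod.card]; omega)
    fun μ => by rw [twist]; split_ifs; exacts [hθ, Subgroup.one_mem _])

theorem exists_mem_eq_off (ht : t ∈ commutator Rˣ) (h0 : E.row 0 * ShiftFrame.weights E f = 1) :
    ∃ x ∈ K, (x : R) =
      1 + ((C.shiftFrame θ (by omega)).gramData t E f h0).off 0 := by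
  have h1 := ZMod.one_ne_zero_add_three (m := m)
  have h2 : (-1 : ZMod (m + 3)) ≠ 0 := neg_ne_zero.2 h1
  set T := E.diag fun _ => t with hT
  have hD : C.diag (pivots t T) ∈ K := C.diag_mem hK
    (by rw [Fintype.card_prod, Fintype.card_fin, ZMod.card]; omega) fun μ => by
      rw [pivots]
      split_ifs
      exacts [E.diag_mem_commutator fun _ => ht, ht, Subgroup.one_mem _]
  have hz : ∀ (l k : Fin 3) (i : ZMod (m + 3)), i ≠ 0 → ∀ r, C.t (l, i) * (C.s (k, 0) * r) = 0 :=
    fun l k i hi r => by rw [← mul_assoc, C.t_s_ne (by simp [hi]), zero_mul]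
  have hoff : ∀ (l : Fin 3) (ν : Fin 3 × ZMod (m + 3)), ν.2 ≠ 0 → ∀ r,
      OneAddMem K (C.s (l, 0) * r * C.t ν) := fun l ν hν r =>
    hK _ _ (by rintro rfl; exact hν rfl) r
  obtain ⟨u, hu, hu'⟩ := (((((hoff 0 (1, 1) h1 1).add (hoff 1 (0, -1) h2 1) (by
    simp [mul_assoc, hz, h1])).add (hoff 1 (0, 1) h1 t) (by
    simp [mul_assoc, hz, h1, h2, add_mul])).add (hoff 1 (2, 1) h1 (E.row 0 * T)) (by
    simp [mul_assoc, hz, h1, h2, add_mul])).add (hoff 2 (2, 1) h1 (E.shift * T)) (by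
    simp [mul_assoc, hz, h1, h2, add_mul])).add
    (hoff 2 (0, 1) h1 (ShiftFrame.weights E f * t)) (by
    simp [mul_assoc, hz, h1, h2, add_mul])
  refine ⟨u * C.diag (pivots t T), K.mul_mem hu hD, ?_⟩
  have ht1 : ∀ l, C.t (l, 1) * (C.diag (pivots t T) : R) = C.t (l, 1) := fun l => by
    rw [t_diag, pivots, if_neg h1, Units.val_one, one_mul]
  have ht2 : ∀ l, C.t (l, -1) * (C.diag (pivots t T) : R) = C.t (l, -1) := fun l => by
    rw [t_diag, pivots, if_neg h2, Units.val_one, one_mul]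
  rw [ShiftFrame.off_zero, shiftFrame_row₁, shiftFrame_row₂, shiftFrame_row₃, Units.val_mul, hu']
  simp only [add_mul, mul_assoc, ht1, ht2, one_mul]
  rw [val_diag_pivots]
  simp only [shiftFrame, mul_add, add_mul, mul_assoc, one_mul, ← hT]
  abel

end

end Frame

theorem exists_isSimpleGroup_quotient {G : Type*} [Group G] {z : G} (hz1 : z ≠ 1)
    (hz : ∀ N : Subgroup G, N.Normal → z ∈ N → N = ⊤) :
    ∃ (N : Subgroup G) (_ : N.Normal), z ∉ N ∧ IsSimpleGroup (G ⧸ N) := by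
  obtain ⟨N, -, hN⟩ := zorn_le_nonempty₀ {N : Subgroup G | N.Normal ∧ z ∉ N}
    (fun c hc hchain y hy => by
      have hdir : DirectedOn (· ≤ ·) c := hchain.directedOn
      refine ⟨sSup c, ⟨⟨fun n hn g => ?_⟩, fun h => ?_⟩, fun s hs => le_sSup hs⟩
      · obtain ⟨K, hK, hnK⟩ := (Subgroup.mem_sSup_of_directedOn ⟨y, hy⟩ hdir).1 hn
        exact (Subgroup.mem_sSup_of_directedOn ⟨y, hy⟩ hdir).2
          ⟨K, hK, (hc hK).1.conj_mem n hnK g⟩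
      · obtain ⟨K, hK, hzK⟩ := (Subgroup.mem_sSup_of_directedOn ⟨y, hy⟩ hdir).1 h
        exact (hc hK).2 hzK) ⊥ ⟨inferInstance, by simpa using hz1⟩
  have := hN.prop.1
  have hzN := hN.prop.2
  have : Nontrivial (G ⧸ N) := ⟨z, 1, fun h => hzN ((QuotientGroup.eq_one_iff z).1 h)⟩
  refine ⟨N, hN.prop.1, hzN, ⟨fun M hM => ?_⟩⟩
  have hle : N ≤ M.comap (QuotientGroup.mk' N) := fun n hn => by
    rw [Subgroup.mem_comap, QuotientGroup.mk'_apply, (QuotientGroup.eq_one_iff n).2 hn]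
    exact M.one_mem
  by_cases hzM : z ∈ M.comap (QuotientGroup.mk' N)
  · right
    rw [eq_top_iff]
    intro g _
    obtain ⟨g, rfl⟩ := QuotientGroup.mk'_surjective N g
    exact (hz _ (hM.comap _) hzM ▸ Subgroup.mem_top g : g ∈ M.comap (QuotientGroup.mk' N))
  · left
    rw [eq_bot_iff]
    intro g hg
    obtain ⟨g, rfl⟩ := QuotientGroup.mk'_surjective N g
    exact (QuotientGroup.eq_one_iff g).2 (hN.le_of_ge ⟨hM.comap _, hzM⟩ hle hg)

/-- Some two-sided multiple of `r` is the identity. -/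
def TwoSidedInvertible {R : Type*} [Ring R] (r : R) : Prop := ∃ α γ, α * r * γ = 1

section NormalizedBy

variable {R : Type*} [Ring R] [CharP R 2]

/-- The subgroup `N` is normalized by `H`. -/
def NormalizedBy {G : Type*} [Group G] (N H : Subgroup G) : Prop :=
  ∀ h ∈ H, ∀ n ∈ N, h * n * h⁻¹ ∈ N

namespace OneAddMem

variable {N H : Subgroup Rˣ} (hN : NormalizedBy N H) {m n : R}

include hN

theorem mul_right_of_normalizedBy (hm : OneAddMem N m) (hn : OneAddMem H n) (hnn : n * n = 0)
    (hnm : n * m = 0) : OneAddMem N (m * n) := by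
  obtain ⟨u, hu, hu'⟩ := hm
  obtain ⟨v, hv, hv'⟩ := hn
  refine ⟨u * (v * u⁻¹ * v⁻¹), N.mul_mem hu (hN v hv _ (N.inv_mem hu)), ?_⟩
  have : (u : R) * v = (1 + m * n) * (v * u) := by
    simp only [hu', hv', mul_add, add_mul, mul_one, one_mul, mul_assoc, hnm, hnn, mul_zero,
      add_zero]
    abel
  rw [← val_commutatorElement_eq this, commutatorElement_def]
  simp only [mul_assoc]

theorem mul_left_of_normalizedBy (hm : OneAddMem H m) (hn : OneAddMem N n) (hnn : n * n = 0)
    (hnm : n * m = 0) : OneAddMem N (m * n) := by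
  obtain ⟨u, hu, hu'⟩ := hm
  obtain ⟨v, hv, hv'⟩ := hn
  refine ⟨u * v * u⁻¹ * v⁻¹, N.mul_mem (hN u hu v hv) (N.inv_mem hv), ?_⟩
  have : (u : R) * v = (1 + m * n) * (v * u) := by
    simp only [hu', hv', mul_add, add_mul, mul_one, one_mul, mul_assoc, hnm, hnn, mul_zero,
      add_zero]
    abel
  rw [← val_commutatorElement_eq this, commutatorElement_def]

theorem conj_of_normalizedBy (hm : OneAddMem N m) {u : Rˣ} (hu : u ∈ H)
    (h : (u : R) * m = n * u) : OneAddMem N n := by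
  obtain ⟨v, hv, hv'⟩ := hm
  refine ⟨u * v * u⁻¹, hN u hu v hv, ?_⟩
  rw [Units.val_mul, Units.mul_inv_eq_iff_eq_mul, Units.val_mul, hv', mul_add, add_mul, h, mul_one,
    one_mul]

end OneAddMem

namespace Frame

variable (B : Frame (Fin 3) R) {N : Subgroup Rˣ} (hN : NormalizedBy N B.elementary)

include hN

theorem oneAddMem_of_zero_one (h : OneAddMem N (B.s 0 * B.t 1)) :
    B.elementary ≤ N := by
  refine B.elementary_le fun i j hij r => ?_
  obtain ⟨k, hik, hkj⟩ : ∃ k, i ≠ k ∧ k ≠ j := by revert i j; decide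
  obtain ⟨π, h0, h1⟩ : ∃ π : Equiv.Perm (Fin 3), π 0 = i ∧ π 1 = k := by
    clear hkj hij h; revert i k; decide
  have h2 : OneAddMem N (B.s i * B.t k) := h.conj_of_normalizedBy hN
    (B.perm_mem (fun i j hij r => B.oneAddMem_elementary hij r) π) (by
      rw [← mul_assoc, B.perm_s, mul_assoc, ← h1, B.t_perm, h0])
  refine (h2.mul_right_of_normalizedBy hN (B.oneAddMem_elementary hkj r) ?_ ?_).congr ?_
  · simp [mul_assoc, mul_reassoc (B.t_s_ne hkj.symm)]
  · simp [mul_assoc, mul_reassoc (B.t_s_ne hij.symm)]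
  · simp [mul_assoc, mul_reassoc (B.t_s_self k)]

theorem elementary_le_of_twoSidedInvertible {i j : Fin 3} (hij : i ≠ j) {r : R}
    (hr : TwoSidedInvertible r) (h : OneAddMem N (B.s i * r * B.t j)) : B.elementary ≤ N := by
  obtain ⟨α, γ, hαγ⟩ := hr
  obtain ⟨k, hik, hkj⟩ : ∃ k, i ≠ k ∧ k ≠ j := by clear h; revert i j; decide
  have h1 : OneAddMem N (B.s k * α * r * B.t j) :=
    (OneAddMem.mul_left_of_normalizedBy hN (B.oneAddMem_elementary hik.symm α) h
      (by simp [mul_assoc, mul_reassoc (B.t_s_ne hij.symm)])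
      (by simp [mul_assoc, mul_reassoc (B.t_s_ne hkj.symm)])).congr
      (by simp [mul_assoc, mul_reassoc (B.t_s_self i)])
  have h2 : OneAddMem N (B.s k * B.t i) :=
    (h1.mul_right_of_normalizedBy hN (B.oneAddMem_elementary hij.symm γ)
      (by simp [mul_assoc, mul_reassoc (B.t_s_ne hij)])
      (by simp [mul_assoc, mul_reassoc (B.t_s_ne hik)])).congr (by
        simp only [mul_assoc, mul_reassoc (B.t_s_self j), one_mul]
        rw [← mul_assoc r, ← mul_assoc α, ← mul_assoc α, hαγ, one_mul])
  obtain ⟨π, h0, h1⟩ : ∃ π : Equiv.Perm (Fin 3), π k = 0 ∧ π i = 1 := by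
    clear hkj hij h h1 h2; revert i k; decide
  exact B.oneAddMem_of_zero_one hN (h2.conj_of_normalizedBy hN
    (B.perm_mem (fun i j hij r => B.oneAddMem_elementary hij r) π) (by
      rw [← mul_assoc, B.perm_s, mul_assoc, h0, ← h1, B.t_perm]))

theorem elementary_le_of_comp {κ : Type*} [Fintype κ] [DecidableEq κ] (I : Frame κ R) {i j : Fin 3}
    {k l : κ} (hij : i ≠ j) {r : R} (hr : TwoSidedInvertible r)
    (h : OneAddMem N ((B.comp I).s (i, k) * r * (B.comp I).t (j, l))) : B.elementary ≤ N := by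
  obtain ⟨α, γ, hαγ⟩ := hr
  refine B.elementary_le_of_twoSidedInvertible hN hij (r := I.s k * r * I.t l)
    ⟨α * I.t k, I.s l * γ, ?_⟩ (h.congr (by simp [comp, mul_assoc]))
  simp only [mul_assoc, mul_reassoc (I.t_s_self _), one_mul]
  rw [← mul_assoc, hαγ]

end Frame

end NormalizedBy

theorem one_add_pow_of_orthogonal {R : Type*} [Ring R] [CharP R 2] {a b c φ χ γ : R} {t T : R}
    (h1 : φ * a = t + 1) (h2 : φ * b = 0) (h3 : φ * c = 0) (h4 : χ * a = 0) (h5 : χ * b = t + 1)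
    (h6 : χ * c = 0) (h7 : γ * a = 0) (h8 : γ * b = 0) (h9 : γ * c = T + 1) (k : ℕ) :
    (1 + (a * φ + b * χ + c * γ)) ^ k =
      1 + (a * (∑ j ∈ Finset.range k, t ^ j) * φ + b * (∑ j ∈ Finset.range k, t ^ j) * χ
        + c * (∑ j ∈ Finset.range k, T ^ j) * γ) := by
  induction k with
  | zero => simp
  | succ k ih =>
    have hsum : ∀ u : R, ∑ j ∈ Finset.range (k + 1), u ^ j =
        1 + (∑ j ∈ Finset.range k, u ^ j) * u := fun u => by
      rw [Finset.sum_range_succ', Finset.sum_mul, pow_zero, add_comm]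
      simp only [pow_succ]
    rw [pow_succ, ih, hsum, hsum]
    simp only [mul_add, add_mul, mul_one, one_mul, mul_assoc, mul_reassoc h1, mul_reassoc h2,
      mul_reassoc h3, mul_reassoc h4, mul_reassoc h5, mul_reassoc h6, mul_reassoc h7,
      mul_reassoc h8, mul_reassoc h9, zero_mul, mul_zero, add_zero, zero_add]
    simp only [add_assoc, add_left_comm, add_comm, CharTwo.add_cancel_left,
      CharTwo.add_self_eq_zero, add_zero]

namespace Frame

variable {R : Type*} [Ring R] {m : ℕ}

theorem sum_diag_pow {ι : Type*} [Fintype ι] [DecidableEq ι] (E : Frame ι R) (t : Rˣ) {p : ℕ}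
    (h : ∑ j ∈ Finset.range p, (t : R) ^ j = 0) :
    ∑ j ∈ Finset.range p, (E.diag (fun _ => t) : R) ^ j = 0 := by
  refine E.ext_right fun i => ?_
  have hj : ∀ j : ℕ, (E.diag (fun _ => t) : R) ^ j * E.s i = E.s i * (t : R) ^ j := fun j => by
    rw [← Units.val_pow_eq_pow_val, ← map_pow, diag_s]; simp
  rw [Finset.sum_mul, Finset.sum_congr rfl fun j _ => hj j, ← Finset.mul_sum, h, mul_zero, zero_mul]

section Reflection

variable [CharP R 2] (C : Frame (Fin 3 × ZMod (m + 3)) R) (θ t : Rˣ) {N : ℕ}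
  (E : Frame (Fin N) R) (f : ℕ → R)
  (h0 : E.row 0 * ShiftFrame.weights E f = 1) {x : Rˣ}
  (hx : (x : R) = 1 + ((C.shiftFrame θ (by omega)).gramData t E f h0).off 0)

include hx

theorem val_pow_of_eq_off (k : ℕ) : ((x ^ k : Rˣ) : R) =
    1 + (C.s (0, 0) * (∑ j ∈ Finset.range k, (t : R) ^ j) * ((t + 1) * C.t (0, 0) + C.t (1, 1))
      + C.s (1, 0) * (∑ j ∈ Finset.range k, (t : R) ^ j) *
        ((t + 1) * C.t (1, 0) + C.t (0, -1) + t * C.t (0, 1)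
          + E.row 0 * E.diag (fun _ => t) * C.t (2, 1))
      + C.s (2, 0) * (∑ j ∈ Finset.range k, (E.diag (fun _ => t) : R) ^ j) *
        ((E.diag (fun _ => t) + 1) * C.t (2, 0) + E.shift * E.diag (fun _ => t) * C.t (2, 1)
          + ShiftFrame.weights E f * t * C.t (0, 1))) := by
  have h1 := ZMod.one_ne_zero_add_three (m := m)
  rw [ShiftFrame.off_zero, shiftFrame_row₁, shiftFrame_row₂, shiftFrame_row₃] at hx
  rw [Units.val_pow_eq_pow_val, hx]
  simp only [shiftFrame]
  refine one_add_pow_of_orthogonal ?_ ?_ ?_ ?_ ?_ ?_ ?_ ?_ ?_ k <;>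
    simp [add_mul, mul_assoc, C.t_s, h1]

theorem pow_eq_one_of_sum_eq_zero {p : ℕ} (h : ∑ j ∈ Finset.range p, (t : R) ^ j = 0) :
    x ^ p = 1 := by
  apply Units.ext
  rw [C.val_pow_of_eq_off θ t E f h0 hx, h, E.sum_diag_pow t h]
  simp

end Reflection

section Orders

variable [CharP R 2] (B : Frame (Fin 3) R) (I : Frame (ZMod (m + 3)) R) (θ t : Rˣ) {n : ℕ}
  {N : Subgroup Rˣ} (hN : NormalizedBy N B.elementary)

include hN

theorem elementary_le_of_pow_mem (E : Frame (Fin n) R) (f : ℕ → R)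
    (h0 : E.row 0 * ShiftFrame.weights E f = 1) {x : Rˣ}
    (hx : (x : R) = 1 + (((B.comp I).shiftFrame θ (by omega)).gramData t E f h0).off 0)
    {k : ℕ} (hk : TwoSidedInvertible (∑ j ∈ Finset.range k, (t : R) ^ j)) (hkN : x ^ k ∈ N) :
    B.elementary ≤ N := by
  have hH := B.oneAddMem_elementary_comp I (by simp)
  set C := B.comp I with hC
  have h1 := ZMod.one_ne_zero_add_three (m := m)
  have h2 : (2 : ZMod (m + 3)) ≠ 0 := fun h => by
    have : ((2 : ℕ) : ZMod (m + 3)) = 0 := by exact_mod_cast h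
    exact Nat.not_dvd_of_pos_of_lt (by omega) (by omega) ((ZMod.natCast_eq_zero_iff _ _).1 this)
  have h21 : (2 : ZMod (m + 3)) ≠ 1 := fun h => h1 (by
    rw [← sub_eq_zero] at h; rw [← h]; ring)
  have hX := C.val_pow_of_eq_off θ t E f h0 hx k
  set σ := ∑ j ∈ Finset.range k, (t : R) ^ j with hσ
  set X := x ^ k with hXdef
  set φ := (t + 1) * C.t (0, 0) + C.t (1, 1) with hφ
  have hXs : (X : R) * C.s (1, 2) = C.s (1, 2) := by
    rw [hX]
    simp [hφ, add_mul, mul_assoc, C.t_s, Ne.symm h2, Ne.symm h21]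
  have hXt : C.t (0, 0) * (X : R) = C.t (0, 0) + σ * φ := by
    rw [hX]
    simp only [mul_add, mul_assoc, mul_one, ← mul_assoc (C.t (0, 0)), C.t_s_self,
      C.t_s_ne (show ((0, 0) : Fin 3 × ZMod (m + 3)) ≠ (1, 0) by simp),
      C.t_s_ne (show ((0, 0) : Fin 3 × ZMod (m + 3)) ≠ (2, 0) by simp), zero_mul, one_mul,
      add_zero]
  have hφs : φ * C.s (1, 2) = 0 := by simp [hφ, add_mul, mul_assoc, C.t_s, Ne.symm h21]
  have step1 : OneAddMem N (C.s (1, 2) * σ * φ) := by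
    obtain ⟨w, hw, hw'⟩ := hH (1, 2) (0, 0) (by simp) 1
    rw [mul_one] at hw'
    refine ⟨X⁻¹ * (w * X * w⁻¹), N.mul_mem (N.inv_mem hkN) (hN w hw X hkN), ?_⟩
    rw [Units.val_mul, Units.inv_mul_eq_iff_eq_mul, Units.val_mul, Units.mul_inv_eq_iff_eq_mul,
      Units.val_mul, hw']
    simp only [mul_add, add_mul, mul_one, one_mul, mul_assoc, hXt, mul_reassoc hXs,
      mul_reassoc hφs, zero_mul, mul_zero, add_zero]
    abel
  have step2 : OneAddMem N (C.s (1, 2) * σ * C.t (2, 0)) :=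
    (step1.mul_right_of_normalizedBy hN (hH (1, 1) (2, 0) (by simp) 1)
      (by simp [mul_assoc, mul_reassoc (C.t_s_ne (show ((2, 0) : Fin 3 × ZMod (m + 3)) ≠ (1,
          1) by simp))])
      (by simp [mul_assoc, mul_reassoc (C.t_s_ne (show ((2, 0) : Fin 3 × ZMod (m + 3)) ≠ (1,
          2) by simp))])).congr
      (by
        have : φ * C.s (1, 1) = 1 := by simp [hφ, add_mul, mul_assoc, C.t_s]
        simp only [mul_one, mul_assoc, mul_reassoc this, one_mul])
  exact B.elementary_le_of_comp hN I (by decide) hk step2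

theorem elementary_le_of_cycle_pow_mem {k : ℕ} (hk : ¬ m + 3 ∣ k)
    (hkN : (B.comp I).cycle θ ^ k ∈ N) : B.elementary ≤ N := by
  have hH := B.oneAddMem_elementary_comp I (by simp)
  set C := B.comp I with hC
  set Y := C.cycle θ ^ k with hY
  have hk0 : (k : ZMod (m + 3)) ≠ 0 := fun h => hk ((ZMod.natCast_eq_zero_iff _ _).1 h)
  have hYs : (Y : R) * C.s (0, 0) = C.s (0, k) := by
    have := C.cycle_zpow_s θ (l := 0) (by decide) 0 (k : ℤ)
    rwa [zpow_natCast, zero_add, Int.cast_natCast, ← hY] at this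
  have hYt : C.t (1, (k : ZMod (m + 3))) * (Y : R) = C.t (1, 0) := by
    have := C.t_cycle_zpow θ (l := 1) (by decide) 0 (k : ℤ)
    rwa [zpow_natCast, zero_add, Int.cast_natCast, ← hY] at this
  have step1 : OneAddMem N (C.s (0, k) * C.t (1, k) + C.s (0, 0) * C.t (1, 0)) := by
    obtain ⟨w, hw, hw'⟩ := hH (0, 0) (1, 0) (by simp) 1
    rw [mul_one] at hw'
    refine ⟨Y * (w * Y⁻¹ * w⁻¹), N.mul_mem hkN (hN w hw _ (N.inv_mem hkN)), ?_⟩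
    have : (Y : R) * w = (1 + (C.s (0, k) * C.t (1, k) + C.s (0, 0) * C.t (1, 0))) * (w * Y) := by
      simp only [hw', mul_add, add_mul, mul_one, one_mul, mul_assoc, hYt, mul_reassoc hYs,
        mul_reassoc (C.t_s_ne (show ((1, (k : ZMod (m + 3))) : Fin 3 × ZMod (m + 3)) ≠ (0,
            0) by simp)),
        mul_reassoc (C.t_s_ne (show ((1, 0) : Fin 3 × ZMod (m + 3)) ≠ (0, 0) by simp)),
        zero_mul, mul_zero, add_zero]
      simp only [add_assoc, add_left_comm, add_comm, CharTwo.add_cancel_left,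
        CharTwo.add_self_eq_zero, add_zero, zero_add]
    rw [← val_commutatorElement_eq this, commutatorElement_def]
    simp only [mul_assoc]
  have step2 : OneAddMem N (C.s (0, 0) * 1 * C.t (2, 0)) :=
    (step1.mul_right_of_normalizedBy hN (hH (1, 0) (2, 0) (by simp) 1)
      (by simp [mul_assoc, mul_reassoc (C.t_s_ne (show ((2, 0) : Fin 3 × ZMod (m + 3)) ≠ (1,
          0) by simp))])
      (by
        simp [mul_add, mul_assoc,
          mul_reassoc (C.t_s_ne (show ((2, 0) : Fin 3 × ZMod (m + 3)) ≠ (0,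
              (k : ZMod (m + 3))) by simp)),
          mul_reassoc (C.t_s_ne (show ((2, 0) : Fin 3 × ZMod (m + 3)) ≠ (0, 0) by simp))])).congr
      (by
        simp only [mul_one, add_mul, mul_assoc, mul_reassoc (C.t_s_self (1, 0)), one_mul,
          mul_reassoc (C.t_s_ne (show ((1, (k : ZMod (m + 3))) : Fin 3 × ZMod (m + 3)) ≠ (1, 0) by
            simpa using hk0)), zero_mul, mul_zero, zero_add])
  exact B.elementary_le_of_comp hN I (by decide) ⟨1, 1, by simp⟩ step2

theorem elementary_le_of_cycle_pow_mul_mem {l : ℕ}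
    (hl : TwoSidedInvertible (((θ ^ l : Rˣ) : R) + 1))
    (hlN : (B.comp I).cycle θ ^ ((m + 3) * l) ∈ N) : B.elementary ≤ N := by
  have hH := B.oneAddMem_elementary_comp I (by simp)
  have hYs := (B.comp I).cycle_pow_mul_s_two θ l
  set C := B.comp I with hC
  set Y := C.cycle θ ^ ((m + 3) * l) with hY
  have hYt : C.t (0, 0) * (Y : R) = C.t (0, 0) := by
    have := C.t_cycle_zpow θ (l := 0) (by decide) 0 (((m + 3) * l : ℕ) : ℤ)
    have hz : ((((m + 3) * l : ℕ) : ℤ) : ZMod (m + 3)) = 0 := by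
      rw [Int.cast_natCast, Nat.cast_mul, ZMod.natCast_self, zero_mul]
    rwa [hz, add_zero, zpow_natCast] at this
  refine B.elementary_le_of_comp hN I (i := 2) (j := 0) (k := 0) (l := 0) (by decide) hl ?_
  obtain ⟨w, hw, hw'⟩ := hH (2, 0) (0, 0) (by simp) 1
  rw [mul_one] at hw'
  refine ⟨Y * (w * Y⁻¹ * w⁻¹), N.mul_mem hlN (hN w hw _ (N.inv_mem hlN)), ?_⟩
  have : (Y : R) * w =
      (1 + C.s (2, 0) * (((θ ^ l : Rˣ) : R) + 1) * C.t (0, 0)) * (w * Y) := by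
    simp only [hw', mul_add, add_mul, mul_one, one_mul, mul_assoc, hYt, mul_reassoc hYs,
      mul_reassoc (C.t_s_ne (show ((0, 0) : Fin 3 × ZMod (m + 3)) ≠ (2, 0) by simp)),
      zero_mul, mul_zero, add_zero]
    simp only [add_assoc, add_left_comm, add_comm, CharTwo.add_cancel_left,
      CharTwo.add_self_eq_zero, add_zero]
  rw [← val_commutatorElement_eq this, commutatorElement_def]
  simp only [mul_assoc]

end Orders

end Frame

theorem orderOf_eq_of_pow_eq_one_iff {G : Type*} [Monoid G] {x : G} {p : ℕ}
    (h : ∀ k, x ^ k = 1 ↔ p ∣ k) : orderOf x = p :=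
  Nat.dvd_antisymm (orderOf_dvd_of_pow_eq_one ((h p).2 dvd_rfl))
    ((h _).1 (pow_orderOf_eq_one x))

section Quotient

variable {G : Type*} [Group G] {H : Subgroup G} (N : Subgroup H)

theorem normalizedBy_map_subtype [N.Normal] : NormalizedBy (N.map H.subtype) H := by
  rintro h hh _ ⟨n, hn, rfl⟩
  exact ⟨⟨h, hh⟩ * n * ⟨h, hh⟩⁻¹, Subgroup.Normal.conj_mem inferInstance n hn _, rfl⟩

theorem not_le_map_subtype (hN : N ≠ ⊤) : ¬ H ≤ N.map H.subtype := fun h =>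
  hN (by
    rw [eq_top_iff]
    rintro ⟨x, hx⟩ -
    obtain ⟨n, hn, rfl⟩ := h hx
    exact hn)

theorem orderOf_mk_eq_of_pow_mem_iff [N.Normal] {x : H} {p : ℕ}
    (h : ∀ k, (x : G) ^ k ∈ N.map H.subtype ↔ p ∣ k) : orderOf (x : H ⧸ N) = p :=
  orderOf_eq_of_pow_eq_one_iff fun k => by
    rw [← h, ← QuotientGroup.mk_pow, QuotientGroup.eq_one_iff]
    refine ⟨fun hk => ⟨x ^ k, hk, rfl⟩, ?_⟩
    rintro ⟨n, hn, hk⟩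
    rwa [show x ^ k = n from Subtype.ext hk.symm]

theorem closure_mk_eq_top_of_le_closure [N.Normal] {x y : H}
    (h : H ≤ Subgroup.closure {(x : G), (y : G)}) :
    Subgroup.closure {(x : H ⧸ N), (y : H ⧸ N)} = ⊤ := by
  have h1 : Subgroup.closure {x, y} = ⊤ := by
    apply Subgroup.map_injective H.subtype_injective
    rw [MonoidHom.map_closure, Set.image_pair, ← MonoidHom.range_eq_map, Subgroup.range_subtype]
    exact le_antisymm ((Subgroup.closure_le _).2 (by
      rintro _ (rfl | rfl)
      exacts [x.2, y.2])) h
  have := congrArg (Subgroup.map (QuotientGroup.mk' N)) h1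
  rwa [MonoidHom.map_closure, Set.image_pair, ← MonoidHom.range_eq_map,
    MonoidHom.range_eq_top.2 (QuotientGroup.mk'_surjective N)] at this

end Quotient

/-- A unit of order `p` whose partial geometric sums are as invertible as possible. -/
structure IsStronglyOfOrder {R : Type*} [Ring R] (t : Rˣ) (p : ℕ) : Prop where
  mem_commutator : t ∈ commutator Rˣ
  sum_eq_zero : ∑ j ∈ Finset.range p, (t : R) ^ j = 0
  twoSidedInvertible : ∀ k, ¬ p ∣ k → TwoSidedInvertible (∑ j ∈ Finset.range k, (t : R) ^ j)

namespace Frame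

variable {R : Type*} [Ring R] [CharP R 2] (B : Frame (Fin 3) R) (N : Subgroup B.elementary)
  [N.Normal]

theorem exists_generators (hN : N ≠ ⊤) (hR : ∀ n, Nonempty (Frame (Fin (n + 1)) R)) {g : ℕ → R}
    {d m : ℕ} (hg : g 0 = 1) (hclosure : Subring.closure (g '' {n | n < d}) = ⊤) {t θ : Rˣ}
    (hm : 1 ≤ m ∨ t = 1) {p o : ℕ} (ht : IsStronglyOfOrder t p) (hθ : θ ∈ commutator Rˣ)
    (hθo : (θ = 1 ∧ o = m + 3) ∨
      ((∀ l : ℕ, l ≠ 0 → TwoSidedInvertible (((θ ^ l : Rˣ) : R) + 1)) ∧ o = 0)) :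
    ∃ x y : B.elementary ⧸ N, orderOf x = p ∧ orderOf y = o ∧ Subgroup.closure {x, y} = ⊤ := by
  have hle := not_le_map_subtype N hN
  have hnb := normalizedBy_map_subtype N
  set L := (m + 3) * (d + 1) with hLdef
  have hLpos : 0 < L := by positivity
  have hdL : d ≤ L := by nlinarith
  have hcl : Subring.closure (g '' {n | n < L}) = ⊤ := by
    rw [eq_top_iff, ← hclosure]
    exact Subring.closure_mono (Set.image_mono fun n (hn : n < d) => hn.trans_le hdL)
  obtain ⟨E⟩ := hR (2 * L + m + 3)
  obtain ⟨I⟩ : Nonempty (Frame (ZMod (m + 3)) R) := hR (m + 2)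
  have hK := B.oneAddMem_elementary_comp I (by simp)
  have hsp := ((B.comp I).shiftFrame θ (by omega)).spanning (t := t) (g := g) E
    (by rw [hLdef]; push_cast; exact Dvd.intro _ rfl) hLpos hg hcl hm
  obtain ⟨x, hxB, hx⟩ := (B.comp I).exists_mem_eq_off θ t E
    (ShiftFrame.coeffs t g L m) hK ht.mem_commutator (ShiftFrame.row_zero_weights E hLpos hg)
  have hyB := (B.comp I).cycle_mem θ hK hθ
  refine ⟨((⟨x, hxB⟩ : B.elementary) : B.elementary ⧸ N),
    ((⟨(B.comp I).cycle θ, hyB⟩ : B.elementary) : B.elementary ⧸ N),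
    orderOf_mk_eq_of_pow_mem_iff N fun k => ⟨fun hk => ?_, ?_⟩,
    orderOf_mk_eq_of_pow_mem_iff N fun k => ⟨fun hk => ?_, fun hk => ?_⟩,
    closure_mk_eq_top_of_le_closure N
      (B.elementary_le_closure I θ t E (ShiftFrame.coeffs t g L m) _ hsp hx)⟩
  · by_contra hpk
    exact hle (B.elementary_le_of_pow_mem I θ t hnb E _ _ hx (ht.twoSidedInvertible k hpk) hk)
  · rintro ⟨k, rfl⟩
    have := (B.comp I).pow_eq_one_of_sum_eq_zero θ t E _ _ hx ht.sum_eq_zero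
    rw [pow_mul, this, one_pow]
    exact Subgroup.one_mem _
  · have h3 : m + 3 ∣ k := by
      by_contra h3
      exact hle (B.elementary_le_of_cycle_pow_mem I θ hnb h3 hk)
    rcases hθo with ⟨-, rfl⟩ | ⟨hl, rfl⟩
    · exact h3
    · obtain ⟨l, rfl⟩ := h3
      rcases eq_or_ne l 0 with rfl | hl0
      · simp
      · exact absurd (B.elementary_le_of_cycle_pow_mul_mem I θ hnb (hl l hl0) hk) hle
  · rcases hθo with ⟨rfl, rfl⟩ | ⟨hl, rfl⟩
    · obtain ⟨k, rfl⟩ := hk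
      simp only [pow_mul, cycle_one_pow_card, one_pow]
      exact Subgroup.one_mem _
    · rw [zero_dvd_iff.1 hk, pow_zero]
      exact Subgroup.one_mem _

/-- Every group of units lying strongly in the derived subgroup embeds into the quotient. -/
theorem exists_injective (hN : N ≠ ⊤) {Γ : Type*} [Group Γ] (ρ : Γ →* Rˣ)
    (hρ : ∀ g, ρ g ∈ commutator Rˣ)
    (hρ1 : ∀ g, g ≠ 1 → TwoSidedInvertible ((ρ g : R) + 1)) :
    ∃ φ : Γ →* B.elementary ⧸ N, Function.Injective φ := by
  have hle := not_le_map_subtype N hN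
  have hnb := normalizedBy_map_subtype N
  have hK : ∀ i j, i ≠ j → ∀ r, OneAddMem B.elementary (B.s i * r * B.t j) :=
    fun i j h r => B.oneAddMem_elementary h r
  let ψ : Γ →* B.elementary :=
    ((B.diag.comp (MonoidHom.mulSingle (fun _ : Fin 3 => Rˣ) 0)).comp ρ).codRestrict B.elementary
      fun g => B.diag_mulSingle_mem hK (by simp) 0 (hρ g)
  refine ⟨(QuotientGroup.mk' N).comp ψ, (injective_iff_map_eq_one _).2 fun g hg => ?_⟩
  by_contra hg1
  have hgN : B.diag (Pi.mulSingle 0 (ρ g)) ∈ N.map B.elementary.subtype :=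
    ⟨ψ g, (QuotientGroup.eq_one_iff _).1 hg, rfl⟩
  refine hle (B.elementary_le_of_twoSidedInvertible hnb (i := 0) (j := 1) (by decide) (hρ1 g hg1) ?_)
  obtain ⟨w, hw, hw'⟩ := hK 0 1 (by decide) 1
  have h2 : (B.diag (Pi.mulSingle 0 (ρ g)) : R) = 1 + B.s 0 * ((ρ g : R) + 1) * B.t 0 := by
    rw [val_diag_mulSingle, CharTwo.sub_eq_add]
  set X := B.diag (Pi.mulSingle 0 (ρ g)) with hX
  refine ⟨X * (w * X⁻¹ * w⁻¹), Subgroup.mul_mem _ hgN (hnb w hw _ (Subgroup.inv_mem _ hgN)), ?_⟩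
  have : (X : R) * w = (1 + B.s 0 * ((ρ g : R) + 1) * B.t 1) * (w * X) := by
    rw [mul_one] at hw'
    simp only [hw', h2, mul_add, add_mul, mul_one, one_mul, mul_assoc, B.t_s_self,
      mul_reassoc (B.t_s_self 0), mul_reassoc (B.t_s_ne (show (1 : Fin 3) ≠ 0 by decide)),
      zero_mul, mul_zero, add_zero]
    simp only [add_assoc, add_left_comm, add_comm, CharTwo.add_cancel_left,
      CharTwo.add_self_eq_zero, add_zero, zero_add]
  rw [← val_commutatorElement_eq this, commutatorElement_def]
  simp only [mul_assoc]

theorem exists_isSimpleGroup_elementary_quotient [Nontrivial R] :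
    ∃ (N : Subgroup B.elementary) (_ : N.Normal), N ≠ ⊤ ∧ IsSimpleGroup (B.elementary ⧸ N) := by
  obtain ⟨z, hz, hz'⟩ := B.oneAddMem_elementary (show (0 : Fin 3) ≠ 1 by decide) 1
  have hz1 : (⟨z, hz⟩ : B.elementary) ≠ 1 := fun h => by
    have h1 : z = 1 := congrArg Subtype.val h
    rw [h1, Units.val_one, left_eq_add, mul_one] at hz'
    have : B.t 0 * (B.s 0 * B.t 1) * B.s 1 = 1 := by
      rw [← mul_assoc, B.t_s_self, one_mul, B.t_s_self]
    rw [hz', mul_zero, zero_mul] at this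
    exact zero_ne_one this
  obtain ⟨N, hN, hzN, hs⟩ := exists_isSimpleGroup_quotient hz1 fun N hN hzN => by
    by_contra htop
    refine not_le_map_subtype N htop (B.oneAddMem_of_zero_one (normalizedBy_map_subtype N)
      ⟨z, ⟨_, hzN, rfl⟩, ?_⟩)
    rw [hz', mul_one]
  exact ⟨N, hN, fun h => hzN (h ▸ Subgroup.mem_top _), hs⟩

end Frame

theorem closure_conj_eq_top_of_isSimpleGroup {S : Type*} [Group S] [IsSimpleGroup S] {x y : S}
    (hx : x * x = 1) (hy : y ≠ 1) (h : Subgroup.closure {x, y} = ⊤) :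
    Subgroup.closure {y, x * y * x⁻¹} = ⊤ := by
  set K := Subgroup.closure {y, x * y * x⁻¹} with hK
  have hyK : y ∈ K := Subgroup.subset_closure (by simp)
  have hle : K ≤ K.comap (MulAut.conj x).toMonoidHom := by
    rw [hK, Subgroup.closure_le]
    rintro _ (rfl | rfl)
    · exact Subgroup.subset_closure (by simp)
    · have : x * (x * y * x⁻¹) * x⁻¹ = y := by
        rw [show x * (x * y * x⁻¹) * x⁻¹ = x * x * y * (x * x)⁻¹ by group, hx]; simp
      simpa [this] using hyK
  have hfwd : ∀ k ∈ K, x * k * x⁻¹ ∈ K := fun k hk => by simpa using hle hk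
  have hxn : x ∈ Subgroup.normalizer (K : Set S) := Subgroup.mem_normalizer_iff.2 fun k =>
    ⟨hfwd k, fun hk => by
      have := hfwd _ hk
      rwa [show x * (x * k * x⁻¹) * x⁻¹ = x * x * k * (x * x)⁻¹ by group, hx, one_mul, inv_one,
        mul_one] at this⟩
  have hn : K.Normal := by
    rw [← Subgroup.normalizer_eq_top_iff, eq_top_iff, ← h, Subgroup.closure_le]
    rintro _ (rfl | rfl)
    exacts [hxn, Subgroup.le_normalizer hyK]
  refine (hn.eq_bot_or_eq_top).resolve_left fun hb => hy ?_
  rw [hb] at hyK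
  simpa using hyK

theorem isStronglyOfOrder_one_two {R : Type*} [Ring R] [CharP R 2] :
    IsStronglyOfOrder (1 : Rˣ) 2 where
  mem_commutator := Subgroup.one_mem _
  sum_eq_zero := by simp [show (2 : R) = 0 from CharTwo.two_eq_zero]
  twoSidedInvertible k hk := ⟨1, 1, by
    obtain ⟨l, rfl⟩ := Nat.odd_iff.2 (Nat.two_dvd_ne_zero.1 hk)
    simp [show (2 : R) = 0 from CharTwo.two_eq_zero]⟩

theorem exists_isSimpleGroup_of_ring {R : Type} [Ring R] [CharP R 2] [Nontrivial R]
    (hR : ∀ n, Nonempty (Frame (Fin (n + 1)) R)) {g : ℕ → R} {d : ℕ} (hg : g 0 = 1)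
    (hclosure : Subring.closure (g '' {n | n < d}) = ⊤)
    (ht : ∀ p : ℕ, p ≠ 1 → ∃ t : Rˣ, IsStronglyOfOrder t p) {θ : Rˣ}
    (hθ : θ ∈ commutator Rˣ)
    (hθ' : ∀ l : ℕ, l ≠ 0 → TwoSidedInvertible (((θ ^ l : Rˣ) : R) + 1))
    {Γ : Type*} [Group Γ] (ρ : Γ →* Rˣ) (hρ : ∀ γ, ρ γ ∈ commutator Rˣ)
    (hρ1 : ∀ γ, γ ≠ 1 → TwoSidedInvertible ((ρ γ : R) + 1)) :
    ∃ (S : Type) (_ : Group S), IsSimpleGroup S ∧ (∃ φ : Γ →* S, Function.Injective φ) ∧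
      ∀ p q : ℕ, (p = 0 ∨ 2 ≤ p) → (q = 0 ∨ 3 ≤ q) →
        ∃ x y : S, orderOf x = p ∧ orderOf y = q ∧ Subgroup.closure {x, y} = ⊤ := by
  obtain ⟨B⟩ := hR 2
  obtain ⟨N, hNn, hN, hs⟩ := B.exists_isSimpleGroup_elementary_quotient
  have hgen : ∀ {p o : ℕ}, p ≠ 1 → (o = 0 ∨ 4 ≤ o) → ∃ x y : B.elementary ⧸ N,
      orderOf x = p ∧ orderOf y = o ∧ Subgroup.closure {x, y} = ⊤ := fun {p o} hp ho => by
    obtain ⟨t, ht⟩ := ht p hp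
    rcases ho with rfl | ho
    · exact B.exists_generators N hN hR (m := 1) hg hclosure (Or.inl le_rfl) ht hθ
        (Or.inr ⟨hθ', rfl⟩)
    · exact B.exists_generators N hN hR (m := o - 3) hg hclosure (Or.inl (by omega)) ht
        (Subgroup.one_mem _) (Or.inl ⟨rfl, by omega⟩)
  obtain ⟨x₂, y₃, hx₂, hy₃, h₂₃⟩ := B.exists_generators N hN hR (m := 0) hg hclosure (Or.inr rfl)
    isStronglyOfOrder_one_two (Subgroup.one_mem _) (Or.inl ⟨rfl, rfl⟩)
  refine ⟨B.elementary ⧸ N, inferInstance, hs, B.exists_injective N hN ρ hρ hρ1,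
      fun p q hp hq => ?_⟩
  by_cases hq3 : q = 3
  · subst hq3
    by_cases hp4 : p = 0 ∨ 4 ≤ p
    · obtain ⟨x, y, hx, hy, h⟩ := hgen (p := 3) (by omega) hp4
      exact ⟨y, x, hy, hx, by rw [Set.pair_comm, h]⟩
    · obtain rfl | rfl : p = 2 ∨ p = 3 := by omega
      · exact ⟨x₂, y₃, hx₂, hy₃, h₂₃⟩
      · refine ⟨y₃, x₂ * y₃ * x₂⁻¹, hy₃, ?_, closure_conj_eq_top_of_isSimpleGroup ?_ ?_ h₂₃⟩
        · exact (MulEquiv.orderOf_eq (MulAut.conj x₂) y₃).trans hy₃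
        · have := pow_orderOf_eq_one x₂
          rwa [hx₂, sq] at this
        · rintro rfl
          simp at hy₃
  · exact hgen (by omega) (by omega)

/-- The permutation of `ℤ × G` acting by left multiplication by `g` on the levels in `s`. -/
def levelPerm {G : Type*} [Group G] (s : Set ℤ) [DecidablePred (· ∈ s)] :
    G →* Equiv.Perm (ℤ × G) where
  toFun g :=
    { toFun := fun x => (x.1, if x.1 ∈ s then g * x.2 else x.2)
      invFun := fun x => (x.1, if x.1 ∈ s then g⁻¹ * x.2 else x.2)
      left_inv := fun x => by ext <;> by_cases h : x.1 ∈ s <;> simp [h]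
      right_inv := fun x => by ext <;> by_cases h : x.1 ∈ s <;> simp [h] }
  map_one' := by ext x <;> simp
  map_mul' g h := by
    ext x
    · simp
    · by_cases hx : x.1 ∈ s <;> simp [hx, mul_assoc]

theorem levelPerm_apply {G : Type*} [Group G] (s : Set ℤ) [DecidablePred (· ∈ s)] (g : G)
    (x : ℤ × G) : levelPerm s g x = (x.1, if x.1 ∈ s then g * x.2 else x.2) := rfl

/-- The permutation of `ℤ × G` raising the level by one. -/
def levelShift (G : Type*) : Equiv.Perm (ℤ × G) := (Equiv.addRight (1 : ℤ)).prodCongr (Equiv.refl G)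

theorem levelShift_apply {G : Type*} (x : ℤ × G) : levelShift G x = (x.1 + 1, x.2) := rfl

theorem levelShift_pow_apply {G : Type*} (k : ℕ) (x : ℤ × G) :
    (levelShift G ^ k) x = (x.1 + k, x.2) := by
  induction k with
  | zero => simp
  | succ k ih =>
    rw [pow_succ', Equiv.Perm.mul_apply, ih, levelShift_apply]
    simp [add_assoc]

theorem levelPerm_singleton_eq_commutatorElement {G : Type*} [Group G] (g : G) :
    levelPerm {0} g = ⁅levelPerm (Set.Ici 0) g, levelShift G⁆ := by
  rw [eq_comm, commutatorElement_def, mul_inv_eq_iff_eq_mul, mul_inv_eq_iff_eq_mul]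
  ext x
  · simp [levelPerm_apply, levelShift_apply]
  · simp only [Equiv.Perm.mul_apply, levelPerm_apply, levelShift_apply, Set.mem_Ici,
      Set.mem_singleton_iff]
    split_ifs <;> first | rfl | omega

theorem exists_countable_embedding (G : Type*) [Group G] [Countable G] :
    ∃ (Γ : Subgroup (Equiv.Perm (ℤ × G))), Countable Γ ∧
      (∃ φ : G →* Γ, Function.Injective φ ∧ ∀ g, φ g ∈ commutator Γ) ∧
      ∃ σ : Γ, ∀ k : ℕ, k ≠ 0 → σ ^ k ≠ 1 := by
  let f : FreeGroup (Option G) →* Equiv.Perm (ℤ × G) :=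
    FreeGroup.lift fun o => o.elim (levelShift G) fun g => levelPerm (Set.Ici 0) g
  have hc : Countable (FreeGroup (Option G)) := by
    unfold FreeGroup; infer_instance
  have hΓ : Countable f.range := f.rangeRestrict_surjective.countable
  let σ : f.range := ⟨levelShift G, FreeGroup.of none, by simp [f]⟩
  let P : G → f.range := fun g => ⟨levelPerm (Set.Ici 0) g, FreeGroup.of (some g), by simp [f]⟩
  have hcomm : ∀ g, levelPerm {0} g = ((⁅P g, σ⁆ : f.range) : Equiv.Perm (ℤ × G)) :=
    levelPerm_singleton_eq_commutatorElement
  let φ : G →* f.range := (levelPerm {0}).codRestrict f.range fun g => by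
    rw [hcomm]; exact Subtype.property _
  refine ⟨f.range, hΓ, ⟨φ, (injective_iff_map_eq_one _).2 fun g hg => ?_, fun g => ?_⟩, σ,
    fun k hk h => ?_⟩
  · have := congrArg (fun w : f.range => ((w : Equiv.Perm (ℤ × G)) (0, 1)).2) hg
    simpa [φ, levelPerm_apply] using this
  · rw [show φ g = ⁅P g, σ⁆ from Subtype.ext (hcomm g)]
    exact Subgroup.commutator_mem_commutator (Subgroup.mem_top _) (Subgroup.mem_top _)
  · have := congrArg (fun w : f.range => ((w : Equiv.Perm (ℤ × G)) (0, 1)).1) h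
    simp [σ, levelShift_pow_apply] at this
    exact hk this

/-- The space of all binary sequences. -/
abbrev BinSeq : Type := ℕ → ZMod 2

theorem nonempty_binSeq_linearEquiv (β : Type*) [Countable β] [Nonempty β] :
    Nonempty (BinSeq ≃ₗ[ZMod 2] (β → BinSeq)) := by
  obtain ⟨e⟩ : Nonempty (β × ℕ ≃ ℕ) := nonempty_equiv_of_countable
  exact ⟨(LinearEquiv.funCongrLeft (ZMod 2) (ZMod 2) e).trans
    (LinearEquiv.curry (ZMod 2) (ZMod 2) β ℕ)⟩

theorem nonempty_frame_end_binSeq (n : ℕ) :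
    Nonempty (Frame (Fin (n + 1)) (Module.End (ZMod 2) BinSeq)) := by
  obtain ⟨e⟩ := nonempty_binSeq_linearEquiv (Fin (n + 1))
  refine ⟨⟨fun i => e.symm.toLinearMap ∘ₗ LinearMap.single (ZMod 2) (fun _ => BinSeq) i,
    fun i => LinearMap.proj i ∘ₗ e.toLinearMap, fun i j => ?_, ?_⟩⟩
  · refine LinearMap.ext fun v => ?_
    by_cases h : i = j
    · subst h; simp
    · simp [h]
  · refine LinearMap.ext fun v => ?_
    simp only [LinearMap.sum_apply, Module.End.mul_apply, LinearMap.comp_apply,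
      LinearEquiv.coe_coe, Module.End.one_apply, LinearMap.proj_apply, LinearMap.single_apply]
    rw [← map_sum, Finset.univ_sum_single, LinearEquiv.symm_apply_apply]

theorem exists_regular_end_binSeq (Γ : Type*) [Group Γ] [Countable Γ] [DecidableEq Γ] :
    ∃ (ρ : Γ →* Module.End (ZMod 2) BinSeq) (α γ : Module.End (ZMod 2) BinSeq),
      ∀ g, α * ρ g * γ = if g = 1 then 1 else 0 := by
  obtain ⟨e⟩ := nonempty_binSeq_linearEquiv Γ
  let τ : Γ → ((Γ → BinSeq) →ₗ[ZMod 2] (Γ → BinSeq)) := fun g =>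
    LinearMap.funLeft (ZMod 2) BinSeq fun h => g⁻¹ * h
  have hτ : ∀ g w h, τ g w h = w (g⁻¹ * h) := fun g w h => rfl
  refine ⟨{ toFun := fun g => e.symm.toLinearMap ∘ₗ τ g ∘ₗ e.toLinearMap
            map_one' := ?_
            map_mul' := fun g h => ?_ }, LinearMap.proj 1 ∘ₗ e.toLinearMap,
    e.symm.toLinearMap ∘ₗ LinearMap.single (ZMod 2) (fun _ => BinSeq) 1, fun g => ?_⟩
  · refine LinearMap.ext fun v => e.injective (funext fun k => ?_)
    simp [hτ]
  · refine LinearMap.ext fun v => e.injective (funext fun k => ?_)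
    simp [hτ, mul_assoc]
  · refine LinearMap.ext fun v => ?_
    by_cases h : g = 1
    · subst h; simp [hτ]
    · simp [hτ, h, Pi.single_apply]

theorem two_eq_zero_end_binSeq : (2 : Module.End (ZMod 2) BinSeq) = 0 :=
  one_add_one_eq_two.symm.trans (LinearMap.ext fun v => funext fun k => by
    rw [LinearMap.add_apply, Pi.add_apply, CharTwo.add_self_eq_zero]; rfl)

/-- Countably many endomorphisms are contained in a ring with three generators. -/
theorem exists_forall_eq_mul_pow_mul (f : ℕ → Module.End (ZMod 2) BinSeq) :
    ∃ a s b : Module.End (ZMod 2) BinSeq, ∀ n, f n = a * s ^ n * b := by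
  obtain ⟨e⟩ := nonempty_binSeq_linearEquiv ℕ
  let s : Module.End (ZMod 2) BinSeq :=
    e.symm.toLinearMap ∘ₗ LinearMap.funLeft (ZMod 2) BinSeq Nat.succ ∘ₗ e.toLinearMap
  have hs : ∀ n v k, e ((s ^ n) v) k = e v (k + n) := fun n v => by
    induction n with
    | zero => simp
    | succ n ih =>
      intro k
      have : ∀ w, e (s w) k = e w (k + 1) := fun w => by
        simp [s, LinearMap.funLeft_apply]
      rw [pow_succ', Module.End.mul_apply, this, ih]
      rw [add_assoc, add_comm 1]
  refine ⟨LinearMap.proj 0 ∘ₗ e.toLinearMap, s, e.symm.toLinearMap ∘ₗ LinearMap.pi f, fun n => ?_⟩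
  refine LinearMap.ext fun v => ?_
  simp [hs]

theorem exists_finitelyGenerated_ring (Γ : Type*) [Group Γ] [Countable Γ] [DecidableEq Γ] :
    ∃ (R : Type) (_ : Ring R) (_ : CharP R 2) (_ : Nontrivial R),
      (∀ n, Nonempty (Frame (Fin (n + 1)) R)) ∧
      (∃ (g : ℕ → R) (d : ℕ), g 0 = 1 ∧ Subring.closure (g '' {n | n < d}) = ⊤) ∧
      ∃ (ρ : Γ →* R) (α γ : R), ∀ g, α * ρ g * γ = if g = 1 then 1 else 0 := by
  have E := fun n => (nonempty_frame_end_binSeq n).some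
  obtain ⟨ρ, α, γ, hρ⟩ := exists_regular_end_binSeq Γ
  set Z : Set (Module.End (ZMod 2) BinSeq) := {α, γ} ∪ Set.range ρ ∪
    (Set.range fun x : Σ n, Fin (n + 1) => (E x.1).s x.2) ∪
    Set.range fun x : Σ n, Fin (n + 1) => (E x.1).t x.2 with hZ
  have hZc : Z.Countable := (((Set.toFinite _).countable.union (Set.countable_range _)).union
    (Set.countable_range _)).union (Set.countable_range _)
  obtain ⟨f, hf⟩ := hZc.exists_eq_range ⟨α, by simp [hZ]⟩
  obtain ⟨a, s, b, hasb⟩ := exists_forall_eq_mul_pow_mul f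
  set R := Subring.closure {a, s, b} with hR
  have ha : a ∈ R := Subring.subset_closure (by simp)
  have hs : s ∈ R := Subring.subset_closure (by simp)
  have hb : b ∈ R := Subring.subset_closure (by simp)
  have hZR : ∀ z ∈ Z, z ∈ R := fun z hz => by
    rw [hf] at hz
    obtain ⟨n, rfl⟩ := hz
    rw [hasb]
    exact R.mul_mem (R.mul_mem ha (R.pow_mem hs n)) hb
  have hα : α ∈ R := hZR _ (by simp [hZ])
  have hγ : γ ∈ R := hZR _ (by simp [hZ])
  have hρR : ∀ g, ρ g ∈ R := fun g => hZR _ (by simp [hZ])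
  have hsR : ∀ n i, (E n).s i ∈ R := fun n i => hZR _ (Or.inl (Or.inr ⟨⟨n, i⟩, rfl⟩))
  have htR : ∀ n i, (E n).t i ∈ R := fun n i => hZR _ (Or.inr ⟨⟨n, i⟩, rfl⟩)
  have h2 : CharP R 2 := CharTwo.of_one_ne_zero_of_two_eq_zero one_ne_zero
    (Subtype.ext two_eq_zero_end_binSeq)
  refine ⟨R, inferInstance, h2, inferInstance, fun n => ⟨⟨fun i => ⟨_, hsR n i⟩,
    fun i => ⟨_, htR n i⟩, fun i j => Subtype.ext ?_, Subtype.ext ?_⟩⟩,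
    ⟨fun n => if n = 0 then 1 else if n = 1 then ⟨a, ha⟩ else if n = 2 then ⟨s, hs⟩ else ⟨b, hb⟩,
      4, rfl, ?_⟩,
    { toFun := fun g => ⟨ρ g, hρR g⟩
      map_one' := Subtype.ext (map_one ρ)
      map_mul' := fun g h => Subtype.ext (map_mul ρ g h) }, ⟨α, hα⟩, ⟨γ, hγ⟩,
          fun g => Subtype.ext ?_⟩
  · have := (E n).t_s i j
    split_ifs at this ⊢ <;> exact this
  · simpa using (E n).sum_s_t
  · rw [eq_top_iff]
    rintro ⟨x, hx⟩ -
    induction hx using Subring.closure_induction with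
    | mem x hx =>
      apply Subring.subset_closure
      obtain rfl | rfl | rfl := hx
      exacts [⟨1, by simp, by simp⟩, ⟨2, by simp, by simp⟩, ⟨3, by simp, by simp⟩]
    | zero => exact Subring.zero_mem _
    | one => exact Subring.one_mem _
    | add x y hx hy h1 h2 => exact Subring.add_mem _ h1 h2
    | neg x hx h => exact Subring.neg_mem _ h
    | mul x y hx hy h1 h2 => exact Subring.mul_mem _ h1 h2
  · have := hρ g
    split_ifs at this ⊢ <;> exact this

namespace Frame

section

variable {ι R : Type*} [Fintype ι] [DecidableEq ι] [Ring R] (E : Frame ι R)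

/-- The element of `R` with a given matrix of coordinates. -/
def valMatrix (M : Matrix ι ι R) : R := ∑ i, E.s i * ∑ j, M i j * E.t j

theorem t_valMatrix (M : Matrix ι ι R) (i : ι) : E.t i * E.valMatrix M = ∑ j, M i j * E.t j :=
  E.t_mul_sum i _

theorem t_valMatrix_s (M : Matrix ι ι R) (i j : ι) : E.t i * E.valMatrix M * E.s j = M i j := by
  rw [t_valMatrix, sum_mul_s]

/-- The ring homomorphism sending a matrix to the element with these coordinates. -/
def ofMatrix : Matrix ι ι R →+* R where
  toFun := E.valMatrix
  map_zero' := by simp [valMatrix]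
  map_one' := E.ext_left fun i => E.ext_right fun j => by
    rw [t_valMatrix_s, mul_one, E.t_s, Matrix.one_apply]
  map_add' M N := by simp [valMatrix, add_mul, mul_add, Finset.sum_add_distrib]
  map_mul' M N := E.ext_left fun i => E.ext_right fun k => by
    rw [t_valMatrix_s, ← mul_assoc, t_valMatrix, mul_assoc, Finset.sum_mul, Matrix.mul_apply]
    exact Finset.sum_congr rfl fun j _ => by
      rw [mul_assoc, ← mul_assoc (E.t j), t_valMatrix_s]

theorem twoSidedInvertible_ofMatrix_map [CharP R 2] {M : Matrix ι ι (ZMod 2)} (hM : M ≠ 0) :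
    TwoSidedInvertible (E.ofMatrix ((ZMod.castHom dvd_rfl R).mapMatrix M)) := by
  obtain ⟨i, j, hij⟩ : ∃ i j, M i j ≠ 0 := by
    by_contra! h
    exact hM (Matrix.ext h)
  refine ⟨E.t i, E.s j, (E.t_valMatrix_s _ i j).trans ?_⟩
  have h1 : M i j = 1 := by
    revert hij; generalize M i j = a; revert a; decide
  rw [RingHom.mapMatrix_apply, Matrix.map_apply, h1, map_one]

end

section

variable {R : Type*} [Ring R] [CharP R 2] (E : Frame (Fin 2) R) (u : Rˣ)

theorem diag_inv_mem_commutator : E.diag ![u, u⁻¹] ∈ commutator Rˣ := by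
  have : E.diag ![u, u⁻¹] = ⁅E.diag (Pi.mulSingle 0 u), E.perm (Equiv.swap 0 1)⁆ := by
    apply Units.ext
    rw [val_commutatorElement_eq]
    refine E.ext_right fun i => ?_
    fin_cases i <;>
      simp [mul_assoc, diag_s, perm_s, mul_reassoc (E.diag_s _ _), mul_reassoc (E.perm_s _ _)]
  rw [this]
  exact Subgroup.commutator_mem_commutator (Subgroup.mem_top _) (Subgroup.mem_top _)

theorem diag_pow_s_zero (v : Rˣ) (j : ℕ) :
    ((E.diag ![u, v] : Rˣ) : R) ^ j * E.s 0 = E.s 0 * (u : R) ^ j := by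
  rw [← Units.val_pow_eq_pow_val, ← map_pow, diag_s]; simp

theorem diag_pow_s_one (v : Rˣ) (j : ℕ) :
    ((E.diag ![u, v] : Rˣ) : R) ^ j * E.s 1 = E.s 1 * (v : R) ^ j := by
  rw [← Units.val_pow_eq_pow_val, ← map_pow, diag_s]; simp

theorem t_zero_mul_mul_s_zero {P Q : R} (h : P * E.s 0 = E.s 0 * Q) : E.t 0 * P * E.s 0 = Q := by
  rw [mul_assoc, h, ← mul_assoc, E.t_s_self, one_mul]

theorem sum_inv_pow_eq_zero {p : ℕ} (h : ∑ j ∈ Finset.range p, (u : R) ^ j = 0) :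
    ∑ j ∈ Finset.range p, ((u⁻¹ : Rˣ) : R) ^ j = 0 := by
  rcases p with _ | p
  · simp
  · rw [← Units.mul_left_eq_zero (u ^ p), Finset.sum_mul, ← h, ← Finset.sum_range_reflect]
    refine Finset.sum_congr rfl fun j hj => ?_
    have hj : j ≤ p := Nat.lt_succ_iff.1 (Finset.mem_range.1 hj)
    rw [← Units.val_pow_eq_pow_val, ← Units.val_mul, ← Units.val_pow_eq_pow_val]
    congr 1
    rw [show p + 1 - 1 - j = p - j by omega, inv_pow, inv_mul_eq_iff_eq_mul, ← pow_add]
    congr 1; omega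

theorem twoSidedInvertible_of_corner {P Q : R} (h : P * E.s 0 = E.s 0 * Q)
    (hQ : TwoSidedInvertible Q) : TwoSidedInvertible P := by
  obtain ⟨α, γ, hαγ⟩ := hQ
  refine ⟨α * E.t 0, E.s 0 * γ, ?_⟩
  rw [← mul_assoc, mul_assoc α, mul_assoc α, E.t_zero_mul_mul_s_zero h, hαγ]

theorem isStronglyOfOrder_diag_inv {p : ℕ} (h : ∑ j ∈ Finset.range p, (u : R) ^ j = 0)
    (hk : ∀ k, ¬ p ∣ k → TwoSidedInvertible (∑ j ∈ Finset.range k, (u : R) ^ j)) :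
    IsStronglyOfOrder (E.diag ![u, u⁻¹]) p where
  mem_commutator := E.diag_inv_mem_commutator u
  sum_eq_zero := E.ext_right fun i => by
    fin_cases i
    · simp only [Fin.zero_eta, Finset.sum_mul, diag_pow_s_zero, ← Finset.mul_sum, h, mul_zero,
        zero_mul]
    · simp only [Fin.mk_one, Finset.sum_mul, diag_pow_s_one, ← Finset.mul_sum,
        sum_inv_pow_eq_zero u h, mul_zero, zero_mul]
  twoSidedInvertible k hpk := E.twoSidedInvertible_of_corner (by
    simp only [Finset.sum_mul, diag_pow_s_zero, ← Finset.mul_sum]) (hk k hpk)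

end

end Frame

theorem sum_range_pow_mod {A : Type*} [Ring A] {x : A} {p : ℕ}
    (h : ∑ j ∈ Finset.range p, x ^ j = 0) (k : ℕ) :
    ∑ j ∈ Finset.range k, x ^ j = ∑ j ∈ Finset.range (k % p), x ^ j := by
  have hp : x ^ p = 1 := by
    have := geom_sum_mul x p
    rwa [h, zero_mul, eq_comm, sub_eq_zero] at this
  have hc : ∀ c r, ∑ j ∈ Finset.range (p * c + r), x ^ j = ∑ j ∈ Finset.range r, x ^ j :=
    fun c r => by
      induction c with
      | zero => simp
      | succ c ih =>
        rw [show p * (c + 1) + r = p + (p * c + r) by ring, Finset.sum_range_add, h, zero_add, ← ih]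
        exact Finset.sum_congr rfl fun j _ => by rw [pow_add, hp, one_mul]
  conv_lhs => rw [← Nat.div_add_mod k p, hc]

section GeomSum

open Polynomial

theorem degree_geom_sum_X_lt (n : ℕ) :
    (∑ j ∈ Finset.range n, (X : (ZMod 2)[X]) ^ j).degree < n := by
  rw [degree_lt_iff_coeff_zero]
  intro m hm
  simp only [finsetSum_coeff, coeff_X_pow, Finset.sum_ite_eq, Finset.mem_range]
  rw [if_neg (by omega)]

theorem monic_geom_sum_X (n : ℕ) :
    (∑ j ∈ Finset.range (n + 1), (X : (ZMod 2)[X]) ^ j).Monic := by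
  rw [Finset.sum_range_succ, add_comm]
  exact monic_X_pow_add (degree_geom_sum_X_lt n)

theorem natDegree_geom_sum_X (n : ℕ) :
    (∑ j ∈ Finset.range (n + 1), (X : (ZMod 2)[X]) ^ j).natDegree = n := by
  apply natDegree_eq_of_degree_eq_some
  rw [Finset.sum_range_succ, degree_add_eq_right_of_degree_lt, degree_X_pow]
  rw [degree_X_pow]
  exact degree_geom_sum_X_lt n

theorem exists_unit_sum_pow_eq_zero {R : Type*} [Ring R] [CharP R 2] {n : ℕ}
    (E : Frame (Fin (n + 1)) R) : ∃ u : Rˣ, ∑ j ∈ Finset.range (n + 2), (u : R) ^ j = 0 ∧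
      ∀ k, ¬ n + 2 ∣ k → TwoSidedInvertible (∑ j ∈ Finset.range k, (u : R) ^ j) := by
  set Φ : (ZMod 2)[X] := ∑ j ∈ Finset.range (n + 2), X ^ j with hΦ
  have hmonic : Φ.Monic := monic_geom_sum_X (n + 1)
  have hdeg : Φ.natDegree = n + 1 := natDegree_geom_sum_X (n + 1)
  let b := (AdjoinRoot.powerBasis' hmonic).basis.reindex (finCongr hdeg)
  let Ψ : AdjoinRoot Φ →+* R := (E.ofMatrix.comp (ZMod.castHom dvd_rfl R).mapMatrix).comp
    (Algebra.leftMulMatrix b).toRingHom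
  have hΨ : ∀ a, a ≠ 0 → TwoSidedInvertible (Ψ a) := fun a ha =>
    E.twoSidedInvertible_ofMatrix_map fun h => ha (by
      apply Algebra.leftMulMatrix_injective b
      rw [map_zero]; exact h)
  set x := AdjoinRoot.root Φ with hx
  have hmk : ∀ k, AdjoinRoot.mk Φ (∑ j ∈ Finset.range k, X ^ j) = ∑ j ∈ Finset.range k, x ^ j :=
    fun k => by simp [hx]
  have h0 : ∑ j ∈ Finset.range (n + 2), x ^ j = 0 := by
    rw [← hmk, AdjoinRoot.mk_self]
  have hxp : x ^ (n + 2) = 1 := by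
    have := geom_sum_mul x (n + 2)
    rwa [h0, zero_mul, eq_comm, sub_eq_zero] at this
  have hsum : ∀ k, ∑ j ∈ Finset.range k, Ψ x ^ j = Ψ (∑ j ∈ Finset.range k, x ^ j) := fun k => by
    rw [map_sum]; simp only [map_pow]
  refine ⟨Units.map Ψ (Units.ofPowEqOne x (n + 2) hxp (by omega)), ?_, fun k hk => ?_⟩
  · simp only [Units.coe_map, MonoidHom.coe_coe, Units.val_ofPowEqOne]
    rw [hsum, h0, map_zero]
  · simp only [Units.coe_map, MonoidHom.coe_coe, Units.val_ofPowEqOne]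
    rw [hsum]
    apply hΨ
    rw [sum_range_pow_mod h0, ← hmk, Ne, AdjoinRoot.mk_eq_zero]
    have hr : k % (n + 2) ≠ 0 := fun h => hk (Nat.dvd_of_mod_eq_zero h)
    obtain ⟨r, hr⟩ := Nat.exists_eq_succ_of_ne_zero hr
    have hlt := Nat.mod_lt k (show 0 < n + 2 by omega)
    refine hmonic.not_dvd_of_natDegree_lt ?_ ?_
    · rw [hr]; exact (monic_geom_sum_X r).ne_zero
    · rw [hr, natDegree_geom_sum_X, hdeg]; omega

end GeomSum

/-- Corollary A (first part): every countable group `G` embeds into a simple group `S`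
which, for every `p ∈ {2,3,...} ∪ {∞}` and `q ∈ {3,4,...} ∪ {∞}`, is generated by a
pair of elements of orders `p` and `q` respectively (order `0` encodes `∞`). -/
theorem embedding_into_simple_group_with_two_generators_of_all_orders
    (G : Type) [Group G] [Countable G] :
    ∃ (S : Type) (_ : Group S),
      IsSimpleGroup S ∧
      (∃ φ : G →* S, Function.Injective φ) ∧
      ∀ p q : ℕ, (p = 0 ∨ 2 ≤ p) → (q = 0 ∨ 3 ≤ q) →
        ∃ x y : S, orderOf x = p ∧ orderOf y = q ∧ Subgroup.closure {x, y} = ⊤ := by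
  classical
  obtain ⟨Γ, hΓ, ⟨φ, hφ, hφc⟩, σ, hσ⟩ := exists_countable_embedding G
  obtain ⟨R, _, _, _, hR, ⟨g, d, hg, hclosure⟩, ρ, α, γ, hαγ⟩ := exists_finitelyGenerated_ring Γ
  have hadd : ∀ x : Γ, x ≠ 1 → TwoSidedInvertible (ρ x + 1) := fun x hx => ⟨α, γ, by
    have h1 := hαγ 1
    rw [if_pos rfl, map_one, mul_one] at h1
    rw [mul_add, add_mul, hαγ, if_neg hx, mul_one, h1, zero_add]⟩
  have hu : ∀ j : ℕ, ((ρ.toHomUnits σ : Rˣ) : R) ^ j = ρ (σ ^ j) := fun j => by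
    rw [map_pow, MonoidHom.coe_toHomUnits]
  obtain ⟨E⟩ := hR 1
  refine exists_isSimpleGroup_of_ring (θ := E.diag ![ρ.toHomUnits σ, (ρ.toHomUnits σ)⁻¹]) hR hg
    hclosure (fun p hp => ?_) (E.diag_inv_mem_commutator _) (fun l hl => ?_)
    (ρ.toHomUnits.comp φ) (fun x => map_mem_commutator ρ.toHomUnits (hφc x)) (fun x hx => ?_)
  · rcases p with _ | _ | p
    · refine ⟨_, E.isStronglyOfOrder_diag_inv (ρ.toHomUnits σ) (by simp) fun k hk => ⟨α, γ, ?_⟩⟩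
      obtain ⟨k, rfl⟩ := Nat.exists_eq_succ_of_ne_zero fun h : k = 0 => hk (h ▸ dvd_rfl)
      simp only [hu, Finset.mul_sum, Finset.sum_mul, hαγ]
      rw [Finset.sum_range_succ', pow_zero, if_pos rfl, Finset.sum_eq_zero, zero_add]
      exact fun j _ => if_neg (hσ _ j.succ_ne_zero)
    · exact absurd rfl hp
    · obtain ⟨F⟩ := hR p
      obtain ⟨u, h0, hu⟩ := exists_unit_sum_pow_eq_zero F
      exact ⟨_, E.isStronglyOfOrder_diag_inv u h0 hu⟩
  · refine E.twoSidedInvertible_of_corner ?_ (hadd _ (hσ l hl))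
    rw [add_mul, Units.val_pow_eq_pow_val, E.diag_pow_s_zero, hu, mul_add, one_mul, mul_one]
  · exact hadd _ ((map_ne_one_iff φ hφ).2 hx)
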